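/- Power of two choices with simple tabulation: for every constant c ≥ 1 there exist constants C and, for every constant γ > 0, a constant C_γ such that the following holds. Let n be a power of two and let h_0, h_1 : Σ^c → [n] be independent random simple tabulation hash functions. Place n balls with distinct keys from Σ^c sequentially (in any fixed order) into n bins, putting each ball x into the lighter-loaded of bins h_0(x) and h_1(x) at the time of its insertion (ties broken by any fixed rule). Then the expected maximum load of any bin is at most log₂ log₂ n + C, and with probability at least 1 − n^{−γ} the maximum load is at most C_γ · log log n. -/

import Mathlib

open scoped Classical
open Finset

/-- Bit strings of length `n`, identified with `(𝔽₂)^n`; bitwise XOR is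
coordinatewise addition in `ZMod 2`.  This models the set `[2^n]`. -/
abbrev Bits (n : ℕ) : Type := Fin n → ZMod 2

/-- Probability of an event under the uniform distribution on a finite sample space. -/
noncomputable def Pr {Ω : Type*} [Fintype Ω] (E : Ω → Prop) : ℝ :=
  ((Finset.univ.filter E).card : ℝ) / (Fintype.card Ω : ℝ)

/-- Expectation of a real random variable under the uniform distribution on a finite
sample space. -/
noncomputable def Ex {Ω : Type*} [Fintype Ω] (f : Ω → ℝ) : ℝ :=
  (∑ ω, f ω) / (Fintype.card Ω : ℝ)

/-- Simple tabulation hashing with `c` random character tables. -/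
def simpleTab {c : ℕ} {A R : Type*} [AddCommMonoid R] (T : Fin c → A → R) (x : Fin c → A) : R :=
  ∑ i, T i (x i)

/-- The two-choice insertion process: `n = 2^t` balls `ball 0, ball 1, …` are inserted
sequentially into `2^t` bins; ball `i` goes into the lighter loaded of bins
`h₀ (ball i)` and `h₁ (ball i)` at the time of its insertion, ties being broken by the
fixed rule `rule` (which may depend on the ball and the current loads).
`twoChoiceLoad h₀ h₁ ball rule i` is the load vector after the first `i` insertions. -/
noncomputable def twoChoiceLoad {K : Type*} {t : ℕ} (h₀ h₁ : K → Bits t)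
    (ball : Fin (2 ^ t) → K) (rule : Fin (2 ^ t) → (Bits t → ℕ) → Bool) :
    ℕ → Bits t → ℕ
  | 0 => fun _ => 0
  | (i + 1) =>
    let L := twoChoiceLoad h₀ h₁ ball rule i
    if hi : i < 2 ^ t then
      let x := ball ⟨i, hi⟩
      let b :=
        if L (h₀ x) < L (h₁ x) then h₀ x
        else if L (h₁ x) < L (h₀ x) then h₁ x
        else if rule ⟨i, hi⟩ L then h₀ x else h₁ x
      Function.update L b (L b + 1)
    else L

namespace TC

abbrev Om (c s t : ℕ) := (Fin c → Bits s → Bits t) × (Fin c → Bits s → Bits t)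
abbrev JJ (c s : ℕ) := Option (Bool × Fin c × Bits s)
abbrev Vec (c s : ℕ) := JJ c s → ZMod 2

def evec {c s : ℕ} (b : Bool) (y : Fin c → Bits s) : Vec c s
  | none => 0
  | some (b', k, a) => if b' = b ∧ y k = a then 1 else 0

def rvec {c s : ℕ} : Vec c s
  | none => 1
  | some _ => 0

def mkH {c s t : ℕ} (T : Om c s t) (ρ : Bits t) : JJ c s → Bits t
  | none => ρ
  | some (false, k, a) => T.1 k a
  | some (true, k, a) => T.2 k a

def ev {c s t : ℕ} (H : JJ c s → Bits t) (f : Vec c s) : Bits t := ∑ j, f j • H j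

def hs {c s t : ℕ} (T : Om c s t) (b : Bool) (y : Fin c → Bits s) : Bits t :=
  if b then simpleTab T.2 y else simpleTab T.1 y

lemma ev_add {c s t : ℕ} (H : JJ c s → Bits t) (f g : Vec c s) :
    ev H (f + g) = ev H f + ev H g := by
  simp [ev, add_smul, Finset.sum_add_distrib]

lemma ev_addH {c s t : ℕ} (H H' : JJ c s → Bits t) (f : Vec c s) :
    ev (H + H') f = ev H f + ev H' f := by
  simp [ev, smul_add, Finset.sum_add_distrib]

lemma ev_rvec {c s t : ℕ} (T : Om c s t) (ρ : Bits t) : ev (mkH T ρ) rvec = ρ := by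
  simp only [ev, Fintype.sum_option]
  simp [rvec, mkH]

lemma ev_evec {c s t : ℕ} (T : Om c s t) (ρ : Bits t) (b : Bool) (y : Fin c → Bits s) :
    ev (mkH T ρ) (evec b y) = hs T b y := by
  simp only [ev, Fintype.sum_option, Fintype.sum_prod_type]
  cases b <;> simp [evec, mkH, hs, simpleTab]

lemma ev_sum {c s t : ℕ} (H : JJ c s → Bits t) (A : Finset ℕ) (φ : ℕ → Vec c s) :
    ev H (∑ m ∈ A, φ m) = ∑ m ∈ A, ev H (φ m) := by
  induction A using Finset.induction_on with
  | empty => simp [ev]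
  | insert a A ha ih => rw [Finset.sum_insert ha, Finset.sum_insert ha, ev_add, ih]

lemma bits_add_self {t : ℕ} (v : Bits t) : v + v = 0 := by
  funext i; exact CharTwo.add_self_eq_zero (v i)

lemma exists_H {c s t : ℕ} (φ : ℕ → Vec c s) (A : Finset ℕ)
    (hli : LinearIndepOn (ZMod 2) φ (A : Set ℕ)) (y : ℕ → Bits t) :
    ∃ H : JJ c s → Bits t, ∀ m ∈ A, ev H (φ m) = y m := by
  have hli' : LinearIndependent (ZMod 2) (fun m : (A : Set ℕ) => φ m) := hli
  obtain ⟨g, hg⟩ := LinearMap.exists_extend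
    ((Module.Basis.span hli').constr (ZMod 2) (fun m : (A : Set ℕ) => y m))
  refine ⟨fun j => g (Pi.single j 1), fun m hm => ?_⟩
  have h1 : ev (fun j => g (Pi.single j 1)) (φ m) = g (φ m) := by
    simp only [ev, ← map_smul, ← map_sum]
    congr 1
    ext j
    simp [Finset.sum_apply, Pi.single_apply]
  rw [h1]
  have h2 := (Module.Basis.span hli').constr_basis (ZMod 2) (fun m : (A : Set ℕ) => y m) ⟨m, hm⟩
  rw [← hg] at h2
  simpa [Module.Basis.span_apply] using h2

lemma linProb {c s t : ℕ} (φ : ℕ → Vec c s) (A : Finset ℕ)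
    (hli : LinearIndepOn (ZMod 2) φ (A : Set ℕ)) :
    (univ.filter (fun H : JJ c s → Bits t => ∀ m ∈ A, ev H (φ m) = 0)).card * (2 ^ t) ^ A.card
      ≤ Fintype.card (JJ c s → Bits t) := by
  choose σ hσ using fun y : ℕ → Bits t => exists_H (t := t) φ A hli y
  have hc : (2 ^ t) ^ A.card = (Finset.univ : Finset (A → Bits t)).card := by
    simp
  rw [hc, ← Finset.card_product, ← Finset.card_univ]
  let ext : (A → Bits t) → ℕ → Bits t := fun y m => if h : m ∈ A then y ⟨m, h⟩ else 0
  refine Finset.card_le_card_of_injOn (fun q => q.1 + σ (ext q.2)) (by simp) ?_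
  rintro ⟨H, y⟩ h1 ⟨H', y'⟩ h2 h
  simp only [coe_product, Set.mem_prod, mem_coe, mem_filter, mem_univ, true_and, and_true] at h1 h2 h
  have hy : y = y' := by
    funext ⟨m, hm⟩
    have := congrArg (fun G => ev G (φ m)) h
    simp only [ev_addH, h1 m hm, h2 m hm, zero_add, hσ _ m hm] at this
    simpa [ext, hm] using this
  subst hy
  have := add_right_cancel h
  simp [this]

section tree
variable {c s t : ℕ}

/-- vertex vector -/
def vv (ball : Fin (2 ^ t) → Fin c → Bits s) (x : ℕ → Fin (2 ^ t)) (l : ℕ → Bool)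
    (m : ℕ) : Vec c s := if m = 0 then rvec else evec (!l m) (ball (x m))

def ph (par : ℕ → ℕ) (ball : Fin (2 ^ t) → Fin c → Bits s) (x : ℕ → Fin (2 ^ t)) (l : ℕ → Bool)
    (m : ℕ) : Vec c s := evec (l m) (ball (x m)) + vv ball x l (par m)

/-- vertex bin -/
def VV (ball : Fin (2 ^ t) → Fin c → Bits s) (T : Om c s t) (ρ : Bits t)
    (x : ℕ → Fin (2 ^ t)) (l : ℕ → Bool) (m : ℕ) : Bits t :=
  if m = 0 then ρ else hs T (!l m) (ball (x m))

def Realized (par : ℕ → ℕ) (ball : Fin (2 ^ t) → Fin c → Bits s) (T : Om c s t) (ρ : Bits t)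
    (x : ℕ → Fin (2 ^ t)) (l : ℕ → Bool) (A : Finset ℕ) : Prop :=
  ∀ m ∈ A, hs T (l m) (ball (x m)) = VV ball T ρ x l (par m)

lemma ev_vv (ball : Fin (2 ^ t) → Fin c → Bits s) (T : Om c s t) (ρ : Bits t)
    (x : ℕ → Fin (2 ^ t)) (l : ℕ → Bool) (m : ℕ) :
    ev (mkH T ρ) (vv ball x l m) = VV ball T ρ x l m := by
  unfold vv VV
  split_ifs
  · exact ev_rvec T ρ
  · exact ev_evec T ρ _ _

lemma ev_ph (par : ℕ → ℕ) (ball : Fin (2 ^ t) → Fin c → Bits s) (T : Om c s t) (ρ : Bits t)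
    (x : ℕ → Fin (2 ^ t)) (l : ℕ → Bool) (m : ℕ) :
    ev (mkH T ρ) (ph par ball x l m) = 0 ↔
      hs T (l m) (ball (x m)) = VV ball T ρ x l (par m) := by
  rw [ph, ev_add, ev_vv, ev_evec]
  constructor
  · intro h
    have := congrArg (· + VV ball T ρ x l (par m)) h
    simpa [add_assoc, bits_add_self] using this
  · intro h; rw [h, bits_add_self]

lemma mkH_inj : Function.Injective (fun q : Om c s t × Bits t => mkH q.1 q.2) := by
  rintro ⟨⟨T1, T2⟩, ρ⟩ ⟨⟨T1', T2'⟩, ρ'⟩ h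
  have h0 := congrFun h none
  have h1 : T1 = T1' := by funext k a; exact congrFun h (some (false, k, a))
  have h2 : T2 = T2' := by funext k a; exact congrFun h (some (true, k, a))
  have h3 : ρ = ρ' := h0
  simp [h1, h2, h3]

lemma card_HH : Fintype.card (JJ c s → Bits t) = 2 ^ t * Fintype.card (Om c s t) := by
  simp only [Fintype.card_fun, Fintype.card_option, Fintype.card_prod, Fintype.card_bool,
    Fintype.card_fin, ZMod.card]
  rw [pow_succ, mul_comm]
  simp only [← pow_mul, ← pow_add]
  congr 1
  ring

lemma countT (par : ℕ → ℕ) (ball : Fin (2 ^ t) → Fin c → Bits s) (A : Finset ℕ)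
    (X : Finset ((ℕ → Fin (2 ^ t)) × (ℕ → Bool)))
    (hX : ∀ q ∈ X, LinearIndepOn (ZMod 2) (ph par ball q.1 q.2) (A : Set ℕ)) :
    (univ.filter (fun T : Om c s t => ∃ ρ, ∃ q ∈ X, Realized par ball T ρ q.1 q.2 A)).card
      * (2 ^ t) ^ A.card ≤ X.card * (2 ^ t * Fintype.card (Om c s t)) := by
  have h1 : (univ.filter (fun T : Om c s t => ∃ ρ, ∃ q ∈ X, Realized par ball T ρ q.1 q.2 A)).card
      ≤ (X.biUnion (fun q => univ.filter (fun H : JJ c s → Bits t =>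
        ∀ m ∈ A, ev H (ph par ball q.1 q.2 m) = 0))).card := by
    let r : Om c s t → Bits t := fun T =>
      if h : ∃ ρ, ∃ q ∈ X, Realized par ball T ρ q.1 q.2 A then h.choose else 0
    refine Finset.card_le_card_of_injOn (fun T => mkH T (r T)) ?_ ?_
    · intro T hT
      simp only [coe_filter, mem_univ, true_and, Set.mem_ofPred_eq] at hT
      have h2 : r T = hT.choose := dif_pos hT
      obtain ⟨q, hq, h3⟩ := hT.choose_spec
      simp only [coe_biUnion, Set.mem_iUnion, mem_coe, mem_filter, mem_univ, true_and]
      refine ⟨q, hq, fun m hm => ?_⟩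
      rw [ev_ph, h2]
      exact h3 m hm
    · intro T _ T' _ h
      have := @mkH_inj c s t (T, r T) (T', r T') h
      exact (Prod.mk.inj this).1
  calc _ ≤ (∑ q ∈ X, (univ.filter (fun H : JJ c s → Bits t =>
        ∀ m ∈ A, ev H (ph par ball q.1 q.2 m) = 0)).card) * (2 ^ t) ^ A.card :=
        Nat.mul_le_mul_right _ (h1.trans Finset.card_biUnion_le)
    _ = ∑ q ∈ X, (univ.filter (fun H : JJ c s → Bits t =>
        ∀ m ∈ A, ev H (ph par ball q.1 q.2 m) = 0)).card * (2 ^ t) ^ A.card := by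
        rw [Finset.sum_mul]
    _ ≤ ∑ q ∈ X, (2 ^ t * Fintype.card (Om c s t)) := by
        refine Finset.sum_le_sum fun q hq => ?_
        rw [← card_HH]
        exact linProb _ A (hX q hq)
    _ = _ := by simp

lemma li_of_tri {V : Type*} [AddCommGroup V] [Module (ZMod 2) V] (φ : ℕ → V) (A : Finset ℕ)
    (h : ∀ m ∈ A, φ m ∉ Submodule.span (ZMod 2) (φ '' {m' | m' ∈ A ∧ m' < m})) :
    LinearIndepOn (ZMod 2) φ (A : Set ℕ) := by
  induction A using Finset.induction_on_max with
  | empty => simp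
  | insert a A ha ih =>
    have haA : a ∉ (A : Set ℕ) := fun h => lt_irrefl _ (ha a h)
    rw [Finset.coe_insert, linearIndepOn_insert haA]
    constructor
    · apply ih
      intro m hm hsp
      refine h m (mem_insert_of_mem hm) (Submodule.span_mono (Set.image_mono ?_) hsp)
      rintro m' ⟨h1, h2⟩
      exact ⟨mem_insert_of_mem h1, h2⟩
    · intro hsp
      refine h a (mem_insert_self _ _) (Submodule.span_mono (Set.image_mono ?_) hsp)
      intro m' h1
      exact ⟨mem_insert_of_mem h1, ha m' h1⟩

/-- span over `ZMod 2` gives a subset sum. -/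
lemma mem_span_sum {V : Type*} [AddCommGroup V] [Module (ZMod 2) V] (φ : ℕ → V) (A : Finset ℕ)
    (v : V) (h : v ∈ Submodule.span (ZMod 2) (φ '' (A : Set ℕ))) :
    ∃ Q ⊆ A, v = ∑ m ∈ Q, φ m := by
  induction A using Finset.induction_on generalizing v with
  | empty => exact ⟨∅, by simp, by simpa using h⟩
  | insert a A ha ih =>
    rw [Finset.coe_insert, Set.image_insert_eq, Submodule.mem_span_insert] at h
    obtain ⟨z, w, hw, rfl⟩ := h
    obtain ⟨Q, hQ, rfl⟩ := ih w hw
    have : z = 0 ∨ z = 1 := by revert z; decide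
    rcases this with h | h
    · exact ⟨Q, hQ.trans (Finset.subset_insert _ _), by simp [h]⟩
    · refine ⟨insert a Q, Finset.insert_subset_insert _ hQ, ?_⟩
      rw [Finset.sum_insert (fun h => ha (hQ h)), h, one_smul]

end tree
end TC

namespace TC
section proc
variable {c s t : ℕ}

noncomputable def LL (ball : Fin (2 ^ t) → Fin c → Bits s)
    (rule : Fin (2 ^ t) → (Bits t → ℕ) → Bool) (T : Om c s t) (i : ℕ) : Bits t → ℕ :=
  twoChoiceLoad (simpleTab T.1) (simpleTab T.2) ball rule i

lemma LL_step (ball : Fin (2 ^ t) → Fin c → Bits s)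
    (rule : Fin (2 ^ t) → (Bits t → ℕ) → Bool) (T : Om c s t) (i : ℕ) (b : Bits t) :
    LL ball rule T (i+1) b = LL ball rule T i b ∨
    (LL ball rule T (i+1) b = LL ball rule T i b + 1 ∧ ∃ hi : i < 2 ^ t, ∃ σ : Bool,
      hs T σ (ball ⟨i, hi⟩) = b ∧ LL ball rule T i b ≤ LL ball rule T i (hs T (!σ) (ball ⟨i, hi⟩))) := by
  by_cases hi : i < 2 ^ t
  swap
  · left; simp [LL, twoChoiceLoad, hi]
  have key : LL ball rule T (i+1) = (let L := LL ball rule T i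
      let x := ball ⟨i, hi⟩
      let b := if L (simpleTab T.1 x) < L (simpleTab T.2 x) then simpleTab T.1 x
        else if L (simpleTab T.2 x) < L (simpleTab T.1 x) then simpleTab T.2 x
        else if rule ⟨i, hi⟩ L then simpleTab T.1 x else simpleTab T.2 x
      Function.update L b (L b + 1)) := by
    simp only [LL]
    rw [twoChoiceLoad]
    exact dif_pos hi
  simp only at key
  rw [key]
  set L := LL ball rule T i
  by_cases hb : b = (if L (simpleTab T.1 (ball ⟨i, hi⟩)) < L (simpleTab T.2 (ball ⟨i, hi⟩)) then simpleTab T.1 (ball ⟨i, hi⟩)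
        else if L (simpleTab T.2 (ball ⟨i, hi⟩)) < L (simpleTab T.1 (ball ⟨i, hi⟩)) then simpleTab T.2 (ball ⟨i, hi⟩)
        else if rule ⟨i, hi⟩ L then simpleTab T.1 (ball ⟨i, hi⟩) else simpleTab T.2 (ball ⟨i, hi⟩))
  · right
    refine ⟨by rw [← hb]; simp, hi, ?_⟩
    split_ifs at hb with h1 h2 h3
    · exact ⟨false, by simp [hs, hb], by simp [hs, hb]; omega⟩
    · exact ⟨true, by simp [hs, hb], by simp [hs, hb]; omega⟩
    · exact ⟨false, by simp [hs, hb], by simp [hs, hb]; omega⟩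
    · exact ⟨true, by simp [hs, hb], by simp [hs, hb]; omega⟩
  · left
    exact Function.update_of_ne hb _ _

lemma LL_mono (ball : Fin (2 ^ t) → Fin c → Bits s)
    (rule : Fin (2 ^ t) → (Bits t → ℕ) → Bool) (T : Om c s t) (b : Bits t) :
    Monotone (fun i => LL ball rule T i b) := by
  refine monotone_nat_of_le_succ fun i => ?_
  rcases LL_step ball rule T i b with h | ⟨h, _⟩ <;> simp only [h] <;> omega

lemma LL_le (ball : Fin (2 ^ t) → Fin c → Bits s)
    (rule : Fin (2 ^ t) → (Bits t → ℕ) → Bool) (T : Om c s t) (b : Bits t) (i : ℕ) :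
    LL ball rule T i b ≤ i := by
  induction i with
  | zero => simp [LL, twoChoiceLoad]
  | succ i ih => rcases LL_step ball rule T i b with h | ⟨h, _⟩ <;> omega

lemma LL_find (ball : Fin (2 ^ t) → Fin c → Bits s)
    (rule : Fin (2 ^ t) → (Bits t → ℕ) → Bool) (T : Om c s t) (i : ℕ) (b : Bits t) (j : ℕ)
    (h : j < LL ball rule T i b) :
    ∃ τ : Fin (2 ^ t), (τ : ℕ) < i ∧ LL ball rule T τ b = j ∧ ∃ σ : Bool,
      hs T σ (ball τ) = b ∧ j ≤ LL ball rule T τ (hs T (!σ) (ball τ)) := by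
  induction i with
  | zero => simp [LL, twoChoiceLoad] at h
  | succ i ih =>
    by_cases hj : j < LL ball rule T i b
    · obtain ⟨τ, h1, h2⟩ := ih hj
      exact ⟨τ, by omega, h2⟩
    · rcases LL_step ball rule T i b with h' | ⟨h', hi, σ, h1, h2⟩
      · omega
      · have : LL ball rule T i b = j := by omega
        exact ⟨⟨i, hi⟩, by simp, this, σ, h1, by simpa [this] using h2⟩

lemma realize (ball : Fin (2 ^ t) → Fin c → Bits s)
    (rule : Fin (2 ^ t) → (Bits t → ℕ) → Bool) (T : Om c s t)
    (par ht lev : ℕ → ℕ) (Nd : Finset ℕ)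
    (h0 : ∀ m ∈ Nd, 0 < m ∧ par m < m ∧ (par m = 0 ∨ par m ∈ Nd) ∧ lev m < ht (par m) ∧ ht m ≤ lev m)
    (hsib : ∀ m ∈ Nd, ∀ m' ∈ Nd, par m = par m' → m < m' → lev m' < lev m)
    (ρ : Bits t) (hρ : ht 0 ≤ LL ball rule T (2 ^ t) ρ) :
    ∃ (x : ℕ → Fin (2 ^ t)) (l : ℕ → Bool), Realized par ball T ρ x l Nd ∧
      (∀ m ∈ Nd, par m ≠ 0 → x m < x (par m)) ∧
      (∀ m ∈ Nd, ∀ m' ∈ Nd, par m = par m' → m < m' → x m' < x m) := by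
  have main : ∀ N : ℕ, ∃ (x : ℕ → Fin (2 ^ t)) (l : ℕ → Bool), ∀ m ∈ Nd, m < N →
      hs T (l m) (ball (x m)) = VV ball T ρ x l (par m) ∧
      LL ball rule T (x m) (VV ball T ρ x l (par m)) = lev m ∧
      lev m ≤ LL ball rule T (x m) (VV ball T ρ x l m) ∧
      (par m ≠ 0 → x m < x (par m)) := by
    intro N
    induction N with
    | zero => exact ⟨fun _ => ⟨0, by positivity⟩, fun _ => true, by simp⟩
    | succ N ih =>
      obtain ⟨x, l, hx⟩ := ih
      by_cases hN : N ∈ Nd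
      swap
      · refine ⟨x, l, fun m hm hmN => hx m hm ?_⟩
        have : m ≠ N := fun h => hN (h ▸ hm)
        omega
      obtain ⟨a1, a2, a3, a4, a5⟩ := h0 N hN
      have hex : ∃ τ : Fin (2 ^ t), (par N ≠ 0 → τ < x (par N)) ∧
          LL ball rule T τ (VV ball T ρ x l (par N)) = lev N ∧ ∃ σ : Bool,
          hs T σ (ball τ) = VV ball T ρ x l (par N) ∧
          lev N ≤ LL ball rule T τ (hs T (!σ) (ball τ)) := by
        by_cases hp : par N = 0
        · have : lev N < LL ball rule T (2 ^ t) (VV ball T ρ x l (par N)) := by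
            rw [hp] at a4 ⊢
            simp only [VV, if_pos]
            omega
          obtain ⟨τ, -, h2⟩ := LL_find ball rule T _ _ _ this
          exact ⟨τ, fun h => absurd hp h, h2⟩
        · have hpN : par N ∈ Nd := by tauto
          obtain ⟨b1, b2, b3, b4⟩ := hx (par N) hpN a2
          have := (h0 _ hpN).2.2.2.2
          obtain ⟨τ, h1, h2⟩ := LL_find ball rule T (x (par N)) (VV ball T ρ x l (par N)) (lev N)
            (by omega)
          exact ⟨τ, fun _ => h1, h2⟩
      obtain ⟨τ, c1, c2, σ, c3, c4⟩ := hex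
      refine ⟨Function.update x N τ, Function.update l N σ, ?_⟩
      have hV : ∀ m, m ≠ N → VV ball T ρ (Function.update x N τ) (Function.update l N σ) m
          = VV ball T ρ x l m := by
        intro m hm; simp [VV, Function.update_of_ne hm]
      intro m hm hmN
      by_cases hmN' : m = N
      · subst hmN'
        rw [hV _ (by omega)]
        simp only [Function.update_self]
        rw [Function.update_of_ne (by omega)]
        refine ⟨c3, c2, ?_, c1⟩
        simpa [VV, a1.ne'] using c4
      · have hpm := (h0 m hm).2.1
        rw [hV _ hmN', hV _ (by omega)]
        rw [Function.update_of_ne hmN', Function.update_of_ne hmN', Function.update_of_ne (by omega)]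
        exact hx m hm (by omega)
  obtain ⟨x, l, hx⟩ := main (Nd.sup id + 1)
  have hb : ∀ m ∈ Nd, m < Nd.sup id + 1 := fun m hm =>
    Nat.lt_succ_of_le (Finset.le_sup (f := id) hm)
  refine ⟨x, l, fun m hm => (hx m hm (hb m hm)).1, fun m hm => (hx m hm (hb m hm)).2.2.2, ?_⟩
  intro m hm m' hm' hp hlt
  by_contra hle
  push Not at hle
  have e1 := (hx m hm (hb m hm)).2.1
  have e2 := (hx m' hm' (hb m' hm')).2.1
  have := LL_mono ball rule T (VV ball T ρ x l (par m)) (show (x m : ℕ) ≤ x m' from hle)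
  simp only at this
  rw [e1, hp, e2] at this
  have := hsib m hm m' hm' hp hlt
  omega
end proc
end TC

namespace TC

/-! functions supported on a finite set -/
noncomputable def Fn {α : Type} [Fintype α] (d : α) (A : Finset ℕ) : Finset (ℕ → α) :=
  (univ : Finset (A → α)).image (fun y m => if h : m ∈ A then y ⟨m, h⟩ else d)

lemma mem_Fn {α : Type} [Fintype α] (d : α) (A : Finset ℕ) (x : ℕ → α) :
    x ∈ Fn d A ↔ ∀ m ∉ A, x m = d := by
  simp only [Fn, mem_image, mem_univ, true_and]
  constructor
  · rintro ⟨y, rfl⟩ m hm; simp [hm]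
  · intro h
    refine ⟨fun m => x m, ?_⟩
    funext m
    by_cases hm : m ∈ A
    · simp [hm]
    · simp [hm, h m hm]

lemma card_Fn {α : Type} [Fintype α] (d : α) (A : Finset ℕ) :
    (Fn d A).card = Fintype.card α ^ A.card := by
  rw [Fn, Finset.card_image_of_injective]
  · simp
  · intro y y' h
    funext ⟨m, hm⟩
    simpa [hm] using congrFun h m

noncomputable def trunc {α : Type} (d : α) (A : Finset ℕ) (x : ℕ → α) : ℕ → α :=
  fun m => if m ∈ A then x m else d

lemma trunc_mem {α : Type} [Fintype α] (d : α) (A : Finset ℕ) (x : ℕ → α) :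
    trunc d A x ∈ Fn d A := by
  rw [mem_Fn]; intro m hm; simp [trunc, hm]

/-- functions on `U ∪ N` agreeing with `g` on `U` -/
lemma card_fib {α : Type} [Fintype α] (d : α) (U N : Finset ℕ) (g : ℕ → α)
    (S : Finset (ℕ → α)) (hS : ∀ x ∈ S, x ∈ Fn d (U ∪ N) ∧ ∀ m ∈ U, x m = g m) :
    S.card ≤ Fintype.card α ^ N.card := by
  rw [← card_Fn d N]
  refine Finset.card_le_card_of_injOn (trunc d N) (fun x _ => trunc_mem d N x) ?_
  intro x hx y hy h
  funext m
  obtain ⟨hx1, hx2⟩ := hS x hx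
  obtain ⟨hy1, hy2⟩ := hS y hy
  rw [mem_Fn] at hx1 hy1
  by_cases hU : m ∈ U
  · rw [hx2 m hU, hy2 m hU]
  by_cases hN : m ∈ N
  · have := congrFun h m
    simpa [trunc, hN] using this
  · rw [hx1 m (by simp [hU, hN]), hy1 m (by simp [hU, hN])]

lemma card_fibZ {α : Type} [Fintype α] (d : α) (U N : Finset ℕ) (hUN : Disjoint U N) (g : ℕ → α)
    (S : Finset (ℕ → α)) (hS : ∀ x ∈ S, x ∈ Fn d (U ∪ N) ∧ ∀ m ∈ U, x m = g m)
    (m : ℕ) (hm : m ∈ N) (Z : (ℕ → α) → Finset α) (hZ : ∀ x ∈ S, x m ∈ Z (Function.update x m d))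
    (q : ℕ) (hq : ∀ f, (Z f).card * q ≤ Fintype.card α) :
    S.card * q ≤ Fintype.card α ^ N.card := by
  have h1 : (S.image (fun x => Function.update x m d)).card ≤ Fintype.card α ^ (N.erase m).card := by
    refine card_fib d U (N.erase m) g _ ?_
    intro f hf
    obtain ⟨x, hx, rfl⟩ := Finset.mem_image.1 hf
    obtain ⟨hx1, hx2⟩ := hS x hx
    rw [mem_Fn] at hx1 ⊢
    constructor
    · intro a ha
      by_cases ham : a = m
      · subst ham; simp
      · rw [Function.update_of_ne ham]
        apply hx1
        simp only [mem_union, mem_erase, not_or, not_and] at ha ⊢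
        exact ⟨ha.1, ha.2 ham⟩
    · intro a ha
      have : a ≠ m := fun h => Finset.disjoint_left.1 hUN ha (h ▸ hm)
      rw [Function.update_of_ne this, hx2 a ha]
  have h2 : S.card * q ≤ (S.image (fun x => Function.update x m d)).card * Fintype.card α := by
    rw [Finset.card_eq_sum_card_image (fun x => Function.update x m d) S, Finset.sum_mul,
      ← smul_eq_mul (a := Finset.card _), ← Finset.sum_const]
    refine Finset.sum_le_sum fun f hf => ?_
    refine le_trans (Nat.mul_le_mul_right q ?_) (hq f)
    refine Finset.card_le_card_of_injOn (fun x => x m) ?_ ?_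
    · intro x hx
      simp only [coe_filter, Set.mem_ofPred_eq] at hx
      rw [← hx.2]
      exact hZ x hx.1
    · intro x hx y hy h
      simp only [coe_filter, Set.mem_ofPred_eq] at hx hy
      have := hx.2.trans hy.2.symm
      funext a
      by_cases ha : a = m
      · rw [ha]; exact h
      · simpa [Function.update_of_ne ha] using congrFun this a
  refine h2.trans ((Nat.mul_le_mul_right _ h1).trans ?_)
  rw [← pow_succ, Finset.card_erase_add_one hm]

section
variable {c s t : ℕ}

noncomputable def deg (ball : Fin (2 ^ t) → Fin c → Bits s) (k : Fin c) (a : Bits s) : ℕ :=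
  (univ.filter (fun i => ball i k = a)).card

def Light (w : ℕ) (ball : Fin (2 ^ t) → Fin c → Bits s) (k : Fin c) (a : Bits s) : Prop :=
  deg ball k a * 2 ^ w ≤ 2 ^ t

lemma card_heavy (w : ℕ) (ball : Fin (2 ^ t) → Fin c → Bits s) (k : Fin c) :
    (univ.filter (fun a => ¬ Light w ball k a)).card ≤ 2 ^ w := by
  have h1 : ∑ a : Bits s, deg ball k a = 2 ^ t := by
    have := Finset.card_eq_sum_card_fiberwise (f := fun i => ball i k) (s := univ) (t := univ)
      (by intro i _; simp)
    simp only [card_univ, Fintype.card_fin] at this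
    rw [this]; rfl
  have h2 : (univ.filter (fun a => ¬ Light w ball k a)).card * 2 ^ t ≤ 2 ^ t * 2 ^ w := by
    rw [← h1, ← smul_eq_mul (a := Finset.card _), ← Finset.sum_const, Finset.sum_mul]
    refine le_trans (Finset.sum_le_sum (g := fun a => deg ball k a * 2 ^ w) ?_)
      (Finset.sum_le_sum_of_subset (Finset.subset_univ _))
    intro a ha
    simp only [Light, mem_filter, mem_univ, true_and, not_le] at ha
    rw [h1]; exact ha.le
  have : 0 < 2 ^ t := by positivity
  nlinarith

lemma card_allheavy (w : ℕ) (hw : w * (c + 1) ≤ t) (ball : Fin (2 ^ t) → Fin c → Bits s)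
    (hb : Function.Injective ball) :
    (univ.filter (fun i => ∀ k, ¬ Light w ball k (ball i k))).card * 2 ^ w ≤ 2 ^ t := by
  have h1 : (univ.filter (fun i => ∀ k, ¬ Light w ball k (ball i k))).card ≤
      (Fintype.piFinset (fun k => univ.filter (fun a => ¬ Light w ball k a))).card := by
    refine Finset.card_le_card_of_injOn ball ?_ (hb.injOn)
    intro i hi
    simpa using hi
  have h2 : (Fintype.piFinset (fun k => univ.filter (fun a => ¬ Light w ball k a))).card
      ≤ (2 ^ w) ^ c := by
    rw [Fintype.card_piFinset]
    refine (Finset.prod_le_prod' (fun k _ => card_heavy w ball k)).trans ?_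
    simp
  calc _ ≤ (2 ^ w) ^ c * 2 ^ w := Nat.mul_le_mul_right _ (h1.trans h2)
    _ = 2 ^ (w * (c + 1)) := by rw [← pow_succ, ← pow_mul]
    _ ≤ 2 ^ t := Nat.pow_le_pow_right (by norm_num) hw

def kap (y : Fin c → Bits s) : Fin c × Bits s → ZMod 2 := fun q => if y q.1 = q.2 then 1 else 0

lemma kap_inj : Function.Injective (kap (c := c) (s := s)) := by
  intro y y' h
  funext k
  have := congrFun h (k, y k)
  simp only [kap, if_true] at this
  by_contra hne
  rw [if_neg (fun h => hne h.symm)] at this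
  exact one_ne_zero this

def SL (w : ℕ) (ball : Fin (2 ^ t) → Fin c → Bits s) (x : ℕ → Fin (2 ^ t)) (U N : Finset ℕ) : Prop :=
  ∃ a ∈ N, ∃ b ∈ U ∪ N, b ≠ a ∧ ∃ k, Light w ball k (ball (x b) k) ∧ ball (x a) k = ball (x b) k

def Gain (w : ℕ) (ball : Fin (2 ^ t) → Fin c → Bits s) (x : ℕ → Fin (2 ^ t)) (U N : Finset ℕ) : Prop :=
  (∃ a ∈ N, ∀ k, ¬ Light w ball k (ball (x a) k)) ∨ SL w ball x U N ∨
  ∃ w1 ∈ N, ∃ W ⊆ U, ∃ y : Fin (2 ^ t),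
    kap (ball y) = ∑ m ∈ W, kap (ball (x m)) + ∑ m ∈ N, kap (ball (x m)) ∧
    SL w ball (Function.update x w1 y) U N

lemma Gain.mono {w : ℕ} {ball : Fin (2 ^ t) → Fin c → Bits s} {x : ℕ → Fin (2 ^ t)}
    {U U' N : Finset ℕ} (h : Gain w ball x U N) (hU : U ⊆ U') : Gain w ball x U' N := by
  have hSL : ∀ x, SL w ball x U N → SL w ball x U' N := by
    rintro x ⟨a, ha, b, hb, h⟩
    exact ⟨a, ha, b, Finset.union_subset_union_left hU hb, h⟩
  rcases h with h | h | ⟨w1, h1, W, hW, y, h2, h3⟩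
  · exact Or.inl h
  · exact Or.inr (Or.inl (hSL _ h))
  · exact Or.inr (Or.inr ⟨w1, h1, W, hW.trans hU, y, h2, hSL _ h3⟩)

lemma SL_congr {w : ℕ} {ball : Fin (2 ^ t) → Fin c → Bits s} {x x' : ℕ → Fin (2 ^ t)}
    {U N : Finset ℕ} (hx : ∀ m ∈ U ∪ N, x m = x' m) (h : SL w ball x U N) : SL w ball x' U N := by
  obtain ⟨a, ha, b, hb, hab, k, h⟩ := h
  have h1 := hx a (Finset.mem_union_right _ ha)
  have h2 := hx b hb
  exact ⟨a, ha, b, hb, hab, k, by rw [← h1, ← h2]; exact h⟩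

lemma Gain.congr {w : ℕ} {ball : Fin (2 ^ t) → Fin c → Bits s} {x x' : ℕ → Fin (2 ^ t)}
    {U N : Finset ℕ} (hx : ∀ m ∈ U ∪ N, x m = x' m) (h : Gain w ball x U N) :
    Gain w ball x' U N := by
  rcases h with ⟨a, ha, h⟩ | h | ⟨w1, h1, W, hW, y, h2, h3⟩
  · exact Or.inl ⟨a, ha, by rw [← hx a (Finset.mem_union_right _ ha)]; exact h⟩
  · exact Or.inr (Or.inl (SL_congr hx h))
  · refine Or.inr (Or.inr ⟨w1, h1, W, hW, y, ?_, SL_congr ?_ h3⟩)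
    · rw [h2]
      congr 1
      · exact Finset.sum_congr rfl fun m hm => by rw [hx m (Finset.mem_union_left _ (hW hm))]
      · exact Finset.sum_congr rfl fun m hm => by rw [hx m (Finset.mem_union_right _ hm)]
    · intro m hm
      by_cases h : m = w1
      · simp [h]
      · simp [Function.update_of_ne h, hx m hm]

def Chain (w : ℕ) (ball : Fin (2 ^ t) → Fin c → Bits s) (x : ℕ → Fin (2 ^ t)) : ℕ → Finset ℕ → Prop
  | 0, _ => True
  | p + 1, A => ∃ N ⊆ A, Gain w ball x (A \ N) N ∧ Chain w ball x p (A \ N)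

lemma Chain.mono {w : ℕ} {ball : Fin (2 ^ t) → Fin c → Bits s} {x : ℕ → Fin (2 ^ t)} {p : ℕ}
    {A A' : Finset ℕ} (h : Chain w ball x p A) (hA : A ⊆ A') : Chain w ball x p A' := by
  induction p generalizing A A' with
  | zero => trivial
  | succ p ih =>
    obtain ⟨N, hN, h1, h2⟩ := h
    have : A \ N ⊆ A' \ N := Finset.sdiff_subset_sdiff hA le_rfl
    exact ⟨N, hN.trans hA, h1.mono this, ih h2 this⟩

lemma Chain.congr {w : ℕ} {ball : Fin (2 ^ t) → Fin c → Bits s} {x x' : ℕ → Fin (2 ^ t)} {p : ℕ}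
    {A : Finset ℕ} (hx : ∀ m ∈ A, x m = x' m) (h : Chain w ball x p A) : Chain w ball x' p A := by
  induction p generalizing A with
  | zero => trivial
  | succ p ih =>
    obtain ⟨N, hN, h1, h2⟩ := h
    refine ⟨N, hN, h1.congr ?_, ih ?_ h2⟩
    · rw [Finset.sdiff_union_of_subset hN]; exact hx
    · intro m hm; exact hx m (Finset.sdiff_subset hm)

lemma Chain.step {w : ℕ} {ball : Fin (2 ^ t) → Fin c → Bits s} {x : ℕ → Fin (2 ^ t)} {p : ℕ}
    {U N : Finset ℕ} (h : Chain w ball x p U) (hUN : Disjoint U N) (hg : Gain w ball x U N) :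
    Chain w ball x (p + 1) (U ∪ N) := by
  have : (U ∪ N) \ N = U := by
    rw [Finset.union_sdiff_right]; exact Finset.sdiff_eq_self_of_disjoint hUN
  exact ⟨N, Finset.subset_union_right, by rwa [this], by rwa [this]⟩

lemma card_SL (w : ℕ) (ball : Fin (2 ^ t) → Fin c → Bits s) (d : Fin (2 ^ t))
    (U N : Finset ℕ) (hUN : Disjoint U N) (e : ℕ) (he : U.card + N.card ≤ e) (g : ℕ → Fin (2 ^ t))
    (S : Finset (ℕ → Fin (2 ^ t))) (hS : ∀ x ∈ S, x ∈ Fn d (U ∪ N) ∧ ∀ m ∈ U, x m = g m)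
    (h : ∀ x ∈ S, SL w ball x U N) :
    S.card * 2 ^ w ≤ (2 ^ t) ^ N.card * (e * e * c) := by
  let X := (N ×ˢ (U ∪ N)) ×ˢ (univ : Finset (Fin c))
  let Sq : (ℕ × ℕ) × Fin c → Finset (ℕ → Fin (2 ^ t)) := fun q => S.filter (fun x =>
    q.1.2 ≠ q.1.1 ∧ Light w ball q.2 (ball (x q.1.2) q.2) ∧
      ball (x q.1.1) q.2 = ball (x q.1.2) q.2)
  have h1 : S ⊆ X.biUnion Sq := by
    intro x hx
    obtain ⟨a, ha, b, hb, hab, k, h1, h2⟩ := h x hx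
    rw [Finset.mem_biUnion]
    refine ⟨((a, b), k), by simp only [X, mem_product, mem_univ, and_true]; exact ⟨ha, hb⟩, ?_⟩
    simp only [Sq, mem_filter]
    exact ⟨hx, hab, h1, h2⟩
  have h2 : ∀ q ∈ X, (Sq q).card * 2 ^ w ≤ (2 ^ t) ^ N.card := by
    rintro ⟨⟨a, b⟩, k⟩ hq
    simp only [X, mem_product, mem_univ, and_true] at hq
    have := card_fibZ d U N hUN g (Sq ((a, b), k)) (fun x hx => hS x (Finset.mem_filter.1 hx).1)
      a hq.1 (fun f => univ.filter (fun i => Light w ball k (ball (f b) k) ∧ ball i k = ball (f b) k))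
      (by
        intro x hx
        simp only [Sq, mem_filter] at hx
        obtain ⟨-, h1, h2, h3⟩ := hx
        simp only [mem_filter, mem_univ, true_and]
        rw [Function.update_of_ne h1]
        exact ⟨h2, h3⟩) (2 ^ w)
      (by
        intro f
        by_cases hl : Light w ball k (ball (f b) k)
        · simp only [hl, true_and, Fintype.card_fin]; exact hl
        · simp [hl])
    simpa using this
  have hX : X.card ≤ e * e * c := by
    simp only [X, card_product, card_univ, Fintype.card_fin]
    refine Nat.mul_le_mul_right _ (Nat.mul_le_mul (by omega) ((Finset.card_union_le _ _).trans he))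
  calc S.card * 2 ^ w ≤ (∑ q ∈ X, (Sq q).card) * 2 ^ w :=
        Nat.mul_le_mul_right _ ((Finset.card_le_card h1).trans Finset.card_biUnion_le)
    _ = ∑ q ∈ X, (Sq q).card * 2 ^ w := Finset.sum_mul _ _ _
    _ ≤ ∑ q ∈ X, (2 ^ t) ^ N.card := Finset.sum_le_sum h2
    _ = X.card * (2 ^ t) ^ N.card := by simp
    _ ≤ (e * e * c) * (2 ^ t) ^ N.card := Nat.mul_le_mul_right _ hX
    _ = _ := mul_comm _ _

def g0 (c e : ℕ) : ℕ := e + e * e * c + e * 2 ^ e * (e * e * c)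

lemma card_Gain (w : ℕ) (hw : w * (c + 1) ≤ t) (ball : Fin (2 ^ t) → Fin c → Bits s)
    (hb : Function.Injective ball) (d : Fin (2 ^ t))
    (U N : Finset ℕ) (hUN : Disjoint U N) (e : ℕ) (he : U.card + N.card ≤ e) (g : ℕ → Fin (2 ^ t))
    (S : Finset (ℕ → Fin (2 ^ t))) (hS : ∀ x ∈ S, x ∈ Fn d (U ∪ N) ∧ ∀ m ∈ U, x m = g m)
    (h : ∀ x ∈ S, Gain w ball x U N) :
    S.card * 2 ^ w ≤ (2 ^ t) ^ N.card * g0 c e := by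
  let S1 := S.filter (fun x => ∃ a ∈ N, ∀ k, ¬ Light w ball k (ball (x a) k))
  let S2 := S.filter (fun x => SL w ball x U N)
  let S3 := S.filter (fun x => ∃ w1 ∈ N, ∃ W ⊆ U, ∃ y : Fin (2 ^ t),
    kap (ball y) = ∑ m ∈ W, kap (ball (x m)) + ∑ m ∈ N, kap (ball (x m)) ∧
    SL w ball (Function.update x w1 y) U N)
  have hsub : S ⊆ S1 ∪ (S2 ∪ S3) := by
    intro x hx
    rcases h x hx with h | h | h
    · exact Finset.mem_union_left _ (Finset.mem_filter.2 ⟨hx, h⟩)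
    · exact Finset.mem_union_right _ (Finset.mem_union_left _ (Finset.mem_filter.2 ⟨hx, h⟩))
    · exact Finset.mem_union_right _ (Finset.mem_union_right _ (Finset.mem_filter.2 ⟨hx, h⟩))
  have c1 : S1.card * 2 ^ w ≤ (2 ^ t) ^ N.card * e := by
    have hq : ∀ a ∈ N, (S.filter (fun x => ∀ k, ¬ Light w ball k (ball (x a) k))).card * 2 ^ w
        ≤ (2 ^ t) ^ N.card := by
      intro a ha
      have := card_fibZ d U N hUN g (S.filter (fun x => ∀ k, ¬ Light w ball k (ball (x a) k)))
        (fun x hx => hS x (Finset.mem_filter.1 hx).1) a ha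
        (fun _ => univ.filter (fun i => ∀ k, ¬ Light w ball k (ball i k)))
        (by
          intro x hx
          simpa using (Finset.mem_filter.1 hx).2) (2 ^ w)
        (by intro _; simpa using card_allheavy w hw ball hb)
      simpa using this
    have h1 : S1 ⊆ N.biUnion (fun a => S.filter (fun x => ∀ k, ¬ Light w ball k (ball (x a) k))) := by
      intro x hx
      simp only [S1, mem_filter, mem_biUnion] at hx ⊢
      obtain ⟨hx, a, ha, h⟩ := hx
      exact ⟨a, ha, hx, h⟩
    calc S1.card * 2 ^ w ≤ (∑ a ∈ N, (S.filter (fun x => ∀ k, ¬ Light w ball k (ball (x a) k))).card) * 2 ^ w :=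
          Nat.mul_le_mul_right _ ((Finset.card_le_card h1).trans Finset.card_biUnion_le)
      _ = ∑ a ∈ N, (S.filter (fun x => ∀ k, ¬ Light w ball k (ball (x a) k))).card * 2 ^ w := Finset.sum_mul _ _ _
      _ ≤ ∑ a ∈ N, (2 ^ t) ^ N.card := Finset.sum_le_sum hq
      _ = N.card * (2 ^ t) ^ N.card := by simp
      _ ≤ e * (2 ^ t) ^ N.card := Nat.mul_le_mul_right _ (by omega)
      _ = _ := mul_comm _ _
  have c2 : S2.card * 2 ^ w ≤ (2 ^ t) ^ N.card * (e * e * c) :=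
    card_SL w ball d U N hUN e he g S2 (fun x hx => hS x (Finset.mem_filter.1 hx).1)
      (fun x hx => (Finset.mem_filter.1 hx).2)
  have c3 : S3.card * 2 ^ w ≤ (2 ^ t) ^ N.card * (e * 2 ^ e * (e * e * c)) := by
    let X := N ×ˢ U.powerset
    let Sq : ℕ × Finset ℕ → Finset (ℕ → Fin (2 ^ t)) := fun q => S.filter (fun x =>
      ∃ y : Fin (2 ^ t),
        kap (ball y) = ∑ m ∈ q.2, kap (ball (x m)) + ∑ m ∈ N, kap (ball (x m)) ∧
        SL w ball (Function.update x q.1 y) U N)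
    have h1 : S3 ⊆ X.biUnion Sq := by
      intro x hx
      simp only [S3, mem_filter] at hx
      obtain ⟨hx, w1, hw1, W, hW, hy⟩ := hx
      rw [Finset.mem_biUnion]
      refine ⟨(w1, W), by simp only [X, mem_product, mem_powerset]; exact ⟨hw1, hW⟩, ?_⟩
      simp only [Sq, mem_filter]
      exact ⟨hx, hy⟩
    have h2 : ∀ q ∈ X, (Sq q).card * 2 ^ w ≤ (2 ^ t) ^ N.card * (e * e * c) := by
      rintro ⟨w1, W⟩ hq
      simp only [X, mem_product, mem_powerset] at hq
      obtain ⟨hw1, hW⟩ := hq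
      let yy : (ℕ → Fin (2 ^ t)) → Fin (2 ^ t) := fun x => if hx : ∃ y : Fin (2 ^ t),
        kap (ball y) = ∑ m ∈ W, kap (ball (x m)) + ∑ m ∈ N, kap (ball (x m)) ∧
        SL w ball (Function.update x w1 y) U N then hx.choose else d
      have hyy : ∀ x ∈ Sq (w1, W), kap (ball (yy x)) = ∑ m ∈ W, kap (ball (x m)) + ∑ m ∈ N, kap (ball (x m)) ∧
        SL w ball (Function.update x w1 (yy x)) U N := by
        intro x hx
        have hx' := (Finset.mem_filter.1 hx).2
        have : yy x = hx'.choose := dif_pos hx'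
        rw [this]; exact hx'.choose_spec
      have hw1U : w1 ∉ U := fun h => Finset.disjoint_left.1 hUN h hw1
      have hinj : Set.InjOn (fun x => Function.update x w1 (yy x)) (Sq (w1, W) : Set (ℕ → Fin (2 ^ t))) := by
        intro x hx x' hx' hxx
        have hoff : ∀ m, m ≠ w1 → x m = x' m := by
          intro m hm
          simpa [Function.update_of_ne hm] using congrFun hxx m
        have hy : yy x = yy x' := by simpa using congrFun hxx w1
        have e1 := (hyy x hx).1
        have e2 := (hyy x' hx').1
        rw [hy, e2] at e1
        have hWs : ∑ m ∈ W, kap (ball (x m)) = ∑ m ∈ W, kap (ball (x' m)) :=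
          Finset.sum_congr rfl fun m hm => by
            rw [hoff m (fun h => hw1U (hW (h ▸ hm)))]
        rw [hWs, add_right_inj, ← Finset.add_sum_erase N _ hw1, ← Finset.add_sum_erase N _ hw1] at e1
        have hNs : ∑ m ∈ N.erase w1, kap (ball (x m)) = ∑ m ∈ N.erase w1, kap (ball (x' m)) :=
          Finset.sum_congr rfl fun m hm => by
            rw [hoff m (Finset.ne_of_mem_erase hm)]
        rw [hNs, add_left_inj] at e1
        have := hb (kap_inj e1)
        funext m
        by_cases hm : m = w1
        · rw [hm, this]
        · exact hoff m hm
      rw [← Finset.card_image_of_injOn hinj]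
      refine card_SL w ball d U N hUN e he g _ ?_ ?_
      · intro f hf
        obtain ⟨x, hx, rfl⟩ := Finset.mem_image.1 hf
        obtain ⟨a1, a2⟩ := hS x (Finset.mem_filter.1 hx).1
        rw [mem_Fn] at a1 ⊢
        constructor
        · intro m hm
          have : m ≠ w1 := fun h => hm (h ▸ Finset.mem_union_right _ hw1)
          rw [Function.update_of_ne this, a1 m hm]
        · intro m hm
          have : m ≠ w1 := fun h => hw1U (h ▸ hm)
          rw [Function.update_of_ne this, a2 m hm]
      · intro f hf
        obtain ⟨x, hx, rfl⟩ := Finset.mem_image.1 hf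
        exact (hyy x hx).2
    have hX : X.card ≤ e * 2 ^ e := by
      simp only [X, card_product, card_powerset]
      exact Nat.mul_le_mul (by omega) (Nat.pow_le_pow_right (by norm_num) (by omega))
    calc S3.card * 2 ^ w ≤ (∑ q ∈ X, (Sq q).card) * 2 ^ w :=
          Nat.mul_le_mul_right _ ((Finset.card_le_card h1).trans Finset.card_biUnion_le)
      _ = ∑ q ∈ X, (Sq q).card * 2 ^ w := Finset.sum_mul _ _ _
      _ ≤ ∑ q ∈ X, (2 ^ t) ^ N.card * (e * e * c) := Finset.sum_le_sum h2
      _ = X.card * ((2 ^ t) ^ N.card * (e * e * c)) := by simp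
      _ ≤ (e * 2 ^ e) * ((2 ^ t) ^ N.card * (e * e * c)) := Nat.mul_le_mul_right _ hX
      _ = _ := by ring
  have hcard : S.card ≤ S1.card + (S2.card + S3.card) :=
    (Finset.card_le_card hsub).trans ((Finset.card_union_le _ _).trans
      (Nat.add_le_add_left (Finset.card_union_le _ _) _))
  calc S.card * 2 ^ w ≤ (S1.card + (S2.card + S3.card)) * 2 ^ w := Nat.mul_le_mul_right _ hcard
    _ = S1.card * 2 ^ w + (S2.card * 2 ^ w + S3.card * 2 ^ w) := by ring
    _ ≤ _ := Nat.add_le_add c1 (Nat.add_le_add c2 c3)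
    _ = _ := by unfold g0; ring

lemma card_Chain (w : ℕ) (hw : w * (c + 1) ≤ t) (ball : Fin (2 ^ t) → Fin c → Bits s)
    (hb : Function.Injective ball) (d : Fin (2 ^ t)) (e p : ℕ) (A : Finset ℕ) (hA : A.card ≤ e) :
    ((Fn d A).filter (fun x => Chain w ball x p A)).card * (2 ^ w) ^ p
      ≤ (2 ^ t) ^ A.card * (2 ^ e * g0 c e) ^ p := by
  induction p generalizing A with
  | zero =>
    simp only [pow_zero, mul_one]
    refine (Finset.card_filter_le _ _).trans ?_
    rw [card_Fn]; simp
  | succ p ih =>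
    let Sq : Finset ℕ → Finset (ℕ → Fin (2 ^ t)) := fun N => (Fn d A).filter (fun x =>
      Gain w ball x (A \ N) N ∧ Chain w ball x p (A \ N))
    have h1 : (Fn d A).filter (fun x => Chain w ball x (p + 1) A) ⊆ A.powerset.biUnion Sq := by
      intro x hx
      simp only [mem_filter, mem_biUnion, mem_powerset, Sq] at hx ⊢
      obtain ⟨hx, N, hN, h⟩ := hx
      exact ⟨N, hN, hx, h⟩
    have h2 : ∀ N ∈ A.powerset, (Sq N).card * (2 ^ w) ^ (p + 1) ≤
        (2 ^ t) ^ A.card * ((2 ^ e * g0 c e) ^ p * g0 c e) := by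
      intro N hN
      rw [mem_powerset] at hN
      have hcN : (A \ N).card + N.card = A.card := Finset.card_sdiff_add_card_eq_card hN
      have h3 : (Sq N).card * 2 ^ w ≤
          ((Fn d (A \ N)).filter (fun x => Chain w ball x p (A \ N))).card *
            ((2 ^ t) ^ N.card * g0 c e) := by
        rw [Finset.card_eq_sum_card_fiberwise (s := Sq N) (f := trunc d (A \ N))
          (t := (Fn d (A \ N)).filter (fun x => Chain w ball x p (A \ N)))]
        · rw [Finset.sum_mul, ← smul_eq_mul (a := Finset.card _), ← Finset.sum_const]
          refine Finset.sum_le_sum fun g _ => ?_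
          refine card_Gain w hw ball hb d (A \ N) N Finset.sdiff_disjoint e (by omega) g _ ?_ ?_
          · intro x hx
            simp only [mem_filter, Sq] at hx
            refine ⟨?_, ?_⟩
            · rw [Finset.sdiff_union_of_subset hN]; exact hx.1.1
            · intro m hm
              rw [← hx.2]
              simp only [trunc, if_pos hm]
          · intro x hx
            simp only [mem_filter, Sq] at hx
            exact hx.1.2.1
        · intro x hx
          simp only [Sq, coe_filter, Set.mem_ofPred_eq] at hx ⊢
          refine ⟨trunc_mem _ _ _, hx.2.2.congr ?_⟩
          intro m hm
          simp only [trunc, if_pos hm]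
      calc (Sq N).card * (2 ^ w) ^ (p + 1) = (Sq N).card * 2 ^ w * (2 ^ w) ^ p := by ring
        _ ≤ ((Fn d (A \ N)).filter (fun x => Chain w ball x p (A \ N))).card *
            ((2 ^ t) ^ N.card * g0 c e) * (2 ^ w) ^ p := Nat.mul_le_mul_right _ h3
        _ = ((Fn d (A \ N)).filter (fun x => Chain w ball x p (A \ N))).card * (2 ^ w) ^ p *
            ((2 ^ t) ^ N.card * g0 c e) := by ring
        _ ≤ (2 ^ t) ^ (A \ N).card * (2 ^ e * g0 c e) ^ p * ((2 ^ t) ^ N.card * g0 c e) :=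
            Nat.mul_le_mul_right _ (ih (A \ N) (by omega))
        _ = (2 ^ t) ^ ((A \ N).card + N.card) * ((2 ^ e * g0 c e) ^ p * g0 c e) := by
            rw [pow_add]; ring
        _ = _ := by rw [hcN]
    calc ((Fn d A).filter (fun x => Chain w ball x (p + 1) A)).card * (2 ^ w) ^ (p + 1)
        ≤ (∑ N ∈ A.powerset, (Sq N).card) * (2 ^ w) ^ (p + 1) :=
          Nat.mul_le_mul_right _ ((Finset.card_le_card h1).trans Finset.card_biUnion_le)
      _ = ∑ N ∈ A.powerset, (Sq N).card * (2 ^ w) ^ (p + 1) := Finset.sum_mul _ _ _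
      _ ≤ ∑ N ∈ A.powerset, (2 ^ t) ^ A.card * ((2 ^ e * g0 c e) ^ p * g0 c e) := Finset.sum_le_sum h2
      _ = 2 ^ A.card * ((2 ^ t) ^ A.card * ((2 ^ e * g0 c e) ^ p * g0 c e)) := by
          simp [Finset.card_powerset]
      _ ≤ 2 ^ e * ((2 ^ t) ^ A.card * ((2 ^ e * g0 c e) ^ p * g0 c e)) :=
          Nat.mul_le_mul_right _ (Nat.pow_le_pow_right (by norm_num) hA)
      _ = _ := by ring
end
end TC

namespace TC
section
variable {c s t : ℕ}

lemma ph_congr (par : ℕ → ℕ) (ball : Fin (2 ^ t) → Fin c → Bits s) (x x' : ℕ → Fin (2 ^ t))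
    (l l' : ℕ → Bool) (m : ℕ) (h1 : x m = x' m) (h2 : l m = l' m)
    (h3 : par m = 0 ∨ (x (par m) = x' (par m) ∧ l (par m) = l' (par m))) :
    ph par ball x l m = ph par ball x' l' m := by
  unfold ph vv
  rw [h1, h2]
  rcases h3 with h3 | ⟨h3, h4⟩
  · simp [h3]
  · rw [h3, h4]

lemma VV_congr (ball : Fin (2 ^ t) → Fin c → Bits s) (T : Om c s t) (ρ : Bits t)
    (x x' : ℕ → Fin (2 ^ t)) (l l' : ℕ → Bool) (m : ℕ)
    (h3 : m = 0 ∨ (x m = x' m ∧ l m = l' m)) :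
    VV ball T ρ x l m = VV ball T ρ x' l' m := by
  unfold VV
  rcases h3 with h3 | ⟨h3, h4⟩
  · simp [h3]
  · rw [h3, h4]

lemma card_small_sets (N e : ℕ) :
    ((Finset.range N).powerset.filter (fun A => A.card ≤ e)).card ≤ (N + 1) ^ e := by
  have h1 : (Finset.range N).powerset.filter (fun A => A.card ≤ e) ⊆
      (Finset.range (e + 1)).biUnion (fun i => (Finset.range N).powersetCard i) := by
    intro A hA
    simp only [mem_filter, mem_powerset, mem_biUnion, mem_range, mem_powersetCard] at hA ⊢
    exact ⟨A.card, by omega, hA.1, rfl⟩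
  refine (Finset.card_le_card h1).trans (Finset.card_biUnion_le.trans ?_)
  rw [add_pow]
  refine Finset.sum_le_sum fun i hi => ?_
  rw [Finset.card_powersetCard, Finset.card_range, one_pow, mul_one]
  have : 0 < e.choose i := Nat.choose_pos (by simpa [Nat.lt_succ_iff] using hi)
  have h2 : N.choose i ≤ N ^ i := Nat.choose_le_pow N i
  nlinarith [Nat.zero_le (N ^ i)]

def Bad (par : ℕ → ℕ) (w : ℕ) (ball : Fin (2 ^ t) → Fin c → Bits s) (p e N : ℕ)
    (T : Om c s t) : Prop :=
  ∃ A ⊆ Finset.range N, A.card ≤ e ∧ (∀ m ∈ A, par m = 0 ∨ par m ∈ A) ∧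
    ∃ ρ x l, Realized par ball T ρ x l A ∧
      LinearIndepOn (ZMod 2) (ph par ball x l) (A : Set ℕ) ∧ Chain w ball x p A

lemma card_Bad (par : ℕ → ℕ) (w : ℕ) (hw : w * (c + 1) ≤ t) (ball : Fin (2 ^ t) → Fin c → Bits s)
    (hb : Function.Injective ball) (p e N : ℕ) :
    (univ.filter (fun T : Om c s t => Bad par w ball p e N T)).card * (2 ^ w) ^ p
      ≤ (N + 1) ^ e * (2 ^ e * (2 ^ e * g0 c e) ^ p * (2 ^ t * Fintype.card (Om c s t))) := by
  let d : Fin (2 ^ t) := ⟨0, by positivity⟩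
  let AA := (Finset.range N).powerset.filter (fun A => A.card ≤ e)
  let X : Finset ℕ → Finset ((ℕ → Fin (2 ^ t)) × (ℕ → Bool)) := fun A =>
    ((((Fn d A).filter (fun x => Chain w ball x p A)) ×ˢ (Fn true A))).filter (fun q =>
      LinearIndepOn (ZMod 2) (ph par ball q.1 q.2) (A : Set ℕ))
  let E : Finset ℕ → Finset (Om c s t) := fun A =>
    univ.filter (fun T : Om c s t => ∃ ρ, ∃ q ∈ X A, Realized par ball T ρ q.1 q.2 A)
  have h1 : univ.filter (fun T : Om c s t => Bad par w ball p e N T) ⊆ AA.biUnion E := by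
    intro T hT
    obtain ⟨A, hA, hAe, hcl, ρ, x, l, hR, hLI, hch⟩ := (Finset.mem_filter.1 hT).2
    rw [Finset.mem_biUnion]
    refine ⟨A, by simp only [AA, mem_filter, mem_powerset]; exact ⟨hA, hAe⟩, ?_⟩
    simp only [E, mem_filter, mem_univ, true_and]
    have ex : ∀ m ∈ A, x m = trunc d A x m := fun m hm => by simp [trunc, hm]
    have el : ∀ m ∈ A, l m = trunc true A l m := fun m hm => by simp [trunc, hm]
    refine ⟨ρ, (trunc d A x, trunc true A l), ?_, ?_⟩
    · simp only [X, mem_filter, mem_product]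
      refine ⟨⟨⟨trunc_mem _ _ _, hch.congr ex⟩, trunc_mem _ _ _⟩, ?_⟩
      refine hLI.congr ?_
      intro m hm
      exact ph_congr _ _ _ _ _ _ _ (ex m hm) (el m hm) ((hcl m hm).imp_right fun h => ⟨ex _ h, el _ h⟩)
    · intro m hm
      simp only
      rw [← ex m hm, ← el m hm, hR m hm]
      exact VV_congr _ _ _ _ _ _ _ _ ((hcl m hm).imp_right fun h => ⟨ex _ h, el _ h⟩)
  have h2 : ∀ A ∈ AA, (E A).card * (2 ^ w) ^ p ≤
      2 ^ e * (2 ^ e * g0 c e) ^ p * (2 ^ t * Fintype.card (Om c s t)) := by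
    intro A hA
    have hAe : A.card ≤ e := (Finset.mem_filter.1 hA).2
    have a1 := countT par ball A (X A) (fun q hq => (Finset.mem_filter.1 hq).2)
    have a2 : (X A).card ≤ ((Fn d A).filter (fun x => Chain w ball x p A)).card * 2 ^ e := by
      refine (Finset.card_filter_le _ _).trans ?_
      rw [Finset.card_product, card_Fn, Fintype.card_bool]
      exact Nat.mul_le_mul_left _ (Nat.pow_le_pow_right (by norm_num) hAe)
    have a3 := card_Chain w hw ball hb d e p A hAe
    have hpos : 0 < (2 ^ t) ^ A.card := by positivity
    refine Nat.le_of_mul_le_mul_left ?_ hpos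
    calc (2 ^ t) ^ A.card * ((E A).card * (2 ^ w) ^ p)
        = (E A).card * (2 ^ t) ^ A.card * (2 ^ w) ^ p := by ring
      _ ≤ (X A).card * (2 ^ t * Fintype.card (Om c s t)) * (2 ^ w) ^ p := Nat.mul_le_mul_right _ a1
      _ ≤ ((Fn d A).filter (fun x => Chain w ball x p A)).card * 2 ^ e *
            (2 ^ t * Fintype.card (Om c s t)) * (2 ^ w) ^ p :=
          Nat.mul_le_mul_right _ (Nat.mul_le_mul_right _ a2)
      _ = ((Fn d A).filter (fun x => Chain w ball x p A)).card * (2 ^ w) ^ p *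
            (2 ^ e * (2 ^ t * Fintype.card (Om c s t))) := by ring
      _ ≤ (2 ^ t) ^ A.card * (2 ^ e * g0 c e) ^ p * (2 ^ e * (2 ^ t * Fintype.card (Om c s t))) :=
          Nat.mul_le_mul_right _ a3
      _ = _ := by ring
  calc _ ≤ (∑ A ∈ AA, (E A).card) * (2 ^ w) ^ p :=
        Nat.mul_le_mul_right _ ((Finset.card_le_card h1).trans Finset.card_biUnion_le)
    _ = ∑ A ∈ AA, (E A).card * (2 ^ w) ^ p := Finset.sum_mul _ _ _
    _ ≤ ∑ A ∈ AA, 2 ^ e * (2 ^ e * g0 c e) ^ p * (2 ^ t * Fintype.card (Om c s t)) :=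
        Finset.sum_le_sum h2
    _ = AA.card * (2 ^ e * (2 ^ e * g0 c e) ^ p * (2 ^ t * Fintype.card (Om c s t))) := by
        rw [Finset.sum_const, smul_eq_mul]
    _ ≤ _ := Nat.mul_le_mul_right _ (card_small_sets N e)
end
end TC

namespace TC
section
variable {c s t : ℕ}

lemma evec_some {b b' : Bool} {y : Fin c → Bits s} {k : Fin c} {a : Bits s} :
    evec b y (some (b', k, a)) = if b' = b ∧ y k = a then 1 else 0 := rfl

lemma vv_apply (ball : Fin (2 ^ t) → Fin c → Bits s) (x : ℕ → Fin (2 ^ t)) (l : ℕ → Bool)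
    (m : ℕ) (b : Bool) (k : Fin c) (a : Bits s) :
    vv ball x l m (some (b, k, a)) = if m ≠ 0 ∧ b = !l m ∧ ball (x m) k = a then 1 else 0 := by
  unfold vv
  by_cases hm : m = 0
  · simp [hm, rvec]
  · simp [hm, evec]

lemma ph_apply (par : ℕ → ℕ) (ball : Fin (2 ^ t) → Fin c → Bits s) (x : ℕ → Fin (2 ^ t))
    (l : ℕ → Bool) (m : ℕ) (b : Bool) (k : Fin c) (a : Bits s) :
    ph par ball x l m (some (b, k, a)) = (if b = l m ∧ ball (x m) k = a then 1 else 0) +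
      if par m ≠ 0 ∧ b = !l (par m) ∧ ball (x (par m)) k = a then 1 else 0 := by
  unfold ph
  rw [Pi.add_apply, vv_apply, evec_some]

lemma ph_none (par : ℕ → ℕ) (ball : Fin (2 ^ t) → Fin c → Bits s) (x : ℕ → Fin (2 ^ t))
    (l : ℕ → Bool) (m : ℕ) :
    ph par ball x l m none = if par m = 0 then 1 else 0 := by
  unfold ph vv
  split_ifs <;> simp [evec, rvec]

lemma fresh (par : ℕ → ℕ) (ball : Fin (2 ^ t) → Fin c → Bits s) (x : ℕ → Fin (2 ^ t))
    (l : ℕ → Bool) (S : Set ℕ) (m : ℕ) (hpm : par m = 0 ∨ par m ∈ S)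
    (hS : ∀ m' ∈ S, par m' = 0 ∨ par m' ∈ S) (k : Fin c)
    (hk : ∀ m' ∈ S, ball (x m') k ≠ ball (x m) k) :
    ph par ball x l m ∉ Submodule.span (ZMod 2) (ph par ball x l '' S) := by
  intro h
  have hz : ∀ v ∈ Submodule.span (ZMod 2) (ph par ball x l '' S),
      v (some (l m, k, ball (x m) k)) = 0 := by
    intro v hv
    induction hv using Submodule.span_induction with
    | mem v hv =>
      obtain ⟨m', hm', rfl⟩ := hv
      rw [ph_apply, if_neg (fun h => hk m' hm' h.2), zero_add, if_neg]
      rintro ⟨h1, -, h2⟩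
      exact hk _ ((hS m' hm').resolve_left h1) h2
    | zero => rfl
    | add u v _ _ hu hv => rw [Pi.add_apply, hu, hv, add_zero]
    | smul a v _ hv => rw [Pi.smul_apply, hv, smul_zero]
  have := hz _ h
  rw [ph_apply, if_pos ⟨rfl, rfl⟩, if_neg, add_zero] at this
  · exact one_ne_zero this
  · rintro ⟨h1, -, h2⟩
    exact hk _ (hpm.resolve_left h1) h2

def Uniq (ball : Fin (2 ^ t) → Fin c → Bits s) (x : ℕ → Fin (2 ^ t)) (A : Finset ℕ) : Prop :=
  ∀ m ∈ A, ∃ k, ∀ m' ∈ A, m' ≠ m → ball (x m') k ≠ ball (x m) k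

def Sib (par : ℕ → ℕ) (x : ℕ → Fin (2 ^ t)) (A : Finset ℕ) : Prop :=
  ∀ m ∈ A, ∀ m' ∈ A, par m = par m' → m < m' → x m' < x m

def Final (par : ℕ → ℕ) (ball : Fin (2 ^ t) → Fin c → Bits s) (A : Finset ℕ) (T : Om c s t) : Prop :=
  ∃ ρ x l, Realized par ball T ρ x l A ∧ Uniq ball x A ∧ Sib par x A

lemma li_of_uniq (par : ℕ → ℕ) (ball : Fin (2 ^ t) → Fin c → Bits s) (x : ℕ → Fin (2 ^ t))
    (l : ℕ → Bool) (A : Finset ℕ) (hp : ∀ m ∈ A, par m = 0 ∨ (par m ∈ A ∧ par m < m))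
    (hu : Uniq ball x A) : LinearIndepOn (ZMod 2) (ph par ball x l) (A : Set ℕ) := by
  apply li_of_tri
  intro m hm
  obtain ⟨k, hk⟩ := hu m hm
  refine fresh par ball x l _ m (hp m hm) ?_ k ?_
  · rintro m' ⟨h1, h2⟩
    exact (hp m' h1).imp_right fun h => ⟨h.1, h.2.trans h2⟩
  · rintro m' ⟨h1, h2⟩
    exact hk m' h1 h2.ne

lemma card_anti (B : Finset ℕ) (d : Fin (2 ^ t)) :
    ((Fn d B).filter (fun x => ∀ m ∈ B, ∀ m' ∈ B, m < m' → x m' < x m)).card ≤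
      (2 ^ t).choose B.card := by
  have h1 : (2 ^ t).choose B.card = (Finset.powersetCard B.card (univ : Finset (Fin (2 ^ t)))).card := by
    simp
  rw [h1]
  have hinj : ∀ x : ℕ → Fin (2 ^ t), (∀ m ∈ B, ∀ m' ∈ B, m < m' → x m' < x m) →
      Set.InjOn x (B : Set ℕ) := by
    intro x hx m hm m' hm' h
    rcases lt_trichotomy m m' with h' | h' | h'
    · have := hx m hm m' hm' h'; rw [h] at this; exact absurd this (lt_irrefl _)
    · exact h'
    · have := hx m' hm' m hm h'; rw [h] at this; exact absurd this (lt_irrefl _)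
  refine Finset.card_le_card_of_injOn (fun x => B.image x) ?_ ?_
  · intro x hx
    simp only [coe_filter, Set.mem_ofPred_eq] at hx
    simp only [mem_coe, mem_powersetCard, subset_univ, true_and]
    exact Finset.card_image_of_injOn (hinj x hx.2)
  · intro x hx y hy h
    simp only [coe_filter, Set.mem_ofPred_eq] at hx hy
    have sm : ∀ x : ℕ → Fin (2 ^ t), (∀ m ∈ B, ∀ m' ∈ B, m < m' → x m' < x m) →
        StrictMono (fun m : (B)ᵒᵈ => x (OrderDual.ofDual m : B)) := by
      intro x hx a b hab
      exact hx _ (OrderDual.ofDual b).2 _ (OrderDual.ofDual a).2 hab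
    have hr : Set.range (fun m : (B)ᵒᵈ => x (OrderDual.ofDual m : B))
        = Set.range (fun m : (B)ᵒᵈ => y (OrderDual.ofDual m : B)) := by
      have : ∀ x : ℕ → Fin (2 ^ t), Set.range (fun m : (B)ᵒᵈ => x (OrderDual.ofDual m : B))
          = ((B.image x : Finset _) : Set (Fin (2 ^ t))) := by
        intro x
        ext i
        simp only [Set.mem_range, coe_image, Set.mem_image, mem_coe]
        constructor
        · rintro ⟨a, rfl⟩; exact ⟨_, (OrderDual.ofDual a).2, rfl⟩
        · rintro ⟨a, ha, rfl⟩; exact ⟨OrderDual.toDual ⟨a, ha⟩, rfl⟩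
      rw [this, this]
      exact congrArg _ h
    have := (StrictMono.range_inj (sm x hx.2) (sm y hy.2)).1 hr
    funext m
    by_cases hm : m ∈ B
    · exact congrFun this (OrderDual.toDual ⟨m, hm⟩)
    · rw [(mem_Fn d B x).1 hx.1 m hm, (mem_Fn d B y).1 hy.1 m hm]

lemma choose_bd (n r : ℕ) (hr : 5 ≤ r) : n.choose r * 2 ^ r * 2 ≤ n ^ r := by
  have h1 : 2 ^ (r + 1) ≤ r.factorial := by
    induction r, hr using Nat.le_induction with
    | base => decide
    | succ r hr ih =>
      rw [Nat.factorial_succ, pow_succ]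
      nlinarith
  have h2 := Nat.descFactorial_le_pow n r
  rw [Nat.descFactorial_eq_factorial_mul_choose] at h2
  calc n.choose r * 2 ^ r * 2 = 2 ^ (r + 1) * n.choose r := by ring
    _ ≤ r.factorial * n.choose r := Nat.mul_le_mul_right _ h1
    _ ≤ _ := h2

lemma card_sib (par : ℕ → ℕ) (d : Fin (2 ^ t)) (I : Finset ℕ) (A : Finset ℕ)
    (hA : ∀ m ∈ A, par m ∈ I) (hI : ∀ v ∈ I, 5 ≤ (A.filter (fun m => par m = v)).card) :
    (((Fn d A).filter (fun x => Sib par x A)) ×ˢ (Fn true A)).card * 2 ^ I.card ≤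
      (2 ^ t) ^ A.card := by
  induction I using Finset.induction_on generalizing A with
  | empty =>
    have : A = ∅ := by
      by_contra h
      obtain ⟨m, hm⟩ := Finset.nonempty_iff_ne_empty.2 h
      simpa using hA m hm
    subst this
    simp only [card_product, card_empty, pow_zero, mul_one]
    have h1 := Finset.card_filter_le (Fn d ∅) (fun x => Sib par x ∅)
    rw [card_Fn] at h1 ⊢
    simpa using h1
  | insert v I hv ih =>
    let B := A.filter (fun m => par m = v)
    let A' := A.filter (fun m => par m ≠ v)
    have hBA : B.card + A'.card = A.card := Finset.card_filter_add_card_filter_not _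
    have ih' := ih A' (by
        intro m hm
        obtain ⟨h1, h2⟩ := Finset.mem_filter.1 hm
        exact (Finset.mem_insert.1 (hA m h1)).resolve_left h2) (by
        intro u hu
        refine (hI u (Finset.mem_insert_of_mem hu)).trans (Finset.card_le_card ?_)
        intro m hm
        simp only [A', mem_filter] at hm ⊢
        refine ⟨⟨hm.1, ?_⟩, hm.2⟩
        rw [hm.2]; rintro rfl; exact hv hu)
    have hB : 5 ≤ B.card := hI v (Finset.mem_insert_self _ _)
    have h1 : (((Fn d A).filter (fun x => Sib par x A)) ×ˢ (Fn true A)).card ≤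
        ((((Fn d A').filter (fun x => Sib par x A')) ×ˢ (Fn true A')) ×ˢ
          (((Fn d B).filter (fun x => ∀ m ∈ B, ∀ m' ∈ B, m < m' → x m' < x m)) ×ˢ (Fn true B))).card := by
      refine Finset.card_le_card_of_injOn (fun q => ((trunc d A' q.1, trunc true A' q.2),
        (trunc d B q.1, trunc true B q.2))) ?_ ?_
      · rintro ⟨x, l⟩ hq
        have hq := Finset.mem_coe.1 hq
        rw [Finset.mem_product, Finset.mem_filter] at hq
        obtain ⟨⟨q1, q2⟩, q3⟩ := hq
        simp only [coe_product, coe_filter, Set.mem_prod, Set.mem_ofPred_eq, mem_coe, trunc_mem, true_and, and_true]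
        constructor
        · intro m hm m' hm' hpp hlt
          have a := (Finset.mem_filter.1 hm).1
          have a' := (Finset.mem_filter.1 hm').1
          simpa only [trunc, if_pos hm, if_pos hm'] using q2 m a m' a' hpp hlt
        · intro m hm m' hm' hlt
          have a := (Finset.mem_filter.1 hm)
          have a' := (Finset.mem_filter.1 hm')
          simpa only [trunc, if_pos hm, if_pos hm'] using q2 m a.1 m' a'.1 (a.2.trans a'.2.symm) hlt
      · rintro ⟨x, l⟩ hq ⟨x', l'⟩ hq' h
        have hq := Finset.mem_coe.1 hq
        have hq' := Finset.mem_coe.1 hq'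
        rw [Finset.mem_product, Finset.mem_filter] at hq hq'
        simp only [Prod.mk.injEq] at h
        obtain ⟨⟨e1, e2⟩, e3, e4⟩ := h
        have gen : ∀ {α : Type} [Fintype α] (d : α) (x x' : ℕ → α), x ∈ Fn d A → x' ∈ Fn d A →
            trunc d A' x = trunc d A' x' → trunc d B x = trunc d B x' → x = x' := by
          intro α _ d x x' hx hx' e1 e2
          funext m
          rw [mem_Fn] at hx hx'
          by_cases hm : m ∈ A
          · by_cases hm' : par m = v
            · have : m ∈ B := Finset.mem_filter.2 ⟨hm, hm'⟩
              simpa [trunc, this] using congrFun e2 m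
            · have : m ∈ A' := Finset.mem_filter.2 ⟨hm, hm'⟩
              simpa [trunc, this] using congrFun e1 m
          · rw [hx m hm, hx' m hm]
        rw [gen d x x' hq.1.1 hq'.1.1 e1 e3, gen true l l' hq.2 hq'.2 e2 e4]
    have h2 : (((Fn d B).filter (fun x => ∀ m ∈ B, ∀ m' ∈ B, m < m' → x m' < x m)) ×ˢ (Fn true B)).card * 2
        ≤ (2 ^ t) ^ B.card := by
      rw [Finset.card_product, card_Fn, Fintype.card_bool]
      exact (Nat.mul_le_mul_right _ (Nat.mul_le_mul_right _ (card_anti B d))).trans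
        (choose_bd _ _ hB)
    have h1 := h1.trans_eq (Finset.card_product _ _)
    rw [Finset.card_insert_of_notMem hv, ← hBA, pow_add (2 ^ t)]
    calc _ ≤ (((Fn d A').filter (fun x => Sib par x A')) ×ˢ (Fn true A')).card *
          (((Fn d B).filter (fun x => ∀ m ∈ B, ∀ m' ∈ B, m < m' → x m' < x m)) ×ˢ (Fn true B)).card
            * 2 ^ (I.card + 1) := Nat.mul_le_mul_right _ h1
      _ = (((Fn d B).filter (fun x => ∀ m ∈ B, ∀ m' ∈ B, m < m' → x m' < x m)) ×ˢ (Fn true B)).card * 2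
          * ((((Fn d A').filter (fun x => Sib par x A')) ×ˢ (Fn true A')).card * 2 ^ I.card) := by ring
      _ ≤ _ := Nat.mul_le_mul h2 ih'

lemma card_Final (par : ℕ → ℕ) (ball : Fin (2 ^ t) → Fin c → Bits s) (I A : Finset ℕ)
    (hp : ∀ m ∈ A, par m = 0 ∨ (par m ∈ A ∧ par m < m))
    (hA : ∀ m ∈ A, par m ∈ I) (hI : ∀ v ∈ I, 5 ≤ (A.filter (fun m => par m = v)).card) :
    (univ.filter (fun T : Om c s t => Final par ball A T)).card * 2 ^ I.card
      ≤ 2 ^ t * Fintype.card (Om c s t) := by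
  let d : Fin (2 ^ t) := ⟨0, by positivity⟩
  let X : Finset ((ℕ → Fin (2 ^ t)) × (ℕ → Bool)) :=
    (((Fn d A).filter (fun x => Sib par x A)) ×ˢ (Fn true A)).filter (fun q =>
      LinearIndepOn (ZMod 2) (ph par ball q.1 q.2) (A : Set ℕ))
  have a1 := countT par ball A X (fun q hq => (Finset.mem_filter.1 hq).2)
  have a2 : X.card ≤ _ := Finset.card_filter_le _ _
  have a3 := card_sib par d I A hA hI
  have h1 : (univ.filter (fun T : Om c s t => Final par ball A T)).card ≤
      (univ.filter (fun T : Om c s t => ∃ ρ, ∃ q ∈ X, Realized par ball T ρ q.1 q.2 A)).card := by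
    refine Finset.card_le_card fun T hT => ?_
    obtain ⟨ρ, x, l, hR, hu, hsib⟩ := (Finset.mem_filter.1 hT).2
    simp only [mem_filter, mem_univ, true_and]
    have ex : ∀ m ∈ A, x m = trunc d A x m := fun m hm => by simp [trunc, hm]
    have el : ∀ m ∈ A, l m = trunc true A l m := fun m hm => by simp [trunc, hm]
    refine ⟨ρ, (trunc d A x, trunc true A l), ?_, ?_⟩
    · simp only [X, mem_filter, mem_product]
      refine ⟨⟨⟨trunc_mem _ _ _, ?_⟩, trunc_mem _ _ _⟩, ?_⟩
      · intro m hm m' hm'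
        rw [← ex m hm, ← ex m' hm']; exact hsib m hm m' hm'
      · refine (li_of_uniq par ball x l A hp hu).congr ?_
        intro m hm
        exact ph_congr _ _ _ _ _ _ _ (ex m hm) (el m hm)
          ((hp m hm).imp_right fun h => ⟨ex _ h.1, el _ h.1⟩)
    · intro m hm
      simp only
      rw [← ex m hm, ← el m hm, hR m hm]
      exact VV_congr _ _ _ _ _ _ _ _ ((hp m hm).imp_right fun h => ⟨ex _ h.1, el _ h.1⟩)
  have hpos : 0 < (2 ^ t) ^ A.card := by positivity
  refine Nat.le_of_mul_le_mul_left ?_ hpos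
  calc (2 ^ t) ^ A.card * ((univ.filter (fun T : Om c s t => Final par ball A T)).card * 2 ^ I.card)
      = (univ.filter (fun T : Om c s t => Final par ball A T)).card * (2 ^ t) ^ A.card * 2 ^ I.card := by ring
    _ ≤ X.card * (2 ^ t * Fintype.card (Om c s t)) * 2 ^ I.card :=
        Nat.mul_le_mul_right _ ((Nat.mul_le_mul_right _ h1).trans a1)
    _ ≤ (((Fn d A).filter (fun x => Sib par x A)) ×ˢ (Fn true A)).card * (2 ^ t * Fintype.card (Om c s t)) * 2 ^ I.card :=
        Nat.mul_le_mul_right _ (Nat.mul_le_mul_right _ a2)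
    _ = (((Fn d A).filter (fun x => Sib par x A)) ×ˢ (Fn true A)).card * 2 ^ I.card * (2 ^ t * Fintype.card (Om c s t)) := by ring
    _ ≤ _ := Nat.mul_le_mul_right _ a3
end
end TC

namespace TC
section
variable {c s t : ℕ}

/-- relative goodness of a node with respect to a set of nodes -/
def goodW (w : ℕ) (ball : Fin (2 ^ t) → Fin c → Bits s) (x : ℕ → Fin (2 ^ t)) (S : Finset ℕ)
    (m : ℕ) : Prop :=
  (∃ k, Light w ball k (ball (x m) k)) ∧
    ∀ k, Light w ball k (ball (x m) k) → ∀ m' ∈ S, m' < m → ball (x m') k ≠ ball (x m) k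

lemma goodW_congr (w : ℕ) (ball : Fin (2 ^ t) → Fin c → Bits s) (x : ℕ → Fin (2 ^ t))
    (S S' : Finset ℕ) (m : ℕ) (h : ∀ m' < m, m' ∈ S ↔ m' ∈ S') :
    goodW w ball x S m ↔ goodW w ball x S' m := by
  unfold goodW
  refine and_congr_right fun _ => forall_congr' fun k => imp_congr_right fun _ => ?_
  constructor
  · intro h1 m' hm' hlt; exact h1 m' ((h m' hlt).2 hm') hlt
  · intro h1 m' hm' hlt; exact h1 m' ((h m' hlt).1 hm') hlt

lemma exists_active (par : ℕ → ℕ) (w : ℕ) (ball : Fin (2 ^ t) → Fin c → Bits s)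
    (x : ℕ → Fin (2 ^ t)) (Nd : Finset ℕ) (hpar : ∀ m ∈ Nd, par m < m) :
    ∃ A : Finset ℕ, ∀ m, m ∈ A ↔ m ∈ Nd ∧ (par m = 0 ∨ (par m ∈ A ∧ goodW w ball x A (par m))) := by
  have main : ∀ n, ∃ A : Finset ℕ, (∀ m ∈ A, m < n) ∧ ∀ m < n, m ∈ A ↔ m ∈ Nd ∧ (par m = 0 ∨ (par m ∈ A ∧ goodW w ball x A (par m))) := by
    intro n
    induction n with
    | zero => exact ⟨∅, by simp, by simp⟩
    | succ n ih =>
      obtain ⟨A, h1, h2⟩ := ih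
      by_cases hn : n ∈ Nd ∧ (par n = 0 ∨ (par n ∈ A ∧ goodW w ball x A (par n)))
      · refine ⟨insert n A, ?_, ?_⟩
        · intro m hm
          rcases Finset.mem_insert.1 hm with h | h
          · omega
          · have := h1 m h; omega
        · intro m hm
          have hg : ∀ u ≤ n, goodW w ball x (insert n A) u ↔ goodW w ball x A u := by
            intro u hu
            apply goodW_congr
            intro m' hm'
            rw [Finset.mem_insert]
            constructor
            · rintro (h | h)
              · omega
              · exact h
            · exact Or.inr
          by_cases hmn : m = n
          · subst hmn
            have := hpar m hn.1
            rw [hg _ this.le, Finset.mem_insert, Finset.mem_insert]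
            simp only [true_or, true_iff]
            refine ⟨hn.1, hn.2.imp_right fun h => ⟨Or.inr h.1, h.2⟩⟩
          · rw [Finset.mem_insert]
            simp only [hmn, false_or]
            rw [h2 m (by omega)]
            refine and_congr_right fun hmN => or_congr_right ?_
            have := hpar m hmN
            rw [hg _ (by omega), Finset.mem_insert]
            have : par m ≠ n := by omega
            simp [this]
      · refine ⟨A, fun m hm => (h1 m hm).trans (Nat.lt_succ_self n), ?_⟩
        intro m hm
        by_cases hmn : m = n
        · subst hmn
          constructor
          · intro h; exact absurd (h1 m h) (lt_irrefl _)
          · intro h; exact absurd h hn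
        · exact h2 m (by omega)
  obtain ⟨A, h1, h2⟩ := main (Nd.sup id + 1)
  refine ⟨A, fun m => ?_⟩
  by_cases hm : m < Nd.sup id + 1
  · exact h2 m hm
  · constructor
    · intro h; exact absurd (h1 m h) hm
    · intro h; exact absurd (Nat.lt_succ_of_le (Finset.le_sup (f := id) h.1)) hm

structure Cx (c s t : ℕ) where
  par : ℕ → ℕ
  w : ℕ
  ball : Fin (2 ^ t) → Fin c → Bits s
  hb : Function.Injective ball
  T : Om c s t
  ρ : Bits t
  x : ℕ → Fin (2 ^ t)
  l : ℕ → Bool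
  Nd : Finset ℕ
  hpar : ∀ m ∈ Nd, 0 < m ∧ par m < m ∧ (par m = 0 ∨ par m ∈ Nd)
  hR : Realized par ball T ρ x l Nd
  hdec : ∀ m ∈ Nd, par m ≠ 0 → x m < x (par m)
  hsib : Sib par x Nd
  p : ℕ
  e : ℕ
  N : ℕ
  D : ℕ
  hNd : Nd ⊆ Finset.range N
  hD : ∀ m ∈ Nd, par^[D] m = 0
  hBad : ¬ Bad par w ball p e N T
  A : Finset ℕ
  hA : ∀ m, m ∈ A ↔ m ∈ Nd ∧ (par m = 0 ∨ (par m ∈ A ∧ goodW w ball x A (par m)))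

namespace Cx
variable (C : Cx c s t)

def key (m : ℕ) : Fin c → Bits s := C.ball (C.x m)
def Lt (k : Fin c) (a : Bits s) : Prop := Light C.w C.ball k a
def φ (m : ℕ) : Vec c s := ph C.par C.ball C.x C.l m
def Good (m : ℕ) : Prop := m ∈ C.A ∧ goodW C.w C.ball C.x C.A m
noncomputable def R : Finset ℕ := C.A.filter (fun m =>
  C.φ m ∉ Submodule.span (ZMod 2) (C.φ '' {m' | m' ∈ C.A ∧ m' < m}))
noncomputable def P : Finset ℕ := C.R.filter (fun m => ¬ C.Good m)

lemma A_sub {m : ℕ} (h : m ∈ C.A) : m ∈ C.Nd := ((C.hA m).1 h).1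
lemma A_par {m : ℕ} (h : m ∈ C.A) : C.par m = 0 ∨ C.Good (C.par m) := ((C.hA m).1 h).2
lemma A_pos {m : ℕ} (h : m ∈ C.A) : 0 < m := (C.hpar m (C.A_sub h)).1
lemma A_plt {m : ℕ} (h : m ∈ C.A) : C.par m < m := (C.hpar m (C.A_sub h)).2.1
lemma child_mem {m : ℕ} (h : m ∈ C.Nd) (hp : C.par m = 0 ∨ C.Good (C.par m)) : m ∈ C.A :=
  (C.hA m).2 ⟨h, hp⟩
lemma R_sub : C.R ⊆ C.A := Finset.filter_subset _ _
lemma P_sub : C.P ⊆ C.R := Finset.filter_subset _ _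

lemma fresh_R {m : ℕ} (hm : m ∈ C.A) (k : Fin c)
    (h : ∀ m' ∈ C.A, m' < m → C.key m' k ≠ C.key m k) : m ∈ C.R := by
  refine Finset.mem_filter.2 ⟨hm, ?_⟩
  refine fresh C.par C.ball C.x C.l _ m ?_ ?_ k ?_
  · exact (C.A_par hm).imp_right fun h => ⟨h.1, C.A_plt hm⟩
  · rintro m' ⟨h1, h2⟩
    exact (C.A_par h1).imp_right fun h => ⟨h.1, (C.A_plt h1).trans h2⟩
  · rintro m' ⟨h1, h2⟩
    exact h m' h1 h2

lemma good_R {m : ℕ} (h : C.Good m) : m ∈ C.R := by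
  obtain ⟨h1, ⟨k, hk⟩, h2⟩ := h
  exact C.fresh_R h1 k (h2 k hk)

lemma R_par {m : ℕ} (h : m ∈ C.R) : C.par m = 0 ∨ C.par m ∈ C.R :=
  (C.A_par (C.R_sub h)).imp_right C.good_R

lemma R_li : LinearIndepOn (ZMod 2) C.φ (C.R : Set ℕ) := by
  apply li_of_tri
  intro m hm h
  refine (Finset.mem_filter.1 hm).2 (Submodule.span_mono (Set.image_mono ?_) h)
  rintro m' ⟨h1, h2⟩
  exact ⟨C.R_sub h1, h2⟩

lemma span_R (m : ℕ) : ∀ m' ∈ C.A, m' < m →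
    C.φ m' ∈ Submodule.span (ZMod 2) (C.φ '' ((C.R.filter (fun m' => m' < m) : Finset ℕ) : Set ℕ)) := by
  intro m'
  induction m' using Nat.strong_induction_on with
  | _ m' ih =>
    intro hm' hlt
    by_cases hR : m' ∈ C.R
    · exact Submodule.subset_span ⟨m', by simp [hR, hlt], rfl⟩
    · have : C.φ m' ∈ Submodule.span (ZMod 2) (C.φ '' {m'' | m'' ∈ C.A ∧ m'' < m'}) := by
        by_contra h
        exact hR (Finset.mem_filter.2 ⟨hm', h⟩)
      refine Submodule.span_le.2 ?_ this
      rintro _ ⟨m'', ⟨h1, h2⟩, rfl⟩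
      exact ih m'' h2 h1 (h2.trans hlt)

lemma dep {m : ℕ} (hm : m ∈ C.A) (hR : m ∉ C.R) :
    ∃ Q ⊆ C.R, (∀ q ∈ Q, q < m) ∧ C.φ m = ∑ q ∈ Q, C.φ q := by
  have h1 : C.φ m ∈ Submodule.span (ZMod 2) (C.φ '' {m' | m' ∈ C.A ∧ m' < m}) := by
    by_contra h
    exact hR (Finset.mem_filter.2 ⟨hm, h⟩)
  have h2 : C.φ m ∈ Submodule.span (ZMod 2) (C.φ '' ((C.R.filter (fun m' => m' < m) : Finset ℕ) : Set ℕ)) := by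
    refine Submodule.span_le.2 ?_ h1
    rintro _ ⟨m'', ⟨h1, h2⟩, rfl⟩
    exact C.span_R m m'' h1 h2
  obtain ⟨Q, hQ, h⟩ := mem_span_sum C.φ _ _ h2
  exact ⟨Q, hQ.trans (Finset.filter_subset _ _), fun q hq => (Finset.mem_filter.1 (hQ hq)).2, h⟩

lemma noChain (Y : Finset ℕ) (hY : Y ⊆ C.R) (he : Y.card * C.D ≤ C.e) :
    ¬ Chain C.w C.ball C.x C.p Y := by
  intro hch
  let Z := ((Y ×ˢ Finset.range C.D).image (fun q => C.par^[q.2] q.1)).filter (fun m => m ∈ C.R)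
  have hZR : Z ⊆ C.R := fun m hm => (Finset.mem_filter.1 hm).2
  have hDpos : ∀ m ∈ C.R, C.D ≠ 0 := by
    intro m hm h0
    have := C.hD m (C.A_sub (C.R_sub hm))
    rw [h0] at this
    have := C.A_pos (C.R_sub hm)
    simp_all
  refine C.hBad ⟨Z, ?_, ?_, ?_, C.ρ, C.x, C.l, ?_, ?_, ?_⟩
  · intro m hm
    exact C.hNd (C.A_sub (C.R_sub (hZR hm)))
  · refine (Finset.card_filter_le _ _).trans (Finset.card_image_le.trans ?_)
    rw [Finset.card_product, Finset.card_range]; exact he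
  · intro m hm
    obtain ⟨h1, h2⟩ := Finset.mem_filter.1 hm
    obtain ⟨⟨y, k⟩, h3, h4⟩ := Finset.mem_image.1 h1
    rw [Finset.mem_product, Finset.mem_range] at h3
    simp only at h3 h4
    rcases C.R_par h2 with h5 | h5
    · exact Or.inl h5
    · by_cases hk : k + 1 < C.D
      · right
        refine Finset.mem_filter.2 ⟨Finset.mem_image.2 ⟨(y, k + 1), ?_, ?_⟩, h5⟩
        · rw [Finset.mem_product, Finset.mem_range]; exact ⟨h3.1, hk⟩
        · simp only [Function.iterate_succ_apply', h4]
      · left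
        have : k.succ = C.D := by omega
        rw [← h4, ← Function.iterate_succ_apply' C.par k y, this]
        exact C.hD y (C.A_sub (C.R_sub (hY h3.1)))
  · intro m hm
    exact C.hR m (C.A_sub (C.R_sub (hZR hm)))
  · exact C.R_li.mono (by exact_mod_cast hZR)
  · refine hch.mono fun y hy => ?_
    refine Finset.mem_filter.2 ⟨Finset.mem_image.2 ⟨(y, 0), ?_, rfl⟩, hY hy⟩
    rw [Finset.mem_product, Finset.mem_range]
    exact ⟨hy, Nat.pos_of_ne_zero (hDpos y (hY hy))⟩
end Cx

lemma chain_pairs (w : ℕ) (ball : Fin (2 ^ t) → Fin c → Bits s) (x : ℕ → Fin (2 ^ t))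
    (P Y : Finset ℕ) (hPY : P ⊆ Y)
    (h : ∀ m ∈ P, (∀ k, ¬ Light w ball k (ball (x m) k)) ∨
      ∃ m' ∈ Y, m' < m ∧ ∃ k, Light w ball k (ball (x m) k) ∧ ball (x m') k = ball (x m) k) :
    Chain w ball x P.card Y := by
  induction P using Finset.induction_on_max generalizing Y with
  | empty => trivial
  | insert a P ha ih =>
    have haP : a ∉ P := fun h => lt_irrefl _ (ha a h)
    rw [Finset.card_insert_of_notMem haP]
    have haY : a ∈ Y := hPY (Finset.mem_insert_self _ _)
    refine ⟨{a}, by simpa using haY, ?_, ?_⟩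
    · rcases h a (Finset.mem_insert_self _ _) with h1 | ⟨m', hm', hlt, k, h1, h2⟩
      · exact Or.inl ⟨a, by simp, h1⟩
      · refine Or.inr (Or.inl ⟨a, by simp, m', ?_, hlt.ne, k, by rw [h2]; exact h1, h2.symm⟩)
        apply Finset.mem_union_left
        simp only [mem_sdiff, mem_singleton]
        exact ⟨hm', hlt.ne⟩
    · refine ih (Y \ {a}) ?_ ?_
      · intro m hm
        simp only [mem_sdiff, mem_singleton]
        exact ⟨hPY (Finset.mem_insert_of_mem hm), (ha m hm).ne⟩
      · intro m hm
        rcases h m (Finset.mem_insert_of_mem hm) with h1 | ⟨m', hm', hlt, h1⟩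
        · exact Or.inl h1
        · refine Or.inr ⟨m', ?_, hlt, h1⟩
          simp only [mem_sdiff, mem_singleton]
          exact ⟨hm', (hlt.trans (ha m hm)).ne⟩

namespace Cx
variable (C : Cx c s t)

lemma P_partner {m : ℕ} (hm : m ∈ C.P) : (∀ k, ¬ Light C.w C.ball k (C.ball (C.x m) k)) ∨
      ∃ m' ∈ C.R, m' < m ∧ ∃ k, Light C.w C.ball k (C.ball (C.x m) k) ∧
        C.ball (C.x m') k = C.ball (C.x m) k := by
  obtain ⟨hR, hg⟩ := Finset.mem_filter.1 hm
  by_cases h0 : ∀ k, ¬ Light C.w C.ball k (C.ball (C.x m) k)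
  · exact Or.inl h0
  right
  push Not at h0
  have : ∃ k, Light C.w C.ball k (C.ball (C.x m) k) ∧ ∃ m' ∈ C.A, m' < m ∧
      C.ball (C.x m') k = C.ball (C.x m) k := by
    by_contra hcon
    refine hg ⟨C.R_sub hR, h0, ?_⟩
    intro k hk m' hm' hlt heq
    exact hcon ⟨k, hk, m', hm', hlt, heq⟩
  obtain ⟨k, hk, m', h1, h2, h3⟩ := this
  have hex : ∃ m', m' ∈ C.A ∧ C.ball (C.x m') k = C.ball (C.x m) k := ⟨m', h1, h3⟩
  refine ⟨Nat.find hex, ?_, lt_of_le_of_lt (Nat.find_min' hex ⟨h1, h3⟩) h2, k, hk, (Nat.find_spec hex).2⟩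
  refine C.fresh_R (Nat.find_spec hex).1 k ?_
  intro m'' hm'' hlt heq
  refine Nat.find_min hex hlt ⟨hm'', ?_⟩
  rw [← (Nat.find_spec hex).2]; exact heq

lemma P_card (he : 2 * C.p * C.D ≤ C.e) : C.P.card < C.p := by
  by_contra hlt
  push Not at hlt
  obtain ⟨P', hP', hc⟩ := Finset.exists_subset_card_eq hlt
  have : ∀ m : ℕ, ∃ m', m ∈ P' → (m' ∈ C.R ∧ ((∀ k, ¬ Light C.w C.ball k (C.ball (C.x m) k)) ∨
      (m' < m ∧ ∃ k, Light C.w C.ball k (C.ball (C.x m) k) ∧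
        C.ball (C.x m') k = C.ball (C.x m) k))) := by
    intro m
    by_cases hm : m ∈ P'
    · rcases C.P_partner (hP' hm) with h | ⟨m', h1, h2⟩
      · exact ⟨m, fun _ => ⟨C.P_sub (hP' hm), Or.inl h⟩⟩
      · exact ⟨m', fun _ => ⟨h1, Or.inr h2⟩⟩
    · exact ⟨0, fun h => absurd h hm⟩
  choose f hf using this
  refine C.noChain (P' ∪ P'.image f) ?_ ?_ ?_
  · intro m hm
    rcases Finset.mem_union.1 hm with h | h
    · exact C.P_sub (hP' h)
    · obtain ⟨a, ha, rfl⟩ := Finset.mem_image.1 h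
      exact (hf a ha).1
  · refine le_trans (Nat.mul_le_mul_right _ ?_) he
    have h1 := Finset.card_union_le P' (P'.image f)
    have h2 := Finset.card_image_le (s := P') (f := f)
    omega
  · rw [← hc]
    refine chain_pairs _ _ _ P' _ Finset.subset_union_left ?_
    intro m hm
    refine (hf m hm).2.imp_right fun h => ⟨f m, ?_, h⟩
    exact Finset.mem_union_right _ (Finset.mem_image_of_mem f hm)

lemma good_disj {z z' : ℕ} (hz : C.Good z) (hz' : C.Good z') (hne : z ≠ z') {k : Fin c}
    (hk : C.Lt k (C.key z k)) : C.key z' k ≠ C.key z k := by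
  intro heq
  rcases lt_or_gt_of_ne hne with h | h
  · refine hz'.2.2 k ?_ z hz.1 h heq.symm
    have : C.Lt k (C.key z' k) := by rw [heq]; exact hk
    exact this
  · exact hz.2.2 k hk z' hz'.1 h heq

noncomputable def Tch : Finset ℕ := C.R.filter (fun z => C.Good z ∧
  ∃ m ∈ C.P, ∃ k, C.Lt k (C.key m k) ∧ C.key z k = C.key m k)

lemma Tch_card : C.Tch.card ≤ C.P.card * c := by
  have : C.P.card * c = (C.P ×ˢ (univ : Finset (Fin c))).card := by simp
  rw [this]
  have hsub : C.Tch ⊆ (C.P ×ˢ (univ : Finset (Fin c))).biUnion (fun q =>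
      C.Tch.filter (fun z => C.Lt q.2 (C.key z q.2) ∧ C.key z q.2 = C.key q.1 q.2)) := by
    intro z hz
    obtain ⟨m, hm, k, h1, h2⟩ := (Finset.mem_filter.1 hz).2.2
    rw [Finset.mem_biUnion]
    refine ⟨(m, k), by simp [hm], ?_⟩
    exact Finset.mem_filter.2 ⟨hz, by rw [h2]; exact h1, h2⟩
  refine (Finset.card_le_card hsub).trans ((Finset.card_biUnion_le_card_mul _ _ 1 ?_).trans (by simp))
  rintro ⟨m, k⟩ -
  rw [Finset.card_le_one]
  intro z hz z' hz'
  obtain ⟨h1, h2, h3⟩ := Finset.mem_filter.1 hz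
  obtain ⟨h1', h2', h3'⟩ := Finset.mem_filter.1 hz'
  by_contra hne
  exact C.good_disj (Finset.mem_filter.1 h1).2.1 (Finset.mem_filter.1 h1').2.1 hne h2 (h3'.trans h3.symm)

def UG (z : ℕ) : Prop := C.Good z ∧ z ∉ C.Tch

lemma UG_disj {z m : ℕ} (hz : C.UG z) (hm : m ∈ C.R) (hne : m ≠ z) {k : Fin c}
    (hk : C.Lt k (C.key z k)) : C.key m k ≠ C.key z k := by
  by_cases hg : C.Good m
  · exact C.good_disj hz.1 hg hne.symm hk
  · intro heq
    refine hz.2 (Finset.mem_filter.2 ⟨C.good_R hz.1, hz.1, m, Finset.mem_filter.2 ⟨hm, hg⟩, k, ?_, heq.symm⟩)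
    rw [heq]; exact hk

lemma UG_of {m : ℕ} (hm : m ∈ C.R) (h : m ∉ C.P ∪ C.Tch) : C.UG m := by
  rw [Finset.mem_union, not_or] at h
  refine ⟨?_, h.2⟩
  by_contra hg
  exact h.1 (Finset.mem_filter.2 ⟨hm, hg⟩)

/-- coefficient of a subset sum at a light character of an untouched good node -/
lemma coefU {z : ℕ} (hz : C.UG z) (Q : Finset ℕ) (hQ : Q ⊆ C.R) {k : Fin c}
    (hk : C.Lt k (C.key z k)) (b : Bool) :
    (∑ m ∈ Q, C.φ m) (some (b, k, C.key z k)) = (if z ∈ Q ∧ b = C.l z then 1 else 0) +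
      ∑ m ∈ Q, (if C.par m = z ∧ b = !C.l z then 1 else 0) := by
  have hz0 : z ≠ 0 := (C.A_pos hz.1.1).ne'
  have h1 : ∀ m ∈ Q, C.φ m (some (b, k, C.key z k)) = (if m = z ∧ b = C.l z then 1 else 0) +
      (if C.par m = z ∧ b = !C.l z then 1 else 0) := by
    intro m hm
    rw [φ, ph_apply]
    congr 1
    · by_cases hmz : m = z
      · subst hmz; simp [key]
      · rw [if_neg, if_neg]
        · exact fun h => hmz h.1
        · exact fun h => C.UG_disj hz (hQ hm) hmz hk h.2
    · by_cases hmz : C.par m = z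
      · rw [hmz]; simp [key, hz0]
      · rw [if_neg, if_neg]
        · exact fun h => hmz h.1
        · exact fun h => C.UG_disj hz ((C.R_par (hQ hm)).resolve_left h.1) hmz hk h.2.2
  rw [Finset.sum_apply, Finset.sum_congr rfl h1, Finset.sum_add_distrib]
  congr 1
  by_cases hb : b = C.l z
  · simp [hb]
  · simp [hb]

/-- exceptional vertices -/
def Exc (u : ℕ) : Prop := u ∈ C.Tch ∨ ∃ v ∈ C.P ∪ C.Tch, C.par v = u

noncomputable def ExcS : Finset ℕ := C.Tch ∪ (C.P ∪ C.Tch).image C.par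

lemma mem_ExcS (u : ℕ) : u ∈ C.ExcS ↔ C.Exc u := by
  simp only [ExcS, Exc, mem_union, mem_image]

lemma ExcS_card : C.ExcS.card ≤ (2 * c + 1) * C.P.card := by
  have h1 := Finset.card_union_le C.Tch ((C.P ∪ C.Tch).image C.par)
  have h2 := Finset.card_image_le (s := C.P ∪ C.Tch) (f := C.par)
  have h3 := Finset.card_union_le C.P C.Tch
  have h4 := C.Tch_card
  have : (2 * c + 1) * C.P.card = C.P.card * c + C.P.card * c + C.P.card := by ring
  unfold ExcS
  omega

lemma child_case {m u z : ℕ} (hu : C.par m = u) (hu' : u = 0 ∨ u ∈ C.R)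
    {Q : Finset ℕ} (hQ : Q ⊆ C.R) (hs : C.φ m = ∑ q ∈ Q, C.φ q) (hz : C.UG z)
    (hzQ : z ∈ Q) (hzu : z ≠ u) {k : Fin c} (hk : C.Lt k (C.key z k)) :
    C.l z = C.l m ∧ C.key m k = C.key z k := by
  have h1 := C.coefU hz Q hQ hk (C.l z)
  rw [← hs, if_pos ⟨hzQ, rfl⟩, Finset.sum_eq_zero, add_zero, φ, ph_apply, hu] at h1
  · have h2 : ¬ (u ≠ 0 ∧ C.l z = !C.l u ∧ C.ball (C.x u) k = C.key z k) := by
      rintro ⟨a1, -, a3⟩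
      exact C.UG_disj hz (hu'.resolve_left a1) (Ne.symm hzu) hk a3
    rw [if_neg h2, add_zero] at h1
    by_contra hcon
    rw [if_neg (show ¬ (C.l z = C.l m ∧ C.ball (C.x m) k = C.key z k) from hcon)] at h1
    exact zero_ne_one h1
  · intro q _
    simp
end Cx
end
end TC

namespace TC
section
variable {c s t : ℕ}

lemma evec_inj {b b' : Bool} {y y' : Fin c → Bits s} (h : evec b y = evec b' y') : y = y' := by
  funext k
  have := congrFun h (some (b, k, y k))
  rw [evec_some, evec_some, if_pos ⟨rfl, rfl⟩] at this
  by_contra hne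
  rw [if_neg (fun h => hne h.2.symm)] at this
  exact one_ne_zero this

/-- at most `d` balls with a given light character hash to a given bin on a given side -/
def F1 (w : ℕ) (ball : Fin (2 ^ t) → Fin c → Bits s) (T : Om c s t) (d : ℕ) : Prop :=
  ∀ k a, Light w ball k a → ∀ b v,
    (univ.filter (fun i => ball i k = a ∧ hs T b (ball i) = v)).card ≤ d

lemma F1_of (par : ℕ → ℕ) (w : ℕ) (ball : Fin (2 ^ t) → Fin c → Bits s)
    (hb : Function.Injective ball) (T : Om c s t) (p e N : ℕ) (hbad : ¬ Bad par w ball p e N T)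
    (hstar : ∀ m ∈ Finset.Icc 1 (p + 1), par m = 0) (he : p + 1 ≤ e) (hN : p + 2 ≤ N) :
    F1 w ball T (p ^ c) := by
  intro k a hk b v
  by_contra hlt
  push Not at hlt
  set S := univ.filter (fun i => ball i k = a ∧ hs T b (ball i) = v) with hS
  have main : ∀ j ≤ p + 1, ∃ y : ℕ → Fin (2 ^ t), ∀ m ∈ Finset.Icc 1 j, y m ∈ S ∧
      ∃ k, ∀ m' ∈ Finset.Icc 1 j, m' < m → ball (y m') k ≠ ball (y m) k := by
    intro j
    induction j with
    | zero => intro _; exact ⟨fun _ => ⟨0, by positivity⟩, by simp⟩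
    | succ j ih =>
      intro hj
      obtain ⟨y, hy⟩ := ih (by omega)
      have hex : ∃ i ∈ S, ∃ k, ∀ m ∈ Finset.Icc 1 j, ball (y m) k ≠ ball i k := by
        by_contra hcon
        push Not at hcon
        have : S.card ≤ (Fintype.piFinset (fun k : Fin c => (Finset.Icc 1 j).image (fun m => ball (y m) k))).card := by
          refine Finset.card_le_card_of_injOn ball ?_ hb.injOn
          intro i hi
          simp only [Fintype.coe_piFinset, Set.mem_pi, mem_coe, mem_image]
          intro k _
          exact hcon i hi k
        rw [Fintype.card_piFinset] at this
        have h2 : ∏ k : Fin c, ((Finset.Icc 1 j).image (fun m => ball (y m) k)).card ≤ p ^ c := by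
          refine (Finset.prod_le_prod' (g := fun _ => p) fun k _ => ?_).trans (by simp)
          refine Finset.card_image_le.trans ?_
          simp; omega
        omega
      obtain ⟨i, hi, k', hk'⟩ := hex
      refine ⟨Function.update y (j + 1) i, ?_⟩
      intro m hm
      rw [Finset.mem_Icc] at hm
      by_cases hmj : m = j + 1
      · subst hmj
        rw [Function.update_self]
        refine ⟨hi, k', fun m' hm' hlt' => ?_⟩
        rw [Function.update_of_ne (by omega)]
        exact hk' m' (by rw [Finset.mem_Icc] at hm' ⊢; omega)
      · rw [Function.update_of_ne hmj]
        obtain ⟨h1, k2, h2⟩ := hy m (by rw [Finset.mem_Icc]; omega)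
        refine ⟨h1, k2, fun m' hm' hlt' => ?_⟩
        rw [Finset.mem_Icc] at hm'
        rw [Function.update_of_ne (by omega)]
        exact h2 m' (by rw [Finset.mem_Icc]; omega) hlt'
  obtain ⟨y, hy⟩ := main (p + 1) le_rfl
  refine hbad ⟨Finset.Icc 1 (p + 1), ?_, by simpa using he, fun m hm => Or.inl (hstar m hm), v, y,
    fun _ => b, ?_, ?_, ?_⟩
  · intro m hm
    rw [Finset.mem_Icc] at hm
    rw [Finset.mem_range]; omega
  · intro m hm
    rw [hstar m hm]
    have := (hy m hm).1
    rw [hS, Finset.mem_filter] at this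
    simpa [VV] using this.2.2
  · apply li_of_tri
    intro m hm
    obtain ⟨k, hk⟩ := (hy m hm).2
    refine fresh par ball y _ _ m (Or.inl (hstar m hm)) ?_ k ?_
    · rintro m' ⟨h1, h2⟩
      exact Or.inl (hstar m' h1)
    · rintro m' ⟨h1, h2⟩
      exact hk m' h1 h2
  · have := chain_pairs w ball y (Finset.Icc 2 (p + 1)) (Finset.Icc 1 (p + 1))
      (Finset.Icc_subset_Icc (by omega) le_rfl) ?_
    · simpa using this
    · intro m hm
      rw [Finset.mem_Icc] at hm
      have hk1 : ∀ m ∈ Finset.Icc 1 (p + 1), ball (y m) k = a := by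
        intro m hm
        have := (hy m hm).1
        rw [hS, Finset.mem_filter] at this
        exact this.2.1
      right
      have e1 := hk1 1 (by rw [Finset.mem_Icc]; omega)
      have e2 := hk1 m (by rw [Finset.mem_Icc]; omega)
      refine ⟨1, by rw [Finset.mem_Icc]; omega, by omega, k, ?_, ?_⟩
      · rw [e2]; exact hk
      · rw [e1, e2]

namespace Cx
variable (C : Cx c s t)

lemma L1 {m u : ℕ} (hm : m ∈ C.A) (hmR : m ∉ C.R) (hu : C.par m = u) (hE : ¬ C.Exc u) :
    ∃ z, C.UG z ∧ ((C.par z = u ∧ z ∈ C.A ∧ C.l z = C.l m) ∨ (z = u ∧ u ≠ 0 ∧ C.l m = !C.l u)) ∧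
      ∀ k, C.Lt k (C.key z k) → C.key m k = C.key z k := by
  obtain ⟨Q, hQ, -, hs⟩ := C.dep hm hmR
  have hu' : u = 0 ∨ u ∈ C.R := by
    rw [← hu]; exact (C.A_par hm).imp_right C.good_R
  by_cases hch : ∃ z ∈ Q, C.par z = u
  · obtain ⟨z, hzQ, hzu⟩ := hch
    have hzA := C.R_sub (hQ hzQ)
    have hUG : C.UG z := by
      refine C.UG_of (hQ hzQ) fun h => hE (Or.inr ⟨z, h, hzu⟩)
    have hne : z ≠ u := by
      have := C.A_plt hzA
      omega
    obtain ⟨k, hk⟩ := hUG.1.2.1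
    refine ⟨z, hUG, Or.inl ⟨hzu, hzA, (C.child_case hu hu' hQ hs hUG hzQ hne hk).1⟩, ?_⟩
    intro k hk
    exact (C.child_case hu hu' hQ hs hUG hzQ hne hk).2
  · push Not at hch
    by_cases hu0 : u = 0
    · exfalso
      have h1 := congrFun hs none
      rw [Finset.sum_apply, Finset.sum_eq_zero, φ, ph_none, if_pos (hu.trans hu0)] at h1
      · exact one_ne_zero h1
      · intro q hq
        rw [φ, ph_none, if_neg (fun h => hch q hq (h.trans hu0.symm))]
    · have hUG : C.UG u := by
        refine ⟨?_, fun h => hE (Or.inl h)⟩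
        have := (C.A_par hm)
        rw [hu] at this
        exact this.resolve_left hu0
      have key : ∀ k, C.Lt k (C.key u k) → (!C.l u) = C.l m ∧ C.ball (C.x m) k = C.key u k := by
        intro k hk
        have h1 := C.coefU hUG Q hQ hk (!C.l u)
        rw [← hs, Finset.sum_eq_zero, add_zero, if_neg (by simp), φ, ph_apply, hu,
          if_pos (c := u ≠ 0 ∧ _) ⟨hu0, rfl, rfl⟩] at h1
        · by_contra hcon
          rw [if_neg hcon] at h1
          simp at h1
        · intro q hq
          rw [if_neg (fun h => hch q hq h.1)]
      obtain ⟨k, hk⟩ := hUG.1.2.1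
      exact ⟨u, hUG, Or.inr ⟨rfl, hu0, (key k hk).1.symm⟩, fun k hk => (key k hk).2⟩

noncomputable def ch (u : ℕ) : Finset ℕ := C.A.filter (fun m => C.par m = u)
noncomputable def gch (u : ℕ) : Finset ℕ := C.A.filter (fun m => C.par m = u ∧ C.Good m)

lemma x_inj_ch (u : ℕ) : Set.InjOn C.x (C.ch u : Set ℕ) := by
  intro m hm m' hm' h
  obtain ⟨h1, h2⟩ := Finset.mem_filter.1 hm
  obtain ⟨h1', h2'⟩ := Finset.mem_filter.1 hm'
  rcases lt_trichotomy m m' with h' | h' | h'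
  · have := C.hsib m (C.A_sub h1) m' (C.A_sub h1') (h2.trans h2'.symm) h'
    rw [h] at this; exact absurd this (lt_irrefl _)
  · exact h'
  · have := C.hsib m' (C.A_sub h1') m (C.A_sub h1) (h2'.trans h2.symm) h'
    rw [h] at this; exact absurd this (lt_irrefl _)

lemma ch_share {d : ℕ} (hF : F1 C.w C.ball C.T d) (u : ℕ) (k : Fin c) (a : Bits s)
    (hk : C.Lt k a) (b : Bool) (S : Finset ℕ) (hS : S ⊆ C.ch u)
    (h : ∀ m ∈ S, C.key m k = a ∧ C.l m = b) : S.card ≤ d := by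
  refine le_trans ?_ (hF k a hk b (VV C.ball C.T C.ρ C.x C.l u))
  refine Finset.card_le_card_of_injOn C.x ?_ ((C.x_inj_ch u).mono (by exact_mod_cast hS))
  intro m hm
  obtain ⟨h1, h2⟩ := Finset.mem_filter.1 (hS hm)
  obtain ⟨h3, h4⟩ := h m hm
  simp only [coe_filter, mem_univ, true_and, Set.mem_ofPred_eq]
  refine ⟨h3, ?_⟩
  have := C.hR m (C.A_sub h1)
  rw [h2, h4] at this
  exact this

lemma ch_le {d : ℕ} (hF : F1 C.w C.ball C.T d) (u : ℕ) (hE : ¬ C.Exc u) :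
    (C.ch u).card ≤ (C.gch u).card + d * ((C.gch u).card + 1) := by
  have hsub : C.ch u ⊆ C.gch u ∪ (insert u (C.gch u)).biUnion (fun z =>
      (C.ch u).filter (fun m => C.UG z ∧ C.l m = (if z = u then !C.l u else C.l z) ∧
        ∀ k, C.Lt k (C.key z k) → C.key m k = C.key z k)) := by
    intro m hm
    obtain ⟨hmA, hmu⟩ := Finset.mem_filter.1 hm
    by_cases hR : m ∈ C.R
    · apply Finset.mem_union_left
      refine Finset.mem_filter.2 ⟨hmA, hmu, ?_⟩
      exact (C.UG_of hR fun h => hE (Or.inr ⟨m, h, hmu⟩)).1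
    · apply Finset.mem_union_right
      obtain ⟨z, hz, h1, h2⟩ := C.L1 hmA hR hmu hE
      rw [Finset.mem_biUnion]
      refine ⟨z, ?_, Finset.mem_filter.2 ⟨hm, hz, ?_, h2⟩⟩
      · rcases h1 with h1 | h1
        · exact Finset.mem_insert_of_mem (Finset.mem_filter.2 ⟨h1.2.1, h1.1, hz.1⟩)
        · rw [h1.1]; exact Finset.mem_insert_self _ _
      · rcases h1 with h1 | h1
        · have : z ≠ u := by
            have := C.A_plt h1.2.1
            omega
          rw [if_neg this, h1.2.2]
        · rw [if_pos h1.1, h1.2.2]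
  refine (Finset.card_le_card hsub).trans ((Finset.card_union_le _ _).trans (Nat.add_le_add_left ?_ _))
  refine (Finset.card_biUnion_le_card_mul _ _ d ?_).trans ?_
  · intro z hz
    by_cases hUG : C.UG z
    · obtain ⟨k, hk⟩ := hUG.1.2.1
      refine C.ch_share hF u k (C.key z k) hk (if z = u then !C.l u else C.l z) _
        (Finset.filter_subset _ _) ?_
      intro m hm
      obtain ⟨-, -, h1, h2⟩ := Finset.mem_filter.1 hm
      exact ⟨h2 k hk, h1⟩
    · simp [hUG]
  · rw [mul_comm]
    exact Nat.mul_le_mul_left _ (Finset.card_insert_le _ _)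

lemma root_le {d : ℕ} (hF : F1 C.w C.ball C.T d)
    (hroot : ∀ m ∈ C.Nd, C.par m = 0 → ∀ m' ∈ C.Nd, m' < m → C.par m' = 0) :
    (C.ch 0).card ≤ (C.gch 0).card + C.P.card + d * (C.gch 0).card + 2 ^ (C.P ∪ C.Tch).card := by
  let S1 := (C.ch 0).filter (fun m => ∃ Q ⊆ C.P ∪ C.Tch, C.φ m = ∑ q ∈ Q, C.φ q)
  have hsub : C.ch 0 ⊆ ((C.gch 0 ∪ C.P) ∪ (C.gch 0).biUnion (fun z =>
      (C.ch 0).filter (fun m => C.UG z ∧ C.l m = C.l z ∧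
        ∀ k, C.Lt k (C.key z k) → C.key m k = C.key z k))) ∪ S1 := by
    intro m hm
    obtain ⟨hmA, hmu⟩ := Finset.mem_filter.1 hm
    by_cases hR : m ∈ C.R
    · apply Finset.mem_union_left
      apply Finset.mem_union_left
      by_cases hg : C.Good m
      · exact Finset.mem_union_left _ (Finset.mem_filter.2 ⟨hmA, hmu, hg⟩)
      · exact Finset.mem_union_right _ (Finset.mem_filter.2 ⟨hR, hg⟩)
    · obtain ⟨Q, hQ, hlt, hs⟩ := C.dep hmA hR
      by_cases hQP : Q ⊆ C.P ∪ C.Tch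
      · exact Finset.mem_union_right _ (Finset.mem_filter.2 ⟨hm, Q, hQP, hs⟩)
      · apply Finset.mem_union_left
        apply Finset.mem_union_right
        rw [Finset.not_subset] at hQP
        obtain ⟨z, hzQ, hzP⟩ := hQP
        have hUG := C.UG_of (hQ hzQ) hzP
        have hzA := C.R_sub (hQ hzQ)
        have hz0 : C.par z = 0 := hroot m (C.A_sub hmA) hmu z (C.A_sub hzA) (hlt z hzQ)
        have hzne : z ≠ 0 := (C.A_pos hzA).ne'
        rw [Finset.mem_biUnion]
        refine ⟨z, Finset.mem_filter.2 ⟨hzA, hz0, hUG.1⟩, Finset.mem_filter.2 ⟨hm, hUG, ?_, ?_⟩⟩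
        · obtain ⟨k, hk⟩ := hUG.1.2.1
          exact (C.child_case hmu (Or.inl rfl) hQ hs hUG hzQ hzne hk).1.symm
        · intro k hk
          exact (C.child_case hmu (Or.inl rfl) hQ hs hUG hzQ hzne hk).2
  have hS1 : S1.card ≤ 2 ^ (C.P ∪ C.Tch).card := by
    rw [← Finset.card_powerset]
    have : ∀ m : ℕ, ∃ Q, m ∈ S1 → Q ⊆ C.P ∪ C.Tch ∧ C.φ m = ∑ q ∈ Q, C.φ q := by
      intro m
      by_cases hm : m ∈ S1
      · obtain ⟨Q, h⟩ := (Finset.mem_filter.1 hm).2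
        exact ⟨Q, fun _ => h⟩
      · exact ⟨∅, fun h => absurd h hm⟩
    choose Q hQ using this
    refine Finset.card_le_card_of_injOn Q (fun m hm => by rw [mem_coe, Finset.mem_powerset]; exact (hQ m hm).1) ?_
    intro m hm m' hm' heq
    have e1 := (hQ m hm).2
    rw [heq, ← (hQ m' hm').2] at e1
    have hc := (Finset.mem_filter.1 hm).1
    have hc' := (Finset.mem_filter.1 hm').1
    refine C.x_inj_ch 0 hc hc' ?_
    rw [φ, φ, ph, ph, (Finset.mem_filter.1 hc).2, (Finset.mem_filter.1 hc').2, add_left_inj] at e1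
    exact C.hb (evec_inj e1)
  have hB : ((C.gch 0).biUnion (fun z =>
      (C.ch 0).filter (fun m => C.UG z ∧ C.l m = C.l z ∧
        ∀ k, C.Lt k (C.key z k) → C.key m k = C.key z k))).card ≤ (C.gch 0).card * d := by
    refine Finset.card_biUnion_le_card_mul _ _ d ?_
    intro z hz
    by_cases hUG : C.UG z
    · obtain ⟨k, hk⟩ := hUG.1.2.1
      refine C.ch_share hF 0 k (C.key z k) hk (C.l z) _ (Finset.filter_subset _ _) ?_
      intro m hm
      obtain ⟨-, -, h1, h2⟩ := Finset.mem_filter.1 hm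
      exact ⟨h2 k hk, h1⟩
    · simp [hUG]
  refine (Finset.card_le_card hsub).trans ((Finset.card_union_le _ _).trans (Nat.add_le_add ?_ hS1))
  refine (Finset.card_union_le _ _).trans (Nat.add_le_add (Finset.card_union_le _ _) ?_)
  rw [mul_comm]; exact hB

/-- the `κ` relation for implied nodes -/
lemma kapRel {m : ℕ} (hm : m ∈ C.A) (hmR : m ∉ C.R) :
    ∃ W ⊆ C.R, kap (C.key m) = ∑ q ∈ W, kap (C.key q) := by
  obtain ⟨Q, hQ, -, hs⟩ := C.dep hm hmR
  refine mem_span_sum (fun q => kap (C.key q)) C.R _ ?_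
  set M := Submodule.span (ZMod 2) ((fun q => kap (C.key q)) '' (C.R : Set ℕ)) with hM
  have hmem : ∀ q ∈ C.R, kap (C.key q) ∈ M := fun q hq => Submodule.subset_span ⟨q, hq, rfl⟩
  let pr : Vec c s →ₗ[ZMod 2] (Fin c × Bits s → ZMod 2) :=
    LinearMap.funLeft (ZMod 2) (ZMod 2) (fun q : Fin c × Bits s => some (C.l m, q.1, q.2))
  have hpr_e : ∀ b y, pr (evec b y) = if b = C.l m then kap y else 0 := by
    intro b y
    funext q
    simp only [pr, LinearMap.funLeft_apply, evec_some]
    by_cases hb : b = C.l m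
    · simp [hb, kap]
    · simp [hb, Ne.symm hb]
  have hpr_v : ∀ u, u = 0 ∨ u ∈ C.R → pr (vv C.ball C.x C.l u) ∈ M := by
    intro u hu
    unfold vv
    split_ifs with h0
    · have : pr rvec = 0 := by funext q; simp [pr, LinearMap.funLeft_apply, rvec]
      rw [this]; exact M.zero_mem
    · rw [hpr_e]
      split_ifs
      · exact hmem u (hu.resolve_left h0)
      · exact M.zero_mem
  have h1 : pr (C.φ m) ∈ M := by
    rw [hs, map_sum]
    refine Submodule.sum_mem _ fun q hq => ?_
    rw [φ, ph, map_add]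
    refine M.add_mem ?_ (hpr_v _ (C.R_par (hQ hq)))
    rw [hpr_e]
    split_ifs
    · exact hmem q (hQ hq)
    · exact M.zero_mem
  rw [φ, ph, map_add, hpr_e, if_pos rfl] at h1
  have h2 := hpr_v (C.par m) ((C.A_par hm).imp_right C.good_R)
  have := M.sub_mem h1 h2
  rwa [add_sub_cancel_right] at this

lemma kapW {i : Fin (2 ^ t)} {W : Finset ℕ} (hW : W ⊆ C.R)
    (h : kap (C.ball i) = ∑ q ∈ W, kap (C.key q)) {z : ℕ} (hz : C.UG z) {k : Fin c}
    (hk : C.Lt k (C.key z k)) : z ∈ W ↔ C.ball i k = C.key z k := by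
  have h1 := congrFun h (k, C.key z k)
  rw [Finset.sum_apply] at h1
  have h2 : ∀ q ∈ W, kap (C.key q) (k, C.key z k) = if q = z then 1 else 0 := by
    intro q hq
    by_cases hqz : q = z
    · simp [hqz, kap]
    · simp only [kap, hqz, if_false]
      rw [if_neg (C.UG_disj hz (hW hq) hqz hk)]
  rw [Finset.sum_congr rfl h2] at h1
  simp only [kap, Finset.sum_ite_eq'] at h1
  by_cases hzW : z ∈ W <;> by_cases hi : C.ball i k = C.key z k <;> simp_all
end Cx
end
end TC

namespace TC
section
variable {c s t : ℕ}

lemma Cx.embed_final (C : Cx c s t) (par' f : ℕ → ℕ) (A' : Finset ℕ)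
    (hp : ∀ m ∈ A', par' m = 0 ∨ par' m ∈ A') (hpos : ∀ m ∈ A', m ≠ 0)
    (hf : ∀ m ∈ A', C.Good (f m) ∧ C.par (f m) = f (par' m))
    (hinj : ∀ m ∈ A', ∀ m' ∈ A', f m = f m' → m = m')
    (hmono : ∀ m ∈ A', ∀ m' ∈ A', par' m = par' m' → m < m' → f m < f m') :
    Final par' C.ball A' C.T := by
  refine ⟨VV C.ball C.T C.ρ C.x C.l (f 0), C.x ∘ f, C.l ∘ f, ?_, ?_, ?_⟩
  · intro m hm
    have h1 := C.hR (f m) (C.A_sub (hf m hm).1.1)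
    have h2 := (hf m hm).2
    rw [h2] at h1
    simp only [Function.comp]
    rw [h1]
    rcases hp m hm with h0 | h0
    · rw [h0]; simp [VV]
    · have h3 : f (par' m) ≠ 0 := (C.A_pos (hf _ h0).1.1).ne'
      simp [VV, h3, hpos _ h0]
  · intro m hm
    obtain ⟨k, hk⟩ := (hf m hm).1.2.1
    refine ⟨k, fun m' hm' hne => ?_⟩
    exact C.good_disj (hf m hm).1 (hf m' hm').1 (fun h => hne (hinj m hm m' hm' h).symm) hk
  · intro m hm m' hm' hpp hlt
    refine C.hsib (f m) (C.A_sub (hf m hm).1.1) (f m') (C.A_sub (hf m' hm').1.1) ?_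
      (hmono m hm m' hm' hpp hlt)
    rw [(hf m hm).2, (hf m' hm').2, hpp]

/-- heap depth -/
def hdep (B : ℕ) : ℕ → ℕ
  | 0 => 0
  | m + 1 => hdep B (m / B) + 1
decreasing_by exact Nat.lt_succ_of_le (Nat.div_le_self _ _)

def hpr (B m : ℕ) : ℕ := (m - 1) / B

lemma hdep_pos (B : ℕ) {m : ℕ} (hm : 0 < m) : hdep B m = hdep B (hpr B m) + 1 := by
  obtain ⟨m, rfl⟩ : ∃ k, m = k + 1 := ⟨m - 1, by omega⟩
  rw [hdep]; simp [hpr]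

lemma hpr_lt (B : ℕ) {m : ℕ} (hm : 0 < m) : hpr B m < m := by
  have := Nat.div_le_self (m - 1) B
  unfold hpr; omega

lemma hpr_decomp (B m : ℕ) (hm : 0 < m) : m = B * hpr B m + (m - 1) % B + 1 := by
  have := Nat.div_add_mod (m - 1) B
  unfold hpr; omega

lemma hpr_child (B u r : ℕ) (hr : r < B) : hpr B (B * u + r + 1) = u := by
  unfold hpr
  rw [Nat.add_sub_cancel, Nat.mul_add_div (by omega), Nat.div_eq_of_lt hr, add_zero]

lemma hdep_ub (B : ℕ) (hB : 0 < B) (m : ℕ) : m + 1 ≤ (B + 1) ^ hdep B m := by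
  induction m using Nat.strong_induction_on with
  | _ m ih =>
    rcases Nat.eq_zero_or_pos m with h | h
    · subst h; simp [hdep]
    · rw [hdep_pos B h, pow_succ]
      have h1 := ih _ (hpr_lt B h)
      have h2 := hpr_decomp B m h
      have h3 := Nat.mod_lt (m - 1) hB
      nlinarith

lemma hdep_lb (B : ℕ) (hB : 2 ≤ B) (m : ℕ) : 2 ^ hdep B m ≤ m + 1 := by
  induction m using Nat.strong_induction_on with
  | _ m ih =>
    rcases Nat.eq_zero_or_pos m with h | h
    · subst h; simp [hdep]
    · rw [hdep_pos B h, pow_succ]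
      have h1 := ih _ (hpr_lt B h)
      have h2 := hpr_decomp B m h
      have h3 : 2 * hpr B m ≤ B * hpr B m := Nat.mul_le_mul_right _ hB
      omega

lemma hpr_iter (B : ℕ) (D m : ℕ) (h : hdep B m ≤ D) : (hpr B)^[D] m = 0 := by
  induction D generalizing m with
  | zero =>
    rcases Nat.eq_zero_or_pos m with h' | h'
    · simp [h']
    · rw [hdep_pos B h'] at h; omega
  | succ D ih =>
    rw [Function.iterate_succ_apply]
    apply ih
    rcases Nat.eq_zero_or_pos m with h' | h'
    · subst h'; simp [hpr, hdep]
    · rw [hdep_pos B h'] at h; omega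

/-- choose a 5-ary sub-tree -/
lemma Cx.embed5 (C : Cx c s t) (dep : ℕ → ℕ) (D M : ℕ) (U : ℕ → Prop) (hU0 : U 0) (hd0 : dep 0 = 0)
    (hU : ∀ u, U u → dep u < D → ∃ S : Finset ℕ, 5 ≤ S.card ∧
      ∀ m ∈ S, U m ∧ C.Good m ∧ C.par m = u ∧ dep m = dep u + 1) (hM : M < 2 ^ D) :
    Final (hpr 5) C.ball (Finset.Icc 1 (5 * M)) C.T := by
  have : ∀ u, ∃ g : ℕ → ℕ, U u → dep u < D → (∀ r < 5, U (g r) ∧ C.Good (g r) ∧ C.par (g r) = u ∧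
      dep (g r) = dep u + 1) ∧ ∀ r < 5, ∀ r' < 5, r < r' → g r < g r' := by
    intro u
    by_cases h : U u ∧ dep u < D
    · obtain ⟨S, hS, h1⟩ := hU u h.1 h.2
      obtain ⟨S', hS', hc⟩ := Finset.exists_subset_card_eq hS
      refine ⟨fun r => if hr : r < 5 then S'.orderEmbOfFin hc ⟨r, hr⟩ else 0, fun _ _ => ⟨?_, ?_⟩⟩
      · intro r hr
        simp only [dif_pos hr]
        exact h1 _ (hS' (Finset.orderEmbOfFin_mem _ _ _))
      · intro r hr r' hr' hlt
        simp only [dif_pos hr, dif_pos hr']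
        simpa using hlt
    · exact ⟨fun _ => 0, fun a b => absurd ⟨a, b⟩ h⟩
  choose g hg using this
  let F : ℕ → ℕ := fun m => Nat.strongRec (motive := fun _ => ℕ) (fun m ih =>
    if h : 0 < m then g (ih (hpr 5 m) (hpr_lt 5 h)) ((m - 1) % 5) else 0) m
  have F0 : F 0 = 0 := by
    simp only [F]; rw [Nat.strongRec_eq]; simp
  have Fs : ∀ m, 0 < m → F m = g (F (hpr 5 m)) ((m - 1) % 5) := by
    intro m hm
    simp only [F]; rw [Nat.strongRec_eq, dif_pos hm]
  have key : ∀ m, hdep 5 m ≤ D → U (F m) ∧ dep (F m) = hdep 5 m ∧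
      (0 < m → C.Good (F m) ∧ C.par (F m) = F (hpr 5 m)) := by
    intro m
    induction m using Nat.strong_induction_on with
    | _ m ih =>
      intro hm
      rcases Nat.eq_zero_or_pos m with h | h
      · subst h; rw [F0]; exact ⟨hU0, by simp [hd0, hdep], fun h => absurd h (lt_irrefl _)⟩
      · rw [hdep_pos 5 h] at hm ⊢
        obtain ⟨a1, a2, -⟩ := ih _ (hpr_lt 5 h) (by omega)
        obtain ⟨b1, b2, b3, b4⟩ := (hg _ a1 (by omega)).1 ((m - 1) % 5) (Nat.mod_lt _ (by norm_num))
        rw [Fs m h]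
        exact ⟨b1, by rw [b4, a2], fun _ => ⟨b2, b3⟩⟩
  have hdI : ∀ m ∈ Finset.Icc 1 (5 * M), 0 < m ∧ hpr 5 m < M ∧ hdep 5 (hpr 5 m) < D ∧ hdep 5 m ≤ D := by
    intro m hm
    rw [Finset.mem_Icc] at hm
    have h1 : hpr 5 m < M := by unfold hpr; omega
    have h2 := hdep_lb 5 (by norm_num) (hpr 5 m)
    have h3 : hdep 5 (hpr 5 m) < D := by
      by_contra hcon
      push Not at hcon
      have := Nat.pow_le_pow_right (n := 2) (by norm_num) hcon
      omega
    have h4 := hdep_pos 5 (show 0 < m by omega)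
    exact ⟨by omega, h1, h3, by omega⟩
  have hstep : ∀ m ∈ Finset.Icc 1 (5 * M), ∀ m' ∈ Finset.Icc 1 (5 * M), hpr 5 m = hpr 5 m' →
      m < m' → F m < F m' := by
    intro m hm m' hm' hpp hlt
    obtain ⟨a1, a2, a3, a4⟩ := hdI m hm
    obtain ⟨b1, b2, b3, b4⟩ := hdI m' hm'
    rw [Fs m a1, Fs m' b1, hpp]
    obtain ⟨c1, c2, -⟩ := key _ b3.le
    refine (hg _ c1 (by omega)).2 _ (Nat.mod_lt _ (by norm_num)) _ (Nat.mod_lt _ (by norm_num)) ?_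
    have e1 := hpr_decomp 5 m a1
    have e2 := hpr_decomp 5 m' b1
    rw [← hpp] at e2
    omega
  refine C.embed_final (hpr 5) F _ ?_ ?_ ?_ ?_ hstep
  · intro m hm
    have := hdI m hm
    rw [Finset.mem_Icc]
    omega
  · intro m hm; exact (hdI m hm).1.ne'
  · intro m hm
    obtain ⟨a1, a2, a3, a4⟩ := hdI m hm
    exact (key m a4).2.2 a1
  · intro m
    induction m using Nat.strong_induction_on with
    | _ m ih =>
      intro hm m' hm' heq
      obtain ⟨a1, a2, a3, a4⟩ := hdI m hm
      obtain ⟨b1, b2, b3, b4⟩ := hdI m' hm'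
      have k1 := ((key m a4).2.2 a1).2
      have k2 := ((key m' b4).2.2 b1).2
      rw [heq, k2] at k1
      have hpp : hpr 5 m = hpr 5 m' := by
        rcases Nat.eq_zero_or_pos (hpr 5 m) with h | h
        · rcases Nat.eq_zero_or_pos (hpr 5 m') with h' | h'
          · omega
          · exfalso
            rw [h, F0] at k1
            have := C.A_pos ((key _ b3.le).2.2 h').1.1
            omega
        · rcases Nat.eq_zero_or_pos (hpr 5 m') with h' | h'
          · exfalso
            rw [h', F0] at k1
            have := C.A_pos ((key _ a3.le).2.2 h).1.1
            omega
          · refine ih _ (hpr_lt 5 a1) ?_ _ ?_ k1.symm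
            · rw [Finset.mem_Icc]; omega
            · rw [Finset.mem_Icc]; omega
      rcases lt_trichotomy m m' with h | h | h
      · have := hstep m hm m' hm' hpp h; omega
      · exact h
      · have := hstep m' hm' m hm hpp.symm h; omega

/-- deterministic part of the high probability bound -/
lemma hp_det (ball : Fin (2 ^ t) → Fin c → Bits s) (hb : Function.Injective ball)
    (rule : Fin (2 ^ t) → (Bits t → ℕ) → Bool) (T : Om c s t) (B D M p e w : ℕ)
    (hB1 : (p ^ c + 1) * (5 + (2 * c + 1) * p) + p ^ c + p + 2 ^ (p + p * c) + p + 1 ≤ B)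
    (he1 : 2 * p * D ≤ e) (he2 : p + 1 ≤ e) (hM : M < 2 ^ D) (hD : 1 ≤ D)
    (hbad : ¬ Bad (hpr B) w ball p e ((B + 1) ^ D) T)
    (ρ : Bits t) (hρ : B * D ≤ LL ball rule T (2 ^ t) ρ) :
    Final (hpr 5) ball (Finset.Icc 1 (5 * M)) T := by
  have hB0 : p + 6 ≤ B := by
    have : 1 ≤ (p^c + 1) := by omega
    have : 5 ≤ (p ^ c + 1) * (5 + (2 * c + 1) * p) := by nlinarith [Nat.zero_le ((2*c+1)*p)]
    have : 1 ≤ 2 ^ (p + p * c) := Nat.one_le_two_pow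
    omega
  set N := (B + 1) ^ D with hN
  let Nd := (Finset.range N).filter (fun m => 0 < m ∧ hdep B m ≤ D)
  have hNd : ∀ m, m ∈ Nd ↔ 0 < m ∧ hdep B m ≤ D := by
    intro m
    simp only [Nd, Finset.mem_filter, Finset.mem_range, and_iff_right_iff_imp]
    rintro ⟨h1, h2⟩
    have := hdep_ub B (by omega) m
    have h3 := Nat.pow_le_pow_right (n := B + 1) (by omega) h2
    omega
  have hNp : ∀ m ∈ Nd, 0 < m ∧ hpr B m < m ∧ (hpr B m = 0 ∨ hpr B m ∈ Nd) := by
    intro m hm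
    rw [hNd] at hm
    refine ⟨hm.1, hpr_lt B hm.1, ?_⟩
    rcases Nat.eq_zero_or_pos (hpr B m) with h | h
    · exact Or.inl h
    · right; rw [hNd]
      have := hdep_pos B hm.1
      exact ⟨h, by omega⟩
  have hstep : ∀ m ∈ Nd, B * (D - hdep B (hpr B m)) = B * (D - hdep B m) + B := by
    intro m hm
    rw [hNd] at hm
    have := hdep_pos B hm.1
    have : D - hdep B (hpr B m) = (D - hdep B m) + 1 := by omega
    rw [this]; ring
  let ht : ℕ → ℕ := fun m => B * (D - hdep B m)
  let lev : ℕ → ℕ := fun m => B * (D - hdep B (hpr B m)) - 1 - (m - 1) % B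
  have H0 : ∀ m ∈ Nd, 0 < m ∧ hpr B m < m ∧ (hpr B m = 0 ∨ hpr B m ∈ Nd) ∧ lev m < ht (hpr B m) ∧
      ht m ≤ lev m := by
    intro m hm
    obtain ⟨h1, h2, h3⟩ := hNp m hm
    have h4 := hstep m hm
    have h5 := Nat.mod_lt (m - 1) (show 0 < B by omega)
    refine ⟨h1, h2, h3, ?_, ?_⟩
    · simp only [ht, lev]; omega
    · simp only [ht, lev]; omega
  have H1 : ∀ m ∈ Nd, ∀ m' ∈ Nd, hpr B m = hpr B m' → m < m' → lev m' < lev m := by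
    intro m hm m' hm' hpp hlt
    have h4 := hstep m hm
    have h5 := Nat.mod_lt (m - 1) (show 0 < B by omega)
    have h6 := Nat.mod_lt (m' - 1) (show 0 < B by omega)
    have e1 := hpr_decomp B m (hNp m hm).1
    have e2 := hpr_decomp B m' (hNp m' hm').1
    simp only [lev]
    rw [← hpp] at e2 ⊢
    omega
  obtain ⟨x, l, hR, hdec, hsib⟩ := realize ball rule T (hpr B) ht lev Nd H0 H1 ρ
    (by simpa [ht, hdep] using hρ)
  obtain ⟨A, hA⟩ := exists_active (hpr B) w ball x Nd (fun m hm => (hNp m hm).2.1)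
  let C : Cx c s t :=
    { par := hpr B, w := w, ball := ball, hb := hb, T := T, ρ := ρ, x := x, l := l, Nd := Nd,
      hpar := hNp, hR := hR, hdec := hdec, hsib := hsib, p := p, e := e, N := N, D := D,
      hNd := Finset.filter_subset _ _, hD := fun m hm => hpr_iter B D m ((hNd m).1 hm).2,
      hBad := hbad, A := A, hA := hA }
  have hF : F1 C.w C.ball C.T (p ^ c) := by
    refine F1_of (hpr B) w ball hb T p e N hbad ?_ he2 ?_
    · intro m hm
      rw [Finset.mem_Icc] at hm
      exact Nat.div_eq_of_lt (by omega)
    · have : (B + 1) ^ 1 ≤ N := Nat.pow_le_pow_right (by omega) hD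
      rw [pow_one] at this
      omega
  have hP : C.P.card < p := C.P_card he1
  have hPT : (C.P ∪ C.Tch).card ≤ p + p * c := by
    have h1 := Finset.card_union_le C.P C.Tch
    have h2 := C.Tch_card
    have h3 : C.P.card * c ≤ p * c := Nat.mul_le_mul_right _ hP.le
    omega
  have hX : C.ExcS.card ≤ (2 * c + 1) * p := C.ExcS_card.trans (Nat.mul_le_mul_left _ hP.le)
  have hchcard : ∀ u, (u = 0 ∨ C.Good u) → hdep B u < D → B ≤ (C.ch u).card := by
    intro u hu hd
    have : (Finset.range B).card ≤ (C.ch u).card := by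
      refine Finset.card_le_card_of_injOn (fun r => B * u + r + 1) ?_ ?_
      · intro r hr
        have hr' : r < B := by simpa using hr
        have hpc := hpr_child B u r hr'
        refine Finset.mem_coe.2 (Finset.mem_filter.2 ⟨C.child_mem ?_ ?_, hpc⟩)
        · refine (hNd _).2 ⟨Nat.succ_pos _, ?_⟩
          rw [hdep_pos B (Nat.succ_pos _), hpc]
          omega
        · show hpr B _ = 0 ∨ C.Good (hpr B _)
          rw [hpc]; exact hu
      · intro r _ r' _ h
        simp only at h
        omega
    simpa using this
  refine C.embed5 (hdep B) D M (fun u => u = 0 ∨ (C.Good u ∧ ¬ C.Exc u)) (Or.inl rfl)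
    (by simp [hdep]) ?_ hM
  intro u hu hd
  have h1 := hchcard u (hu.imp_right fun h => h.1) hd
  have h2 : 5 + (2 * c + 1) * p ≤ (C.gch u).card := by
    have h3 : (C.ch u).card ≤ (p ^ c + 1) * (C.gch u).card + p ^ c + p + 2 ^ (p + p * c) := by
      rcases hu with hu | hu
      · subst hu
        have h4 := C.root_le hF (by
          intro m hm h0 m' hm' hlt
          have e1 := hpr_decomp B m (hNp m hm).1
          have : hpr B m = 0 := h0
          rw [this] at e1
          have h5 := Nat.mod_lt (m - 1) (show 0 < B by omega)
          exact Nat.div_eq_of_lt (by omega))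
        have h5 : 2 ^ (C.P ∪ C.Tch).card ≤ 2 ^ (p + p * c) := Nat.pow_le_pow_right (by norm_num) hPT
        rw [add_mul, one_mul]
        omega
      · have h4 := C.ch_le hF u hu.2
        nlinarith [Nat.zero_le (2 ^ (p + p * c))]
    by_contra hcon
    push Not at hcon
    have : (p ^ c + 1) * (C.gch u).card ≤ (p ^ c + 1) * (5 + (2 * c + 1) * p) :=
      Nat.mul_le_mul_left _ hcon.le
    omega
  refine ⟨C.gch u \ C.ExcS, ?_, ?_⟩
  · have := Finset.le_card_sdiff C.ExcS (C.gch u)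
    omega
  · intro m hm
    rw [Finset.mem_sdiff, C.mem_ExcS] at hm
    obtain ⟨h3, h4, h5⟩ := Finset.mem_filter.1 hm.1
    refine ⟨Or.inr ⟨h5, hm.2⟩, h5, h4, ?_⟩
    have h6 : hpr B m = u := h4
    rw [hdep_pos B (C.A_pos h3), h6]
end
end TC

namespace TC
section
variable {c s t : ℕ}

/-- no collisions between keys with the same light characters -/
def F5 (w : ℕ) (ball : Fin (2 ^ t) → Fin c → Bits s) (T : Om c s t) : Prop :=
  ∀ i i', i ≠ i' → (∀ k, ball i k = ball i' k ∨
      (¬ Light w ball k (ball i k) ∧ ¬ Light w ball k (ball i' k))) →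
    ∀ b, hs T b (ball i) ≠ hs T b (ball i')

def dvec (b : Bool) (δ : Fin c → Option (Bits s × Bits s)) : Vec c s
  | none => 0
  | some (b', k, a) => if b' = b then
      (match δ k with
        | none => 0
        | some q => (if q.1 = a then 1 else 0) + (if q.2 = a then 1 else 0)) else 0

lemma dvec_eq (b : Bool) (y y' : Fin c → Bits s) :
    dvec b (fun k => if y k = y' k then none else some (y k, y' k)) = evec b y + evec b y' := by
  funext j
  rcases j with _ | ⟨b', k, a⟩
  · simp [dvec, evec]
  · rw [Pi.add_apply, evec_some, evec_some]
    by_cases hb : b' = b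
    · by_cases hk : y k = y' k
      · simp only [dvec, hb, hk, if_true, true_and]
        exact (CharTwo.add_self_eq_zero _).symm
      · simp [dvec, hb, hk]
    · simp [dvec, hb]

lemma card_F5 (w : ℕ) (ball : Fin (2 ^ t) → Fin c → Bits s) (hb : Function.Injective ball) :
    (univ.filter (fun T : Om c s t => ¬ F5 w ball T)).card * 2 ^ t ≤
      2 * (2 ^ w * 2 ^ w + 1) ^ c * Fintype.card (Om c s t) := by
  let Hv : Fin c → Finset (Bits s) := fun k => univ.filter (fun a => ¬ Light w ball k a)
  let Δ := Fintype.piFinset (fun k : Fin c => insert none ((Hv k ×ˢ Hv k).image some))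
  let FF : Finset (Vec c s) := (((univ : Finset Bool) ×ˢ Δ).image (fun q => dvec q.1 q.2)).filter (· ≠ 0)
  have hFF : FF.card ≤ 2 * (2 ^ w * 2 ^ w + 1) ^ c := by
    refine (Finset.card_filter_le _ _).trans (Finset.card_image_le.trans ?_)
    rw [Finset.card_product]
    have h1 : Δ.card ≤ (2 ^ w * 2 ^ w + 1) ^ c := by
      rw [Fintype.card_piFinset]
      refine (Finset.prod_le_prod' (g := fun _ => 2 ^ w * 2 ^ w + 1) fun k _ => ?_).trans (by simp)
      refine (Finset.card_insert_le _ _).trans (Nat.add_le_add_right ?_ 1)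
      refine Finset.card_image_le.trans ?_
      rw [Finset.card_product]
      exact Nat.mul_le_mul (card_heavy w ball k) (card_heavy w ball k)
    simpa using h1
  have h1 : (univ.filter (fun T : Om c s t => ¬ F5 w ball T)).card * 2 ^ t ≤
      (FF.biUnion (fun f => univ.filter (fun H : JJ c s → Bits t => ev H f = 0))).card := by
    have hc : 2 ^ t = (univ : Finset (Bits t)).card := by simp
    rw [hc, ← Finset.card_product]
    refine Finset.card_le_card_of_injOn (fun q => mkH q.1 q.2) ?_ mkH_inj.injOn
    rintro ⟨T, ρ⟩ hT
    have hT' : ¬ F5 w ball T := by simpa using hT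
    unfold F5 at hT'
    push Not at hT'
    obtain ⟨i, i', hne, hk, b, heq⟩ := hT'
    refine Finset.mem_coe.2 (Finset.mem_biUnion.2 ⟨evec b (ball i) + evec b (ball i'), ?_, ?_⟩)
    · refine Finset.mem_filter.2 ⟨Finset.mem_image.2
        ⟨(b, fun k => if ball i k = ball i' k then none else some (ball i k, ball i' k)), ?_, dvec_eq _ _ _⟩, ?_⟩
      · refine Finset.mem_product.2 ⟨mem_univ _, Fintype.mem_piFinset.2 fun k => ?_⟩
        simp only
        split_ifs with hkk
        · exact Finset.mem_insert_self _ _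
        · obtain ⟨a1, a2⟩ := (hk k).resolve_left hkk
          refine Finset.mem_insert_of_mem (Finset.mem_image.2 ⟨_, Finset.mem_product.2 ⟨?_, ?_⟩, rfl⟩)
          · exact Finset.mem_filter.2 ⟨mem_univ _, a1⟩
          · exact Finset.mem_filter.2 ⟨mem_univ _, a2⟩
      · intro h0
        apply hne
        apply hb
        apply evec_inj (b := b) (b' := b)
        funext j
        have := congrFun h0 j
        exact CharTwo.add_eq_zero.1 this
    · refine Finset.mem_filter.2 ⟨mem_univ _, ?_⟩
      simp only
      rw [ev_add, ev_evec, ev_evec, heq, bits_add_self]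
  have h2 : ∀ f ∈ FF, (univ.filter (fun H : JJ c s → Bits t => ev H f = 0)).card ≤
      Fintype.card (Om c s t) := by
    intro f hf
    have h3 := linProb (t := t) (fun _ : ℕ => f) {0} (by
      apply li_of_tri
      intro m hm h
      have : {m' | m' ∈ ({0} : Finset ℕ) ∧ m' < m} = (∅ : Set ℕ) := by
        ext m'
        simp only [Finset.mem_singleton] at hm
        subst hm
        simp
      rw [this, Set.image_empty, Submodule.span_empty, Submodule.mem_bot] at h
      exact (Finset.mem_filter.1 hf).2 h)
    simp only [Finset.mem_singleton, forall_eq, Finset.card_singleton, pow_one] at h3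
    rw [card_HH, mul_comm] at h3
    exact Nat.le_of_mul_le_mul_left h3 (by positivity)
  calc _ ≤ _ := h1
    _ ≤ FF.card * Fintype.card (Om c s t) := Finset.card_biUnion_le_card_mul _ _ _ h2
    _ ≤ _ := Nat.mul_le_mul_right _ hFF

namespace Cx
variable (C : Cx c s t)

/-- D0 nodes: implied children of a non-exceptional vertex -/
def D0 (m : ℕ) : Prop := m ∈ C.A ∧ m ∉ C.R ∧ ¬ C.Exc (C.par m)

lemma satStep (hF5 : F5 C.w C.ball C.T) (U : Finset ℕ) (hPU : C.P ∪ C.Tch ⊆ U)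
    {m : ℕ} (hm : C.D0 m) (hns : ¬ ∃ W ⊆ U, kap (C.key m) = ∑ q ∈ W, kap (C.key q)) :
    ∃ N ⊆ C.R, Disjoint U N ∧ N.card ≤ c ∧ Gain C.w C.ball C.x U N := by
  obtain ⟨hmA, hmR, hE⟩ := hm
  obtain ⟨W, hW, hk⟩ := C.kapRel hmA hmR
  have hWU : ¬ W ⊆ U := fun h => hns ⟨W, h, hk⟩
  have hkk : kap (C.ball (C.x m)) = ∑ q ∈ W, kap (C.key q) := hk
  let N := W \ U
  have hNUG : ∀ v ∈ N, C.UG v := by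
    intro v hv
    rw [Finset.mem_sdiff] at hv
    exact C.UG_of (hW hv.1) fun h => hv.2 (hPU h)
  have hNl : ∀ v ∈ N, ∀ k, C.Lt k (C.key v k) → C.key m k = C.key v k := by
    intro v hv k hk'
    exact (C.kapW hW hkk (hNUG v hv) hk').1 (Finset.mem_sdiff.1 hv).1
  have hNe : N.Nonempty := Finset.sdiff_nonempty.2 hWU
  have hNc : N.card ≤ c := by
    have : ∀ v : ℕ, ∃ k : Option (Fin c), v ∈ N → ∃ k', k = some k' ∧ C.Lt k' (C.key v k') := by
      intro v
      by_cases hv : v ∈ N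
      · obtain ⟨k, hk⟩ := (hNUG v hv).1.2.1
        exact ⟨some k, fun _ => ⟨k, rfl, hk⟩⟩
      · exact ⟨none, fun h => absurd h hv⟩
    choose g hg using this
    have : N.card ≤ ((univ : Finset (Fin c)).image some).card := by
      refine Finset.card_le_card_of_injOn g ?_ ?_
      · intro v hv
        obtain ⟨k, h1, -⟩ := hg v hv
        rw [h1]
        exact Finset.mem_coe.2 (Finset.mem_image_of_mem _ (mem_univ _))
      · intro v hv v' hv' heq
        obtain ⟨k, h1, h2⟩ := hg v hv
        obtain ⟨k', h1', h2'⟩ := hg v' hv'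
        have : k = k' := by
          rw [h1, h1'] at heq; exact Option.some.inj heq
        subst this
        by_contra hne
        exact C.good_disj (hNUG v hv).1 (hNUG v' hv').1 hne h2
          ((hNl v' hv' k h2').symm.trans (hNl v hv k h2))
    refine this.trans (Finset.card_image_le.trans (by simp))
  obtain ⟨z, hzUG, hzc, hzl⟩ := C.L1 hmA hmR rfl hE
  refine ⟨N, Finset.sdiff_subset.trans hW, Finset.disjoint_sdiff, hNc, Or.inr (Or.inr ?_)⟩
  obtain ⟨w1, hw1⟩ := hNe
  refine ⟨w1, hw1, W ∩ U, Finset.inter_subset_right, C.x m, ?_, ?_⟩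
  · rw [hkk, ← Finset.sum_inter_add_sum_sdiff W U]
    rfl
  have hup : ∀ v, v ≠ w1 → Function.update C.x w1 (C.x m) v = C.x v := fun v hv =>
    Function.update_of_ne hv _ _
  by_cases h2 : ∃ w2 ∈ N, w2 ≠ w1
  · obtain ⟨w2, hw2, hne⟩ := h2
    obtain ⟨k, hk'⟩ := (hNUG w2 hw2).1.2.1
    refine ⟨w1, hw1, w2, Finset.mem_union_right _ hw2, hne, k, ?_, ?_⟩
    · rw [hup w2 hne]; exact hk'
    · rw [hup w2 hne, Function.update_self]; exact hNl w2 hw2 k hk'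
  push Not at h2
  by_cases h3 : ∃ m' ∈ U, ∃ k, C.Lt k (C.key m' k) ∧ C.key m k = C.key m' k
  · obtain ⟨m', hm', k, hk1, hk2⟩ := h3
    have hne : m' ≠ w1 := fun h => (Finset.mem_sdiff.1 hw1).2 (h ▸ hm')
    refine ⟨w1, hw1, m', Finset.mem_union_left _ hm', hne, k, ?_, ?_⟩
    · rw [hup m' hne]; exact hk1
    · rw [hup m' hne, Function.update_self]; exact hk2
  exfalso
  push Not at h3
  have hzw : z = w1 := by
    obtain ⟨k, hk'⟩ := hzUG.1.2.1
    have hzW : z ∈ W := (C.kapW hW hkk hzUG hk').2 (hzl k hk')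
    have hzU : z ∉ U := fun h => h3 z h k hk' (hzl k hk')
    exact h2 z (Finset.mem_sdiff.2 ⟨hzW, hzU⟩)
  have hsame : ∀ k, C.ball (C.x z) k = C.ball (C.x m) k ∨
      (¬ Light C.w C.ball k (C.ball (C.x z) k) ∧ ¬ Light C.w C.ball k (C.ball (C.x m) k)) := by
    intro k
    by_cases hl1 : Light C.w C.ball k (C.ball (C.x z) k)
    · exact Or.inl (hzl k hl1).symm
    by_cases hl2 : Light C.w C.ball k (C.ball (C.x m) k)
    · left
      have h4 := congrFun hkk (k, C.ball (C.x m) k)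
      rw [Finset.sum_apply] at h4
      have h5 : ∃ q ∈ W, C.key q k = C.ball (C.x m) k := by
        by_contra hcon
        push Not at hcon
        rw [Finset.sum_eq_zero (fun q hq => by simp [kap, hcon q hq])] at h4
        simp [kap] at h4
      obtain ⟨q, hq, hqk⟩ := h5
      by_cases hqU : q ∈ U
      · exfalso
        refine h3 q hqU k ?_ hqk.symm
        rw [hqk]; exact hl2
      · have := h2 q (Finset.mem_sdiff.2 ⟨hq, hqU⟩)
        rw [hzw, ← this]
        exact hqk
    · exact Or.inr ⟨hl1, hl2⟩
  have hVm := C.hR m (C.A_sub hmA)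
  rcases hzc with ⟨h4, h5, h6⟩ | ⟨h4, h5, h6⟩
  · refine hF5 (C.x z) (C.x m) ?_ hsame (C.l m) ?_
    · intro hxx
      have := C.x_inj_ch (C.par m) (Finset.mem_coe.2 (Finset.mem_filter.2 ⟨h5, h4⟩))
        (Finset.mem_coe.2 (Finset.mem_filter.2 ⟨hmA, rfl⟩)) hxx
      exact hmR (this ▸ C.good_R hzUG.1)
    · rw [hVm, ← h6, C.hR z (C.A_sub h5), h4]
  · refine hF5 (C.x z) (C.x m) ?_ hsame (C.l m) ?_
    · have := C.hdec m (C.A_sub hmA) h5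
      rw [h4]; exact this.ne'
    · rw [hVm, h6, h4, VV, if_neg h5]

lemma sat (hF5 : F5 C.w C.ball C.T) (hP : C.P.card < C.p)
    (he : (C.p + C.p * c + C.p * c) * C.D ≤ C.e) :
    ∃ U, U.card ≤ C.p + C.p * c + C.p * c ∧
      ∀ m, C.D0 m → ∃ W ⊆ U, kap (C.key m) = ∑ q ∈ W, kap (C.key q) := by
  by_contra hcon
  push Not at hcon
  have hPT : (C.P ∪ C.Tch).card ≤ C.p + C.p * c := by
    have h1 := Finset.card_union_le C.P C.Tch
    have h2 := C.Tch_card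
    have h3 : C.P.card * c ≤ C.p * c := Nat.mul_le_mul_right _ hP.le
    omega
  have main : ∀ q ≤ C.p, ∃ U ⊆ C.R, C.P ∪ C.Tch ⊆ U ∧ U.card ≤ C.p + C.p * c + q * c ∧
      Chain C.w C.ball C.x q U := by
    intro q
    induction q with
    | zero =>
      intro _
      exact ⟨C.P ∪ C.Tch, Finset.union_subset C.P_sub (Finset.filter_subset _ _), subset_rfl,
        by omega, trivial⟩
    | succ q ih =>
      intro hq
      obtain ⟨U, hUR, hPU, hUc, hch⟩ := ih (by omega)
      have hqc : q * c + c ≤ C.p * c := by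
        have := Nat.mul_le_mul_right c hq
        rwa [Nat.succ_mul] at this
      obtain ⟨m, hm, hns⟩ := hcon U (by omega)
      obtain ⟨N, hN, hd, hNc, hg⟩ := C.satStep hF5 U hPU hm (by push Not; exact hns)
      refine ⟨U ∪ N, Finset.union_subset hUR hN, hPU.trans Finset.subset_union_left, ?_,
        hch.step hd hg⟩
      have := Finset.card_union_le U N
      rw [Nat.succ_mul]
      omega
  obtain ⟨U, hUR, -, hUc, hch⟩ := main C.p le_rfl
  exact C.noChain U hUR ((Nat.mul_le_mul_right _ hUc).trans he) hch

/-- vertices with an implied child, non-exceptional -/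
noncomputable def BV : Finset ℕ := C.R.filter (fun u => ∃ m, C.D0 m ∧ C.par m = u)

lemma BV_card (hF5 : F5 C.w C.ball C.T) (hP : C.P.card < C.p)
    (he : (C.p + C.p * c + C.p * c) * C.D ≤ C.e) :
    C.BV.card ≤ 2 ^ (C.p + C.p * c + C.p * c) * (2 * c) := by
  obtain ⟨U, hUc, hU⟩ := C.sat hF5 hP he
  have : ∀ u : ℕ, ∃ m, u ∈ C.BV → C.D0 m ∧ C.par m = u := by
    intro u
    by_cases hu : u ∈ C.BV
    · obtain ⟨m, hm⟩ := (Finset.mem_filter.1 hu).2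
      exact ⟨m, fun _ => hm⟩
    · exact ⟨0, fun h => absurd h hu⟩
  choose g hg using this
  let Y := C.BV.image (fun u => C.key (g u))
  have hY : Y.card ≤ 2 ^ (C.p + C.p * c + C.p * c) := by
    refine le_trans ?_ (Nat.pow_le_pow_right (by norm_num) hUc)
    rw [← Finset.card_powerset]
    have : Y.card ≤ (U.powerset.image (fun W => ∑ q ∈ W, kap (C.key q))).card := by
      refine Finset.card_le_card_of_injOn kap ?_ kap_inj.injOn
      intro y hy
      obtain ⟨u, hu, rfl⟩ := Finset.mem_image.1 hy
      obtain ⟨W, hW, h⟩ := hU _ (hg u hu).1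
      exact Finset.mem_coe.2 (Finset.mem_image.2 ⟨W, Finset.mem_powerset.2 hW, h.symm⟩)
    exact this.trans Finset.card_image_le
  have hfib : ∀ y ∈ Y, (C.BV.filter (fun u => C.key (g u) = y)).card ≤ 2 * c := by
    intro y hy
    let Zk : Fin c → Finset ℕ := fun k => C.R.filter (fun z => C.Good z ∧ C.Lt k (C.key z k) ∧
      C.key z k = y k)
    have hZk : ∀ k, (Zk k).card ≤ 1 := by
      intro k
      rw [Finset.card_le_one]
      intro z hz z' hz'
      obtain ⟨-, h1, h2, h3⟩ := Finset.mem_filter.1 hz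
      obtain ⟨-, h1', h2', h3'⟩ := Finset.mem_filter.1 hz'
      by_contra hne
      exact C.good_disj h1 h1' hne h2 (h3'.trans h3.symm)
    have hsub : C.BV.filter (fun u => C.key (g u) = y) ⊆
        (univ : Finset (Fin c)).biUnion (fun k => Zk k ∪ (Zk k).image C.par) := by
      intro u hu
      obtain ⟨hu1, hu2⟩ := Finset.mem_filter.1 hu
      obtain ⟨⟨h1, h2, h3⟩, h4⟩ := hg u hu1
      rw [h4] at h3
      obtain ⟨z, hz, hc, hl⟩ := C.L1 h1 h2 h4 h3
      obtain ⟨k, hk⟩ := hz.1.2.1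
      have hzk : z ∈ Zk k := Finset.mem_filter.2 ⟨C.good_R hz.1, hz.1, hk, by
        rw [← hu2]; exact (hl k hk).symm⟩
      refine Finset.mem_biUnion.2 ⟨k, mem_univ _, ?_⟩
      rcases hc with h | h
      · exact Finset.mem_union_right _ (Finset.mem_image.2 ⟨z, hzk, h.1⟩)
      · exact Finset.mem_union_left _ (h.1 ▸ hzk)
    refine (Finset.card_le_card hsub).trans ((Finset.card_biUnion_le_card_mul _ _ 2 ?_).trans ?_)
    · intro k _
      refine (Finset.card_union_le _ _).trans ?_
      have := hZk k
      have := Finset.card_image_le (s := Zk k) (f := C.par)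
      omega
    · simp [mul_comm]
  have := Finset.card_le_mul_card_image C.BV (2 * c) hfib
  calc C.BV.card ≤ 2 * c * Y.card := this
    _ ≤ _ := by rw [mul_comm]; exact Nat.mul_le_mul_right _ hY

/-- below a vertex which is good and not bad all children are good -/
lemma good_child {u m : ℕ} (hu : C.Good u) (hE : u ∉ C.ExcS) (hB : u ∉ C.BV)
    (hm : m ∈ C.Nd) (hp : C.par m = u) : C.Good m := by
  have hmA : m ∈ C.A := C.child_mem hm (Or.inr (hp ▸ hu))
  rw [C.mem_ExcS] at hE
  have hmR : m ∈ C.R := by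
    by_contra hR
    exact hB (Finset.mem_filter.2 ⟨C.good_R hu, m, ⟨hmA, hR, hp ▸ hE⟩, hp⟩)
  exact (C.UG_of hmR fun h => hE (Or.inr ⟨m, h, hp⟩)).1
end Cx
end
end TC

namespace TC
section
variable {c s t : ℕ}

/-- clear the top bit -/
def clr (v : ℕ) : ℕ := v - 2 ^ Nat.log 2 v

lemma clr_zero : clr 0 = 0 := by simp [clr]

lemma clr_add {v : ℕ} (hv : v ≠ 0) : v = 2 ^ Nat.log 2 v + clr v := by
  have := Nat.pow_log_le_self 2 hv
  unfold clr; omega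

lemma clr_lt_pow {v : ℕ} (hv : v ≠ 0) : clr v < 2 ^ Nat.log 2 v := by
  have := Nat.lt_pow_succ_log_self (b := 2) (by norm_num) v
  rw [pow_succ] at this
  have := clr_add hv
  omega

lemma clr_lt {v : ℕ} (hv : v ≠ 0) : clr v < v := by
  have := clr_add hv
  have : 0 < 2 ^ Nat.log 2 v := by positivity
  omega

lemma clr_le (v : ℕ) : clr v ≤ v := Nat.sub_le _ _

lemma log_clr {v : ℕ} (h : clr v ≠ 0) : Nat.log 2 (clr v) < Nat.log 2 v := by
  have hv : v ≠ 0 := fun h0 => h (by rw [h0, clr_zero])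
  have h1 := clr_lt_pow hv
  exact Nat.log_lt_of_lt_pow h h1

lemma log_of {v i : ℕ} (h : v < 2 ^ i) : Nat.log 2 (2 ^ i + v) = i := by
  rw [Nat.log_eq_iff]
  · constructor
    · omega
    · rw [pow_succ]; omega
  · right
    exact ⟨by norm_num, by have : 0 < 2 ^ i := by positivity
                           omega⟩

lemma clr_of {v i : ℕ} (h : v < 2 ^ i) : clr (2 ^ i + v) = v := by
  unfold clr; rw [log_of h]; omega

/-- parent in the forest of binomial trees -/
def bpr (B m : ℕ) : ℕ := if (m - 1) / B = 0 then 0 else B * clr ((m - 1) / B) + (m - 1) % B + 1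

lemma nd_div (B v r : ℕ) (hr : r < B) : (B * v + r + 1 - 1) / B = v := by
  rw [Nat.add_sub_cancel, Nat.mul_add_div (by omega), Nat.div_eq_of_lt hr, add_zero]

lemma nd_mod (B v r : ℕ) (hr : r < B) : (B * v + r + 1 - 1) % B = r := by
  rw [Nat.add_sub_cancel, Nat.mul_add_mod, Nat.mod_eq_of_lt hr]

lemma bpr_iter (B : ℕ) (hB : 0 < B) (k : ℕ) : ∀ m, (m - 1) / B < 2 ^ k → (bpr B)^[k + 1] m = 0 := by
  have h0 : ∀ j, (bpr B)^[j] 0 = 0 := by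
    intro j
    induction j with
    | zero => rfl
    | succ j ih => rw [Function.iterate_succ_apply]; simpa [bpr] using ih
  induction k with
  | zero =>
    intro m hm
    have : (m - 1) / B = 0 := by simpa using hm
    simp [bpr, this]
  | succ k ih =>
    intro m hm
    rw [Function.iterate_succ_apply]
    by_cases hv : (m - 1) / B = 0
    · rw [bpr, if_pos hv]; exact h0 _
    · apply ih
      rw [bpr, if_neg hv, nd_div _ _ _ (Nat.mod_lt _ hB)]
      refine (clr_lt_pow hv).trans_le (Nat.pow_le_pow_right (by norm_num) ?_)
      have := Nat.log_lt_of_lt_pow hv hm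
      omega

/-- deterministic part of the expectation bound -/
lemma ex_det (ball : Fin (2 ^ t) → Fin c → Bits s) (hb : Function.Injective ball)
    (rule : Fin (2 ^ t) → (Bits t → ℕ) → Bool) (T : Om c s t) (B j p e w E1 : ℕ)
    (hE1 : E1 = (2 * c + 1) * p + 2 ^ (p + p * c + p * c) * (2 * c))
    (hB1 : (p ^ c + 1) * (E1 + 1) + p ^ c + p + 2 ^ (p + p * c) + p + 2 ≤ B)
    (he1 : 2 * p * (j + 6) ≤ e) (he2 : p + 1 ≤ e) (he3 : (p + p * c + p * c) * (j + 6) ≤ e)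
    (hbad : ¬ Bad (bpr B) w ball p e (B * 2 ^ (j + 5) + 1) T) (hF5 : F5 w ball T)
    (ρ : Bits t) (hρ : j + 5 + B ≤ LL ball rule T (2 ^ t) ρ) :
    Final clr ball ((Finset.range (2 ^ (j + 5))).filter (fun v => v ≠ 0 ∧ clr v < 2 ^ j)) T := by
  have hpp : 0 < 2 ^ (p + p * c) := by positivity
  have hB0 : p + 2 ≤ B := by omega
  have hBpos : 0 < B := by omega
  set N := B * 2 ^ (j + 5) + 1 with hN
  let V : ℕ → ℕ := fun m => (m - 1) / B
  let r : ℕ → ℕ := fun m => (m - 1) % B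
  have hr : ∀ m, r m < B := fun m => Nat.mod_lt _ hBpos
  have hdec : ∀ m, 0 < m → m = B * V m + r m + 1 := by
    intro m hm
    have := Nat.div_add_mod (m - 1) B
    simp only [V, r]; omega
  let Nd := (Finset.range N).filter (fun m => 0 < m ∧ V m < 2 ^ (j + 5) ∧ clr (V m) < 2 ^ j)
  have hNd : ∀ m, m ∈ Nd ↔ 0 < m ∧ V m < 2 ^ (j + 5) ∧ clr (V m) < 2 ^ j := by
    intro m
    simp only [Nd, Finset.mem_filter, Finset.mem_range, and_iff_right_iff_imp]
    rintro ⟨h1, h2, h3⟩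
    have h4 := hdec m h1
    have h5 := hr m
    have h6 : B * (V m + 1) ≤ B * 2 ^ (j + 5) := Nat.mul_le_mul_left _ h2
    rw [mul_add, mul_one] at h6
    omega
  have hp0 : ∀ m, bpr B m = 0 ↔ V m = 0 := by
    intro m
    simp only [bpr, V]
    split_ifs with h <;> simp [h]
  have hp1 : ∀ m, V m ≠ 0 → bpr B m = B * clr (V m) + r m + 1 := by
    intro m h
    simp only [bpr]; rw [if_neg h]
  have hpV : ∀ m, V m ≠ 0 → V (bpr B m) = clr (V m) ∧ r (bpr B m) = r m := by
    intro m h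
    rw [hp1 m h]
    exact ⟨nd_div _ _ _ (hr m), nd_mod _ _ _ (hr m)⟩
  have hj5 : (2:ℕ) ^ j ≤ 2 ^ (j + 5) := Nat.pow_le_pow_right (by norm_num) (by omega)
  have hNp : ∀ m ∈ Nd, 0 < m ∧ bpr B m < m ∧ (bpr B m = 0 ∨ bpr B m ∈ Nd) := by
    intro m hm
    rw [hNd] at hm
    obtain ⟨h1, h2, h3⟩ := hm
    by_cases h0 : V m = 0
    · have := (hp0 m).2 h0
      rw [this]; exact ⟨h1, h1, Or.inl rfl⟩
    · refine ⟨h1, ?_, Or.inr ?_⟩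
      · have h4 := hdec m h1
        rw [hp1 m h0]
        have h5 : B * (clr (V m) + 1) ≤ B * V m := Nat.mul_le_mul_left _ (clr_lt h0)
        rw [mul_add, mul_one] at h5
        omega
      · rw [hNd, (hpV m h0).1]
        refine ⟨by rw [hp1 m h0]; exact Nat.succ_pos _, by omega, ?_⟩
        exact (clr_le _).trans_lt h3
  have hlog : ∀ v, v ≠ 0 → v < 2 ^ (j + 5) → Nat.log 2 v < j + 5 := fun v h0 h => Nat.log_lt_of_lt_pow h0 h
  let ht : ℕ → ℕ := fun m => if m = 0 then j + 5 + B else if V m = 0 then j + 5 else j + 4 - Nat.log 2 (V m)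
  let lev : ℕ → ℕ := fun m => if V m = 0 then j + 5 + B - 1 - r m else j + 4 - Nat.log 2 (V m)
  have H0 : ∀ m ∈ Nd, 0 < m ∧ bpr B m < m ∧ (bpr B m = 0 ∨ bpr B m ∈ Nd) ∧ lev m < ht (bpr B m) ∧
      ht m ≤ lev m := by
    intro m hm
    obtain ⟨h1, h2, h3⟩ := hNp m hm
    obtain ⟨g1, g2, g3⟩ := (hNd m).1 hm
    have hrm := hr m
    refine ⟨h1, h2, h3, ?_, ?_⟩
    · by_cases h0 : V m = 0
      · simp only [lev, ht, h0, (hp0 m).2 h0, if_true]; omega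
      · have h4 : bpr B m ≠ 0 := fun h => h0 ((hp0 m).1 h)
        have h5 := hlog _ h0 g2
        simp only [lev, ht, h0, h4, if_false, (hpV m h0).1]
        split_ifs with h6
        · omega
        · have := log_clr h6; omega
    · have h4 : m ≠ 0 := by omega
      simp only [lev, ht, h4, if_false]
      split_ifs
      · omega
      · omega
  have H1 : ∀ m ∈ Nd, ∀ m' ∈ Nd, bpr B m = bpr B m' → m < m' → lev m' < lev m := by
    intro m hm m' hm' hpp hlt
    obtain ⟨g1, g2, g3⟩ := (hNd m).1 hm
    obtain ⟨g1', g2', g3'⟩ := (hNd m').1 hm'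
    have e1 := hdec m g1
    have e2 := hdec m' g1'
    have r1 := hr m
    have r2 := hr m'
    by_cases h0 : V m = 0
    · have h0' : V m' = 0 := (hp0 m').1 (hpp ▸ (hp0 m).2 h0)
      simp only [lev, h0, h0', if_true]
      rw [h0] at e1; rw [h0'] at e2
      omega
    · have h0' : V m' ≠ 0 := fun h => h0 ((hp0 m).1 (hpp.trans ((hp0 m').2 h)))
      have hc : clr (V m) = clr (V m') := by
        rw [← (hpV m h0).1, ← (hpV m' h0').1, hpp]
      have hrr : r m = r m' := by
        rw [← (hpV m h0).2, ← (hpV m' h0').2, hpp]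
      simp only [lev, h0, h0', if_false]
      have hVV : V m < V m' := by
        by_contra hcon
        push Not at hcon
        have := Nat.mul_le_mul_left B hcon
        omega
      have k1 := clr_add h0
      have k2 := clr_add h0'
      have hpw : 2 ^ Nat.log 2 (V m) < 2 ^ Nat.log 2 (V m') := by omega
      have hll := (Nat.pow_lt_pow_iff_right (a := 2) (by norm_num)).1 hpw
      have := hlog _ h0' g2'
      omega
  obtain ⟨x, l, hR, hdc, hsib⟩ := realize ball rule T (bpr B) ht lev Nd H0 H1 ρ
    (by simpa [ht] using hρ)
  obtain ⟨A, hA⟩ := exists_active (bpr B) w ball x Nd (fun m hm => (hNp m hm).2.1)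
  let C : Cx c s t :=
    { par := bpr B, w := w, ball := ball, hb := hb, T := T, ρ := ρ, x := x, l := l, Nd := Nd,
      hpar := hNp, hR := hR, hdec := hdc, hsib := hsib, p := p, e := e, N := N, D := j + 6,
      hNd := Finset.filter_subset _ _,
      hD := fun m hm => bpr_iter B hBpos (j + 5) m ((hNd m).1 hm).2.1,
      hBad := hbad, A := A, hA := hA }
  have hF : F1 C.w C.ball C.T (p ^ c) := by
    refine F1_of (bpr B) w ball hb T p e N hbad ?_ he2 ?_
    · intro m hm
      rw [Finset.mem_Icc] at hm
      exact (hp0 m).2 (Nat.div_eq_of_lt (by omega))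
    · have : B * 1 ≤ B * 2 ^ (j + 5) := Nat.mul_le_mul_left _ Nat.one_le_two_pow
      omega
  have hP : C.P.card < p := C.P_card he1
  have hPT : (C.P ∪ C.Tch).card ≤ p + p * c := by
    have h1 := Finset.card_union_le C.P C.Tch
    have h2 := C.Tch_card
    have h3 : C.P.card * c ≤ p * c := Nat.mul_le_mul_right _ hP.le
    omega
  have hX : C.ExcS.card ≤ (2 * c + 1) * p := C.ExcS_card.trans (Nat.mul_le_mul_left _ hP.le)
  have hBV : C.BV.card ≤ 2 ^ (p + p * c + p * c) * (2 * c) := C.BV_card hF5 hP he3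
  have hch : B ≤ (C.ch 0).card := by
    have : (Finset.range B).card ≤ (C.ch 0).card := by
      refine Finset.card_le_card_of_injOn (fun r => r + 1) ?_ ?_
      · intro a ha
        have ha' : a < B := by simpa using ha
        have hV0 : V (a + 1) = 0 := by simp only [V]; exact Nat.div_eq_of_lt (by omega)
        have hpz : C.par (a + 1) = 0 := (hp0 _).2 hV0
        refine Finset.mem_coe.2 (Finset.mem_filter.2 ⟨C.child_mem ?_ (Or.inl hpz), hpz⟩)
        refine (hNd _).2 ⟨Nat.succ_pos _, ?_, ?_⟩
        · rw [hV0]; positivity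
        · rw [hV0, clr_zero]; positivity
      · intro a _ a' _ h
        simpa using h
    simpa using this
  have hg : E1 + 1 ≤ (C.gch 0).card := by
    have h4 := C.root_le hF (by
      intro m hm h0 m' hm' hlt
      have h1 := hdec m (hNp m hm).1
      have h2 : V m = 0 := (hp0 m).1 h0
      rw [h2] at h1
      have h3 := hr m
      exact (hp0 m').2 (Nat.div_eq_of_lt (by omega)))
    have h5 : 2 ^ (C.P ∪ C.Tch).card ≤ 2 ^ (p + p * c) := Nat.pow_le_pow_right (by norm_num) hPT
    by_contra hcon
    push Not at hcon
    have : (p ^ c + 1) * (C.gch 0).card ≤ (p ^ c + 1) * (E1 + 1) :=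
      Nat.mul_le_mul_left _ hcon.le
    rw [add_mul, one_mul] at this
    omega
  have hex : ∃ r1 ∈ (C.gch 0).image r, r1 ∉ (C.ExcS ∪ C.BV).image r := by
    by_contra hcon
    push Not at hcon
    have h1 : ((C.gch 0).image r).card ≤ ((C.ExcS ∪ C.BV).image r).card :=
      Finset.card_le_card hcon
    have h2 : ((C.gch 0).image r).card = (C.gch 0).card := by
      refine Finset.card_image_of_injOn ?_
      intro m hm m' hm' h
      obtain ⟨a1, a2, -⟩ := Finset.mem_filter.1 hm
      obtain ⟨b1, b2, -⟩ := Finset.mem_filter.1 hm'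
      have e1 := hdec m (C.A_pos a1)
      have e2 := hdec m' (C.A_pos b1)
      rw [(hp0 m).1 a2, h] at e1
      rw [(hp0 m').1 b2] at e2
      omega
    have h3 := Finset.card_image_le (s := C.ExcS ∪ C.BV) (f := r)
    have h4 := Finset.card_union_le C.ExcS C.BV
    omega
  obtain ⟨r1, hr1, hr2⟩ := hex
  obtain ⟨m1, hm1, hmr⟩ := Finset.mem_image.1 hr1
  obtain ⟨a1, a2, a3⟩ := Finset.mem_filter.1 hm1
  have hr1B : r1 < B := hmr ▸ hr m1
  have hm1eq : m1 = B * 0 + r1 + 1 := by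
    have e1 := hdec m1 (C.A_pos a1)
    rw [(hp0 m1).1 a2, hmr] at e1
    exact e1
  let f : ℕ → ℕ := fun v => B * v + r1 + 1
  have hfV : ∀ v, V (f v) = v := fun v => nd_div _ _ _ hr1B
  have hfr : ∀ v, r (f v) = r1 := fun v => nd_mod _ _ _ hr1B
  have hfp : ∀ v, v ≠ 0 → C.par (f v) = f (clr v) := by
    intro v hv
    have := hp1 (f v) (by rwa [hfV])
    rw [hfV, hfr] at this
    exact this
  have hgood : ∀ v, v < 2 ^ (j + 5) → clr v < 2 ^ j → C.Good (f v) := by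
    intro v
    induction v using Nat.strong_induction_on with
    | _ v ih =>
      intro hv1 hv2
      by_cases hv : v = 0
      · subst hv
        have : f 0 = m1 := hm1eq.symm
        rw [this]; exact a3
      · have hpg := ih (clr v) (clr_lt hv) (by omega) ((clr_le _).trans_lt hv2)
        have hni : f (clr v) ∉ C.ExcS ∪ C.BV := by
          intro h
          exact hr2 (Finset.mem_image.2 ⟨_, h, hfr _⟩)
        rw [Finset.mem_union, not_or] at hni
        refine C.good_child hpg hni.1 hni.2 ?_ (hfp v hv)
        refine (hNd _).2 ⟨Nat.succ_pos _, ?_, ?_⟩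
        · rw [hfV]; exact hv1
        · rw [hfV]; exact hv2
  have hfm : ∀ v v', v < v' → f v < f v' := by
    intro v v' h
    have := Nat.mul_lt_mul_of_pos_left h hBpos
    simp only [f]; omega
  refine C.embed_final clr f _ ?_ ?_ ?_ ?_ ?_
  · intro v hv
    rw [Finset.mem_filter, Finset.mem_range] at hv
    by_cases h0 : clr v = 0
    · exact Or.inl h0
    · right
      rw [Finset.mem_filter, Finset.mem_range]
      exact ⟨by omega, h0, (clr_le _).trans_lt hv.2.2⟩
  · intro v hv
    exact (Finset.mem_filter.1 hv).2.1
  · intro v hv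
    rw [Finset.mem_filter, Finset.mem_range] at hv
    exact ⟨hgood v hv.1 hv.2.2, hfp v hv.2.1⟩
  · intro v _ v' _ h
    rcases lt_trichotomy v v' with h' | h' | h'
    · have := hfm _ _ h'; omega
    · exact h'
    · have := hfm _ _ h'; omega
  · intro v _ v' _ _ h
    exact hfm _ _ h

/-- probability of the final configuration in the expectation part -/
lemma card_FinalE (ball : Fin (2 ^ t) → Fin c → Bits s) (j : ℕ) :
    (univ.filter (fun T : Om c s t => Final clr ball
      ((Finset.range (2 ^ (j + 5))).filter (fun v => v ≠ 0 ∧ clr v < 2 ^ j)) T)).card * 2 ^ (2 ^ j)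
      ≤ 2 ^ t * Fintype.card (Om c s t) := by
  have hj5 : (2:ℕ) ^ j ≤ 2 ^ (j + 5) := Nat.pow_le_pow_right (by norm_num) (by omega)
  have := card_Final clr ball (Finset.range (2 ^ j))
    ((Finset.range (2 ^ (j + 5))).filter (fun v => v ≠ 0 ∧ clr v < 2 ^ j)) ?_ ?_ ?_
  · simpa using this
  · intro v hv
    rw [Finset.mem_filter, Finset.mem_range] at hv
    by_cases h0 : clr v = 0
    · exact Or.inl h0
    · right
      rw [Finset.mem_filter, Finset.mem_range]
      exact ⟨⟨by omega, h0, (clr_le _).trans_lt hv.2.2⟩, clr_lt hv.2.1⟩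
  · intro v hv
    rw [Finset.mem_filter] at hv
    exact Finset.mem_range.2 hv.2.2
  · intro v hv
    rw [Finset.mem_range] at hv
    have : (Finset.range 5).card ≤ (((Finset.range (2 ^ (j + 5))).filter
        (fun v => v ≠ 0 ∧ clr v < 2 ^ j)).filter (fun m => clr m = v)).card := by
      refine Finset.card_le_card_of_injOn (fun i => 2 ^ (j + i) + v) ?_ ?_
      · intro i hi
        have hi' : i < 5 := by simpa using hi
        have h1 : (2:ℕ) ^ j ≤ 2 ^ (j + i) := Nat.pow_le_pow_right (by norm_num) (by omega)
        have h2 : (2:ℕ) ^ (j + i + 1) ≤ 2 ^ (j + 5) := Nat.pow_le_pow_right (by norm_num) (by omega)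
        rw [pow_succ] at h2
        have h3 := clr_of (show v < 2 ^ (j + i) by omega)
        refine Finset.mem_coe.2 (Finset.mem_filter.2 ⟨Finset.mem_filter.2 ⟨Finset.mem_range.2 ?_, ?_, ?_⟩, h3⟩)
        · show 2 ^ (j + i) + v < 2 ^ (j + 5)
          omega
        · have : 0 < 2 ^ (j + i) := by positivity
          show 2 ^ (j + i) + v ≠ 0
          omega
        · rw [h3]; exact hv
      · intro i _ i' _ h
        simp only [Nat.add_right_cancel_iff] at h
        have := Nat.pow_right_injective (le_refl 2) h
        omega
    simpa using this

/-- probability of the final configuration in the high probability part -/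
lemma card_FinalH (ball : Fin (2 ^ t) → Fin c → Bits s) (M : ℕ) :
    (univ.filter (fun T : Om c s t => Final (hpr 5) ball (Finset.Icc 1 (5 * M)) T)).card * 2 ^ M
      ≤ 2 ^ t * Fintype.card (Om c s t) := by
  have := card_Final (hpr 5) ball (Finset.range M) (Finset.Icc 1 (5 * M)) ?_ ?_ ?_
  · simpa using this
  · intro m hm
    rw [Finset.mem_Icc] at hm ⊢
    unfold hpr
    omega
  · intro m hm
    rw [Finset.mem_Icc] at hm
    rw [Finset.mem_range]
    unfold hpr; omega
  · intro v hv
    rw [Finset.mem_range] at hv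
    have : (Finset.range 5).card ≤ ((Finset.Icc 1 (5 * M)).filter (fun m => hpr 5 m = v)).card := by
      refine Finset.card_le_card_of_injOn (fun i => 5 * v + i + 1) ?_ ?_
      · intro i hi
        have hi' : i < 5 := by simpa using hi
        refine Finset.mem_coe.2 (Finset.mem_filter.2 ⟨Finset.mem_Icc.2 ?_, hpr_child 5 v i hi'⟩)
        show 1 ≤ 5 * v + i + 1 ∧ 5 * v + i + 1 ≤ 5 * M
        omega
      · intro i _ i' _ h
        simp only at h
        omega
    simpa using this
end
end TC



namespace TC
section
variable {c s t : ℕ}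

lemma sq_le_two_pow (n : ℕ) : n ^ 2 ≤ 4 * 2 ^ n := by
  induction n using Nat.strong_induction_on with
  | _ n ih =>
    rcases Nat.lt_or_ge n 3 with h | h
    · interval_cases n <;> norm_num
    · obtain ⟨m, rfl⟩ : ∃ m, n = m + 1 := ⟨n - 1, by omega⟩
      have := ih m (by omega)
      rw [pow_succ 2]
      rcases Nat.lt_or_ge m 3 with h' | h'
      · interval_cases m <;> norm_num at *
      · nlinarith

lemma cube_le_two_pow (n : ℕ) : n ^ 3 ≤ 100 * 2 ^ n := by
  induction n using Nat.strong_induction_on with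
  | _ n ih =>
    rcases Nat.lt_or_ge n 5 with h | h
    · interval_cases n <;> norm_num
    · obtain ⟨m, rfl⟩ : ∃ m, n = m + 1 := ⟨n - 1, by omega⟩
      have := ih m (by omega)
      rw [pow_succ 2]
      have h4 : 4 ≤ m := by omega
      nlinarith [mul_le_mul h4 h4 (by norm_num) (by omega)]

/-- polylogarithmic factors are eventually small -/
lemma log_small (a : ℕ) : ∃ t0 : ℕ, ∀ t, t0 ≤ t → a * (Nat.log 2 t + 1) ^ 2 ≤ t := by
  refine ⟨2 ^ (a * 200), fun t ht => ?_⟩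
  have hl : a * 200 ≤ Nat.log 2 t := by
    have := Nat.log_mono_right (b := 2) ht
    rwa [Nat.log_pow (by norm_num)] at this
  set l := Nat.log 2 t with hlD
  have ht0 : t ≠ 0 := by
    have : 0 < 2 ^ (a * 200) := by positivity
    omega
  have h1 : 2 ^ l ≤ t := Nat.pow_log_le_self 2 ht0
  have h2 := cube_le_two_pow (l + 1)
  rw [pow_succ 2] at h2
  have h3 : 200 * (a * (l + 1) ^ 2) ≤ 200 * 2 ^ l := by
    calc 200 * (a * (l + 1) ^ 2) = (a * 200) * (l + 1) ^ 2 := by ring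
      _ ≤ (l + 1) * (l + 1) ^ 2 := Nat.mul_le_mul_right _ (by omega)
      _ = (l + 1) ^ 3 := by ring
      _ ≤ _ := by omega
  omega

lemma g0_le (c e : ℕ) : g0 c e ≤ 2 ^ (4 * e + c + 2) := by
  unfold g0
  have h1 : e ≤ 2 ^ e := Nat.lt_two_pow_self.le
  have h2 : c ≤ 2 ^ c := Nat.lt_two_pow_self.le
  have hc1 : 1 ≤ 2 ^ c := Nat.one_le_two_pow
  have he1 : 1 ≤ 2 ^ e := Nat.one_le_two_pow
  have : 2 ^ (4 * e + c + 2) = 4 * ((2 ^ e) ^ 4 * 2 ^ c) := by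
    rw [mul_comm 4 e, pow_add, pow_add, pow_mul]; ring
  rw [this]
  generalize 2 ^ e = x at *
  generalize 2 ^ c = y at *
  have a1 : e ≤ x ^ 4 * y := by
    calc e ≤ x := h1
      _ = x * 1 * 1 := by ring
      _ ≤ x * x ^ 3 * y := by gcongr; exact Nat.one_le_pow _ _ he1
      _ = _ := by ring
  have a2 : e * e * c ≤ x ^ 4 * y := by
    calc e * e * c ≤ x * x * y := by gcongr
      _ = x * x * 1 * y := by ring
      _ ≤ x * x * x ^ 2 * y := by gcongr; exact Nat.one_le_pow _ _ he1
      _ = _ := by ring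
  have a3 : e * x * (e * e * c) ≤ x ^ 4 * y * 1 := by
    calc e * x * (e * e * c) ≤ x * x * (x * x * y) := by gcongr
      _ = _ := by ring
  omega

/-- bad configurations have polynomially small probability -/
lemma bad_small (c k a1 a2 : ℕ) (hc : 1 ≤ c) : ∃ t0 : ℕ, ∀ t, t0 ≤ t → ∀ (s : ℕ) (par : ℕ → ℕ)
    (ball : Fin (2 ^ t) → Fin c → Bits s), Function.Injective ball → ∀ N : ℕ,
    N + 1 ≤ 2 ^ (a1 * (Nat.log 2 t + 1)) →
    (univ.filter (fun T : Om c s t => Bad par (t / (4 * c)) ball (4 * c * (k + 3))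
      (a2 * (Nat.log 2 t + 1)) N T)).card * 2 ^ (k * t) ≤ Fintype.card (Om c s t) := by
  obtain ⟨t1, ht1⟩ := log_small
    (a1 * a2 + a2 + (a2 + (4 * a2 + c + 2)) * (4 * c * (k + 3)))
  refine ⟨t1 + 4 * c * (k + 3), fun t ht s par ball hb N hN => ?_⟩
  have hsm := ht1 t (by omega)
  set l := Nat.log 2 t + 1 with hl
  have hl1 : 1 ≤ l := by omega
  set p := 4 * c * (k + 3) with hp
  set w := t / (4 * c) with hw
  have hwt : w * (4 * c) ≤ t := Nat.div_mul_le_self _ _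
  have hwt2 : t < (w + 1) * (4 * c) := by
    have := Nat.lt_div_mul_add (a := t) (b := 4 * c) (by omega)
    rw [add_mul, one_mul]; exact this
  have hw1 : w * (c + 1) ≤ t := le_trans (Nat.mul_le_mul_left _ (by omega)) hwt
  have hB := card_Bad par w hw1 ball hb p (a2 * l) N
  set W := Fintype.card (Om c s t)
  set X := (univ.filter (fun T : Om c s t => Bad par w ball p (a2 * l) N T)).card
  have hwp : (2 + k) * t ≤ w * p := by
    have : (w + 1) * (4 * c) * (k + 3) ≥ t * (k + 3) := Nat.mul_le_mul_right _ hwt2.le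
    have e1 : (w + 1) * (4 * c) * (k + 3) = w * p + p := by rw [hp]; ring
    have e2 : t * (k + 3) = (2 + k) * t + t := by ring
    omega
  have hR : (N + 1) ^ (a2 * l) * (2 ^ (a2 * l) * (2 ^ (a2 * l) * g0 c (a2 * l)) ^ p * (2 ^ t * W))
      ≤ 2 ^ (2 * t) * W := by
    calc (N + 1) ^ (a2 * l) * (2 ^ (a2 * l) * (2 ^ (a2 * l) * g0 c (a2 * l)) ^ p * (2 ^ t * W))
        ≤ (2 ^ (a1 * l)) ^ (a2 * l) * (2 ^ (a2 * l) * (2 ^ (a2 * l) *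
            2 ^ (4 * (a2 * l) + c + 2)) ^ p * (2 ^ t * W)) := by
          gcongr
          exact g0_le c (a2 * l)
      _ = 2 ^ (a1 * l * (a2 * l) + (a2 * l + (a2 * l + (4 * (a2 * l) + c + 2)) * p + t)) * W := by
          rw [← pow_add, ← pow_mul, ← pow_mul]
          simp only [← mul_assoc, ← pow_add]
      _ ≤ 2 ^ (2 * t) * W := by
          gcongr
          · norm_num
          · have : a1 * l * (a2 * l) + (a2 * l + (a2 * l + (4 * (a2 * l) + c + 2)) * p)
              ≤ (a1 * a2 + a2 + (a2 + (4 * a2 + c + 2)) * p) * l ^ 2 := by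
              have hll : l ≤ l ^ 2 := by nlinarith
              have h1l : 1 ≤ l ^ 2 := by nlinarith
              calc a1 * l * (a2 * l) + (a2 * l + (a2 * l + (4 * (a2 * l) + c + 2)) * p)
                  = a1 * a2 * l ^ 2 + (a2 * l + (a2 * l + (4 * (a2 * l) + c * 1 + 2 * 1)) * p) := by ring
                _ ≤ a1 * a2 * l ^ 2 + (a2 * l ^ 2 + (a2 * l ^ 2 + (4 * (a2 * l ^ 2) + c * l ^ 2 + 2 * l ^ 2)) * p) := by
                    gcongr
                _ = _ := by ring
            omega
  have h1 : X * 2 ^ ((2 + k) * t) ≤ 2 ^ (2 * t) * W := by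
    refine le_trans ?_ (hB.trans hR)
    rw [← pow_mul]
    gcongr
    norm_num
  have h2 : 2 ^ (2 * t) * (X * 2 ^ (k * t)) ≤ 2 ^ (2 * t) * W := by
    refine le_trans (le_of_eq ?_) h1
    rw [add_mul, pow_add]; ring
  exact Nat.le_of_mul_le_mul_left h2 (by positivity)

/-- high probability bound in counting form -/
lemma hp_count (c k : ℕ) (hc : 1 ≤ c) : ∃ A t0 : ℕ, ∀ t, t0 ≤ t → ∀ (s : ℕ)
    (ball : Fin (2 ^ t) → Fin c → Bits s) (rule : Fin (2 ^ t) → (Bits t → ℕ) → Bool),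
    Function.Injective ball →
    (univ.filter (fun T : Om c s t => ∃ ρ, A * (Nat.log 2 t + 1) ≤
      LL ball rule T (2 ^ t) ρ)).card * 2 ^ (k * t) ≤ 2 * Fintype.card (Om c s t) := by
  set p := 4 * c * (k + 3) with hp
  set B := (p^c+1)*(5+(2*c+1)*p)+p^c+p+2^(p+p*c)+p+1 with hB
  obtain ⟨t1, ht1⟩ := bad_small c k ((B + 1) * (k + 2) + 1) (2 * p * (k + 2) + p + 1) hc
  refine ⟨B * (k + 2), t1, fun t ht s ball rule hb => ?_⟩
  set l := Nat.log 2 t + 1 with hl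
  have hl1 : 1 ≤ l := by omega
  have hbad := ht1 t ht s (hpr B) ball hb ((B + 1) ^ ((k + 2) * l)) ?_
  swap
  · have h1 : (B + 1) ^ ((k + 2) * l) ≤ 2 ^ ((B + 1) * ((k + 2) * l)) := by
      rw [pow_mul 2]
      gcongr
      exact Nat.lt_two_pow_self.le
    have h0 : 1 ≤ 2 ^ ((B + 1) * ((k + 2) * l)) := Nat.one_le_two_pow
    calc (B + 1) ^ ((k + 2) * l) + 1 ≤ 2 ^ ((B + 1) * ((k + 2) * l) + 1) := by
          rw [pow_succ]; omega
      _ ≤ 2 ^ (((B + 1) * (k + 2) + 1) * l) := by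
          apply Nat.pow_le_pow_right (by norm_num)
          calc (B + 1) * ((k + 2) * l) + 1 ≤ (B + 1) * ((k + 2) * l) + l := by omega
            _ = _ := by ring
  have hF := card_FinalH (c := c) (s := s) (t := t) ball ((k + 1) * t)
  set W := Fintype.card (Om c s t)
  have hF' : (univ.filter (fun T : Om c s t =>
      Final (hpr 5) ball (Finset.Icc 1 (5 * ((k + 1) * t))) T)).card * 2 ^ (k * t) ≤ W := by
    have : 2 ^ t * ((univ.filter (fun T : Om c s t =>
      Final (hpr 5) ball (Finset.Icc 1 (5 * ((k + 1) * t))) T)).card * 2 ^ (k * t)) ≤ 2 ^ t * W := by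
      refine le_trans (le_of_eq ?_) hF
      rw [add_mul k 1 t, pow_add, one_mul]; ring
    exact Nat.le_of_mul_le_mul_left this (by positivity)
  have hsub : (univ.filter (fun T : Om c s t => ∃ ρ, B * (k + 2) * l ≤ LL ball rule T (2 ^ t) ρ))
      ⊆ (univ.filter (fun T : Om c s t => Bad (hpr B) (t / (4 * c)) ball p
          ((2 * p * (k + 2) + p + 1) * l) ((B + 1) ^ ((k + 2) * l)) T)) ∪
        (univ.filter (fun T : Om c s t =>
          Final (hpr 5) ball (Finset.Icc 1 (5 * ((k + 1) * t))) T)) := by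
    intro T hT
    obtain ⟨ρ, hρ⟩ := (Finset.mem_filter.1 hT).2
    rw [Finset.mem_union, Finset.mem_filter, Finset.mem_filter]
    by_cases hbd : Bad (hpr B) (t / (4 * c)) ball p
          ((2 * p * (k + 2) + p + 1) * l) ((B + 1) ^ ((k + 2) * l)) T
    · exact Or.inl ⟨Finset.mem_univ _, hbd⟩
    · refine Or.inr ⟨Finset.mem_univ _, ?_⟩
      refine hp_det ball hb rule T B ((k + 2) * l) ((k + 1) * t) p _ _ hB.ge ?_ ?_ ?_ ?_ hbd ρ ?_
      · calc 2 * p * ((k + 2) * l) = 2 * p * (k + 2) * l := by ring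
          _ ≤ _ := Nat.mul_le_mul_right _ (by omega)
      · nlinarith [Nat.zero_le (2 * p * (k + 2))]
      · have h1 : t < 2 ^ l := Nat.lt_pow_succ_log_self (by norm_num) t
        have h2 : k + 1 ≤ 2 ^ (k + 1) := Nat.lt_two_pow_self.le
        calc (k + 1) * t < (k + 1) * 2 ^ l := by
              exact Nat.mul_lt_mul_of_pos_left h1 (by omega)
          _ ≤ 2 ^ (k + 1) * 2 ^ l := Nat.mul_le_mul_right _ h2
          _ = 2 ^ (k + 1 + l) := (pow_add 2 (k + 1) l).symm
          _ ≤ _ := by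
            apply Nat.pow_le_pow_right (by norm_num)
            nlinarith
      · nlinarith
      · rw [← mul_assoc]; exact hρ
  have hcard := (Finset.card_le_card hsub).trans (Finset.card_union_le _ _)
  calc _ ≤ _ := Nat.mul_le_mul_right _ hcard
    _ ≤ 2 * W := by
      rw [add_mul, Nat.two_mul W]; exact Nat.add_le_add hbad hF'

/-- bound for the expectation part in counting form -/
lemma ex_count (c : ℕ) (hc : 1 ≤ c) : ∃ B t0 : ℕ, ∀ t, t0 ≤ t → ∀ (s : ℕ)
    (ball : Fin (2 ^ t) → Fin c → Bits s) (rule : Fin (2 ^ t) → (Bits t → ℕ) → Bool),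
    Function.Injective ball →
    (univ.filter (fun T : Om c s t => ∃ ρ, Nat.log 2 t + B ≤
      LL ball rule T (2 ^ t) ρ)).card * 2 ^ (t / 2) ≤ (2 + 2 ^ (c + 1)) * Fintype.card (Om c s t) := by
  set p := 4 * c * (1 + 3) with hp
  set E1 := (2*c+1)*p+2^(p+p*c+p*c)*(2*c) with hE1
  set B := (p^c+1)*(E1+1)+p^c+p+2^(p+p*c)+p+2 with hB
  obtain ⟨t1, ht1⟩ := bad_small c 1 (B + 9) (16 * p + p + 1 + 8 * (p + p * c + p * c)) hc
  refine ⟨B + 7, t1, fun t ht s ball rule hb => ?_⟩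
  set l := Nat.log 2 t + 1 with hl
  have hl1 : 1 ≤ l := by omega
  have hbad := ht1 t ht s (bpr B) ball hb (B * 2 ^ (l + 1 + 5) + 1) ?_
  swap
  · have h0 : B + 2 ≤ 2 ^ (B + 2) := Nat.lt_two_pow_self.le
    have h1 : 1 ≤ 2 ^ (l + 1 + 5) := Nat.one_le_two_pow
    calc B * 2 ^ (l + 1 + 5) + 1 + 1 ≤ (B + 2) * 2 ^ (l + 1 + 5) := by
          rw [add_mul B 2]; generalize B * 2 ^ (l + 1 + 5) = z; omega
      _ ≤ 2 ^ (B + 2) * 2 ^ (l + 1 + 5) := Nat.mul_le_mul_right _ h0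
      _ = 2 ^ (B + 2 + (l + 1 + 5)) := by rw [← pow_add]
      _ ≤ _ := by
        apply Nat.pow_le_pow_right (by norm_num)
        nlinarith
  have hF := card_FinalE (c := c) (s := s) (t := t) ball (l + 1)
  have hF5 := card_F5 (c := c) (s := s) (t := t) (t / (4 * c)) ball hb
  have ht2 : t / 2 ≤ t := Nat.div_le_self _ _
  have htlt : t < 2 ^ l := Nat.lt_pow_succ_log_self (by norm_num) t
  set w := t / (4 * c) with hw
  set W := Fintype.card (Om c s t)
  set X1 := (univ.filter (fun T : Om c s t => Bad (bpr B) w ball p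
          ((16 * p + p + 1 + 8 * (p + p * c + p * c)) * l) (B * 2 ^ (l + 1 + 5) + 1) T)) with hX1
  set X2 := (univ.filter (fun T : Om c s t => ¬ F5 w ball T)) with hX2
  set X3 := (univ.filter (fun T : Om c s t => Final clr ball
    ((Finset.range (2 ^ (l + 1 + 5))).filter (fun v => v ≠ 0 ∧ clr v < 2 ^ (l + 1))) T)) with hX3
  have b1 : X1.card * 2 ^ (t / 2) ≤ W := by
    refine le_trans (Nat.mul_le_mul_left _ ?_) hbad
    apply Nat.pow_le_pow_right (by norm_num)
    omega
  have b3 : X3.card * 2 ^ (t / 2) ≤ W := by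
    have : 2 ^ t * (X3.card * 2 ^ (t / 2)) ≤ 2 ^ t * W := by
      refine le_trans ?_ hF
      have : 2 ^ t * (X3.card * 2 ^ (t / 2)) = X3.card * 2 ^ (t + t / 2) := by
        rw [pow_add]; ring
      rw [this]
      apply Nat.mul_le_mul_left
      apply Nat.pow_le_pow_right (by norm_num)
      rw [pow_succ]
      omega
    exact Nat.le_of_mul_le_mul_left this (by positivity)
  have b2 : X2.card * 2 ^ (t / 2) ≤ 2 ^ (c + 1) * W := by
    have hwt : w * (4 * c) ≤ t := Nat.div_mul_le_self _ _
    have hx : (2 ^ w * 2 ^ w + 1) ^ c ≤ 2 ^ (t / 2 + c) := by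
      have h0 : 1 ≤ 2 ^ w * 2 ^ w := by
        rw [← pow_add]; exact Nat.one_le_two_pow
      calc (2 ^ w * 2 ^ w + 1) ^ c ≤ (2 * (2 ^ w * 2 ^ w)) ^ c := by gcongr; omega
        _ = 2 ^ ((1 + (w + w)) * c) := by
          rw [← pow_add, ← pow_succ', ← pow_mul, add_comm 1]
        _ ≤ _ := by
          apply Nat.pow_le_pow_right (by norm_num)
          have : (1 + (w + w)) * c = c + 2 * (w * c) := by ring
          have h4 : w * (4 * c) = 4 * (w * c) := by ring
          omega
    have : 2 ^ (t / 2) * (X2.card * 2 ^ (t / 2)) ≤ 2 ^ (t / 2) * (2 ^ (c + 1) * W) := by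
      calc 2 ^ (t / 2) * (X2.card * 2 ^ (t / 2)) = X2.card * 2 ^ (t / 2 + t / 2) := by
            rw [pow_add]; ring
        _ ≤ X2.card * 2 ^ t := by
            apply Nat.mul_le_mul_left
            apply Nat.pow_le_pow_right (by norm_num)
            omega
        _ ≤ _ := hF5
        _ ≤ 2 * 2 ^ (t / 2 + c) * W := by gcongr
        _ = _ := by rw [pow_add, pow_succ]; ring
    exact Nat.le_of_mul_le_mul_left this (by positivity)
  have hsub : (univ.filter (fun T : Om c s t => ∃ ρ, Nat.log 2 t + (B + 7) ≤
      LL ball rule T (2 ^ t) ρ)) ⊆ X1 ∪ X2 ∪ X3 := by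
    intro T hT
    obtain ⟨ρ, hρ⟩ := (Finset.mem_filter.1 hT).2
    by_contra hno
    simp only [Finset.mem_union, not_or] at hno
    obtain ⟨⟨n1, n2⟩, n3⟩ := hno
    have n1' : ¬ Bad (bpr B) w ball p
          ((16 * p + p + 1 + 8 * (p + p * c + p * c)) * l) (B * 2 ^ (l + 1 + 5) + 1) T :=
      fun h => n1 (Finset.mem_filter.2 ⟨Finset.mem_univ _, h⟩)
    have n2' : F5 w ball T := by
      by_contra h
      exact n2 (Finset.mem_filter.2 ⟨Finset.mem_univ _, h⟩)
    refine n3 (Finset.mem_filter.2 ⟨Finset.mem_univ _, ?_⟩)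
    refine ex_det ball hb rule T B (l + 1) p _ w E1 hE1 hB.ge ?_ ?_ ?_ n1' n2' ρ (by omega)
    · calc 2 * p * (l + 1 + 6) ≤ 2 * p * (8 * l) := Nat.mul_le_mul_left _ (by omega)
        _ = (16 * p) * l := by ring
        _ ≤ _ := Nat.mul_le_mul_right _ (by omega)
    · calc p + 1 = (p + 1) * 1 := by ring
        _ ≤ (p + 1) * l := Nat.mul_le_mul_left _ hl1
        _ ≤ _ := Nat.mul_le_mul_right _ (by omega)
    · calc (p + p * c + p * c) * (l + 1 + 6) ≤ (p + p * c + p * c) * (8 * l) :=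
            Nat.mul_le_mul_left _ (by omega)
        _ = (8 * (p + p * c + p * c)) * l := by ring
        _ ≤ _ := Nat.mul_le_mul_right _ (by omega)
  have hcard := ((Finset.card_le_card hsub).trans (Finset.card_union_le _ _)).trans
    (Nat.add_le_add_right (Finset.card_union_le _ _) _)
  calc _ ≤ _ := Nat.mul_le_mul_right _ hcard
    _ ≤ (2 + 2 ^ (c + 1)) * W := by
      rw [add_mul, add_mul, add_mul]; omega

end
end TC



namespace TC
section
variable {c s t : ℕ}

/-- the maximum load -/
noncomputable def Mx (ball : Fin (2 ^ t) → Fin c → Bits s)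
    (rule : Fin (2 ^ t) → (Bits t → ℕ) → Bool) (T : Om c s t) : ℕ :=
  Finset.univ.sup (twoChoiceLoad (simpleTab T.1) (simpleTab T.2) ball rule (2 ^ t))

lemma Mx_le (ball : Fin (2 ^ t) → Fin c → Bits s)
    (rule : Fin (2 ^ t) → (Bits t → ℕ) → Bool) (T : Om c s t) : Mx ball rule T ≤ 2 ^ t :=
  Finset.sup_le (fun b _ => LL_le ball rule T b (2 ^ t))

lemma Mx_ge (ball : Fin (2 ^ t) → Fin c → Bits s)
    (rule : Fin (2 ^ t) → (Bits t → ℕ) → Bool) (T : Om c s t) (K : ℕ)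
    (h : K ≤ Mx ball rule T) : ∃ ρ, K ≤ LL ball rule T (2 ^ t) ρ := by
  obtain ⟨ρ, _, hρ⟩ := Finset.exists_mem_eq_sup (univ : Finset (Bits t)) Finset.univ_nonempty
    (twoChoiceLoad (simpleTab T.1) (simpleTab T.2) ball rule (2 ^ t))
  refine ⟨ρ, ?_⟩
  unfold Mx at h
  rw [hρ] at h
  exact h

lemma Om_pos : 0 < Fintype.card (Om c s t) := Fintype.card_pos

/-- bound of the total load -/
lemma ex_sum (c : ℕ) (hc : 1 ≤ c) : ∃ K t0 : ℕ, ∀ t, t0 ≤ t → ∀ (s : ℕ)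
    (ball : Fin (2 ^ t) → Fin c → Bits s) (rule : Fin (2 ^ t) → (Bits t → ℕ) → Bool),
    Function.Injective ball →
    ∑ T : Om c s t, Mx ball rule T ≤ (Nat.log 2 t + K) * Fintype.card (Om c s t) := by
  obtain ⟨B, t1, h1⟩ := ex_count c hc
  obtain ⟨A, t2, h2⟩ := hp_count c 1 hc
  obtain ⟨t3, h3⟩ := log_small 2
  refine ⟨B + A * (2 + 2 ^ (c + 1)) + 2, t1 + t2 + t3, fun t ht s ball rule hb => ?_⟩
  have g1 := h1 t (by omega) s ball rule hb
  have g2 := h2 t (by omega) s ball rule hb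
  have g3 := h3 t (by omega)
  set l := Nat.log 2 t with hl
  set W := Fintype.card (Om c s t) with hW
  set X := (univ.filter (fun T : Om c s t => ∃ ρ, l + B ≤ LL ball rule T (2 ^ t) ρ)) with hX
  set Y := (univ.filter (fun T : Om c s t => ∃ ρ, A * (l + 1) ≤ LL ball rule T (2 ^ t) ρ)) with hY
  have hpt : ∀ T : Om c s t, Mx ball rule T ≤
      (l + B) + (if T ∈ X then A * (l + 1) else 0) + (if T ∈ Y then 2 ^ t else 0) := by
    intro T
    by_cases hT : T ∈ Y
    · have := Mx_le ball rule T
      rw [if_pos hT]; omega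
    · have hlt : Mx ball rule T < A * (l + 1) := by
        by_contra hh
        exact hT (Finset.mem_filter.2 ⟨Finset.mem_univ _, Mx_ge ball rule T _ (by omega)⟩)
      by_cases hT' : T ∈ X
      · rw [if_pos hT']; omega
      · have : Mx ball rule T < l + B := by
          by_contra hh
          exact hT' (Finset.mem_filter.2 ⟨Finset.mem_univ _, Mx_ge ball rule T _ (by omega)⟩)
        omega
  have hsum : ∑ T : Om c s t, Mx ball rule T ≤ W * (l + B) + X.card * (A * (l + 1)) + Y.card * 2 ^ t := by
    refine (Finset.sum_le_sum (fun T _ => hpt T)).trans (le_of_eq ?_)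
    rw [Finset.sum_add_distrib, Finset.sum_add_distrib, Finset.sum_const, Finset.card_univ,
      ← Finset.sum_filter, ← Finset.sum_filter, Finset.sum_const, Finset.sum_const]
    simp [hW]
  have hl2 : l + 1 ≤ 2 ^ (t / 2) := by
    have : l + 1 ≤ t / 2 := by
      have : (l + 1) ≤ (l + 1) ^ 2 := by nlinarith
      omega
    exact this.trans Nat.lt_two_pow_self.le
  have hXb : X.card * (A * (l + 1)) ≤ A * (2 + 2 ^ (c + 1)) * W := by
    calc X.card * (A * (l + 1)) = A * (X.card * (l + 1)) := by ring
      _ ≤ A * (X.card * 2 ^ (t / 2)) := by gcongr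
      _ ≤ A * ((2 + 2 ^ (c + 1)) * W) := by gcongr
      _ = _ := by ring
  rw [one_mul] at g2
  calc _ ≤ _ := hsum
    _ ≤ W * (l + B) + A * (2 + 2 ^ (c + 1)) * W + 2 * W := by gcongr
    _ = _ := by ring

lemma logb_log (t : ℕ) : Real.logb 2 (Real.logb 2 ((2 : ℝ) ^ t)) = Real.logb 2 t := by
  congr 1
  rw [← Real.rpow_natCast, Real.logb_rpow (by norm_num) (by norm_num)]

lemma log_le_logb (t : ℕ) : (Nat.log 2 t : ℝ) ≤ Real.logb 2 t := by
  exact_mod_cast Real.natLog_le_logb t 2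

lemma loglog_eq (t : ℕ) : Real.log (Real.log ((2 : ℝ) ^ t)) = Real.log (t * Real.log 2) := by
  rw [Real.log_pow]

lemma loglog_lower (t : ℕ) (ht : 4 ≤ t) :
    ((Nat.log 2 t + 1 : ℕ) : ℝ) ≤ 6 * Real.log (Real.log ((2 : ℝ) ^ t)) := by
  rw [loglog_eq]
  have hln := Real.log_two_gt_d9
  have ht' : (4 : ℝ) ≤ t := by exact_mod_cast ht
  have h1 : Real.log t ≤ 2 * Real.log (t * Real.log 2) := by
    have : 2 * Real.log (t * Real.log 2) = Real.log ((t * Real.log 2) ^ 2) := by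
      rw [Real.log_pow]; norm_num
    rw [this]
    apply Real.log_le_log (by linarith)
    have a : (0.6931 : ℝ) ^ 2 ≤ Real.log 2 ^ 2 := by
      apply pow_le_pow_left₀ (by norm_num); linarith
    rw [mul_pow]
    nlinarith
  have h2 := log_le_logb t
  have h3 : Real.log 2 ≤ Real.log t := Real.log_le_log (by norm_num) (by linarith)
  have h4 : Real.logb 2 t + 1 ≤ 3 * Real.log t := by
    unfold Real.logb
    rw [div_add_one (by linarith), div_le_iff₀ (by linarith)]
    nlinarith
  push_cast
  linarith

end
end TC

open TC
/-- Power of two choices with simple tabulation: for every constant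
`c ≥ 1` there are a constant `C` and, for every `γ > 0`, a constant `C_γ` such that
when `n = 2^t` balls with distinct keys are inserted sequentially into `n` bins, each
into the lighter of its two bins under two independent random simple tabulation
functions (ties broken by any fixed rule), the expected maximum load is at most
`log₂ log₂ n + C`, and with probability at least `1 − n^{−γ}` the maximum load is at
most `C_γ · log log n`. -/
theorem two_choices_simple_tabulation (c : ℕ) (hc : 1 ≤ c) :
    ∃ C : ℝ,
      (∀ (s t : ℕ), 2 ≤ t →
        ∀ (ball : Fin (2 ^ t) → (Fin c → Bits s))
          (rule : Fin (2 ^ t) → (Bits t → ℕ) → Bool),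
          Function.Injective ball →
          Ex (fun T : (Fin c → Bits s → Bits t) × (Fin c → Bits s → Bits t) =>
              ((Finset.univ.sup
                (twoChoiceLoad (simpleTab T.1) (simpleTab T.2) ball rule (2 ^ t)) : ℕ) : ℝ)) ≤
            Real.logb 2 (Real.logb 2 ((2 : ℝ) ^ t)) + C) ∧
      (∀ γ : ℝ, 0 < γ → ∃ Cγ : ℝ,
        ∀ (s t : ℕ), 2 ≤ t →
        ∀ (ball : Fin (2 ^ t) → (Fin c → Bits s))
          (rule : Fin (2 ^ t) → (Bits t → ℕ) → Bool),
          Function.Injective ball →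
          1 - ((2 : ℝ) ^ t) ^ (-γ) ≤
            Pr (fun T : (Fin c → Bits s → Bits t) × (Fin c → Bits s → Bits t) =>
              ((Finset.univ.sup
                  (twoChoiceLoad (simpleTab T.1) (simpleTab T.2) ball rule (2 ^ t)) : ℕ) : ℝ) ≤
                Cγ * Real.log (Real.log ((2 : ℝ) ^ t)))) := by
  obtain ⟨K, t1, h1⟩ := ex_sum c hc
  refine ⟨2 ^ t1 + K, ?_, ?_⟩
  · intro s t ht ball rule hb
    rw [logb_log]
    have hW : (0 : ℝ) < (Fintype.card (Om c s t) : ℝ) := by exact_mod_cast Om_pos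
    show (∑ T : Om c s t, ((Mx ball rule T : ℕ) : ℝ)) / (Fintype.card (Om c s t) : ℝ) ≤ _
    rw [div_le_iff₀ hW]
    have hlog := log_le_logb t
    have hlog0 : (0 : ℝ) ≤ (Nat.log 2 t : ℝ) := by positivity
    rcases Nat.lt_or_ge t t1 with hlt | hge
    · calc (∑ T : Om c s t, ((Mx ball rule T : ℕ) : ℝ)) ≤ ∑ T : Om c s t, (2 : ℝ) ^ t1 := by
            apply Finset.sum_le_sum
            intro T _
            have : Mx ball rule T ≤ 2 ^ t1 :=
              (Mx_le ball rule T).trans (Nat.pow_le_pow_right (by norm_num) hlt.le)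
            exact_mod_cast this
        _ = 2 ^ t1 * (Fintype.card (Om c s t) : ℝ) := by
            rw [Finset.sum_const, Finset.card_univ, nsmul_eq_mul, mul_comm]
        _ ≤ _ := by
            apply mul_le_mul_of_nonneg_right _ hW.le
            have : (0 : ℝ) ≤ K := by positivity
            linarith
    · have := h1 t hge s ball rule hb
      have h' : (∑ T : Om c s t, ((Mx ball rule T : ℕ) : ℝ)) ≤
          ((Nat.log 2 t : ℝ) + K) * (Fintype.card (Om c s t) : ℝ) := by exact_mod_cast this
      refine h'.trans ?_
      apply mul_le_mul_of_nonneg_right _ hW.le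
      have : (0 : ℝ) ≤ 2 ^ t1 := by positivity
      linarith
  · intro γ hγ
    obtain ⟨G, hG⟩ := exists_nat_ge γ
    obtain ⟨A, t2, h2⟩ := hp_count c (G + 1) hc
    have hlam : 0 < Real.log (2 * Real.log 2) := by
      apply Real.log_pos
      have := Real.log_two_gt_d9
      linarith
    refine ⟨6 * A + 2 ^ (t2 + 4) / Real.log (2 * Real.log 2), ?_⟩
    intro s t ht ball rule hb
    have hW : (0 : ℝ) < (Fintype.card (Om c s t) : ℝ) := by exact_mod_cast Om_pos
    have hln := Real.log_two_gt_d9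
    have ht2 : (2 : ℝ) ≤ t := by exact_mod_cast ht
    have hll : Real.log (2 * Real.log 2) ≤ Real.log (Real.log ((2 : ℝ) ^ t)) := by
      rw [loglog_eq]
      apply Real.log_le_log (by linarith)
      apply mul_le_mul_of_nonneg_right ht2 (by linarith)
    set lam := Real.log (2 * Real.log 2) with hlamd
    set LLn := Real.log (Real.log ((2 : ℝ) ^ t)) with hLLn
    show _ ≤ ((univ.filter (fun T : Om c s t => ((Mx ball rule T : ℕ) : ℝ) ≤
      (6 * A + 2 ^ (t2 + 4) / lam) * LLn)).card : ℝ) / (Fintype.card (Om c s t) : ℝ)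
    rw [le_div_iff₀ hW]
    have hA0 : (0 : ℝ) ≤ 6 * A := by positivity
    have hq0 : (0 : ℝ) ≤ 2 ^ (t2 + 4) / lam := by positivity
    rcases Nat.lt_or_ge t (t2 + 4) with hlt | hge
    · have hall : univ.filter (fun T : Om c s t => ((Mx ball rule T : ℕ) : ℝ) ≤
          (6 * A + 2 ^ (t2 + 4) / lam) * LLn) = univ := by
        apply Finset.filter_true_of_mem
        intro T _
        have : Mx ball rule T ≤ 2 ^ (t2 + 4) :=
          (Mx_le ball rule T).trans (Nat.pow_le_pow_right (by norm_num) hlt.le)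
        calc ((Mx ball rule T : ℕ) : ℝ) ≤ 2 ^ (t2 + 4) := by exact_mod_cast this
          _ = 2 ^ (t2 + 4) / lam * lam := by field_simp
          _ ≤ 2 ^ (t2 + 4) / lam * LLn := by gcongr
          _ ≤ _ := by
            apply mul_le_mul_of_nonneg_right _ (by linarith)
            linarith
      rw [hall, Finset.card_univ]
      have : (0 : ℝ) ≤ ((2 : ℝ) ^ t) ^ (-γ) := by positivity
      nlinarith
    · have hcnt := h2 t (by omega) s ball rule hb
      have hlow := loglog_lower t (by omega)
      rw [← hLLn] at hlow
      set l := Nat.log 2 t + 1 with hl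
      set X := (univ.filter (fun T : Om c s t => ∃ ρ, A * l ≤ LL ball rule T (2 ^ t) ρ)) with hX
      set Y := (univ.filter (fun T : Om c s t => ((Mx ball rule T : ℕ) : ℝ) ≤
          (6 * A + 2 ^ (t2 + 4) / lam) * LLn)) with hY
      have hcov : (univ : Finset (Om c s t)) ⊆ X ∪ Y := by
        intro T _
        rw [Finset.mem_union]
        by_cases hT : A * l ≤ Mx ball rule T
        · exact Or.inl (Finset.mem_filter.2 ⟨Finset.mem_univ _, Mx_ge ball rule T _ hT⟩)
        · refine Or.inr (Finset.mem_filter.2 ⟨Finset.mem_univ _, ?_⟩)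
          have h3 : Mx ball rule T ≤ A * l := by omega
          calc ((Mx ball rule T : ℕ) : ℝ) ≤ (A : ℝ) * (l : ℝ) := by exact_mod_cast h3
            _ ≤ A * (6 * LLn) := by gcongr
            _ = 6 * A * LLn := by ring
            _ ≤ _ := by
              apply mul_le_mul_of_nonneg_right _ (by linarith)
              linarith
      have hle := (Finset.card_le_card hcov).trans (Finset.card_union_le _ _)
      rw [Finset.card_univ] at hle
      have hleR : (Fintype.card (Om c s t) : ℝ) ≤ (X.card : ℝ) + (Y.card : ℝ) := by exact_mod_cast hle
      have hXR : (X.card : ℝ) * 2 ^ ((G + 1) * t) ≤ 2 * (Fintype.card (Om c s t) : ℝ) := by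
        exact_mod_cast hcnt
      have hpw : (2 : ℝ) ≤ ((2 : ℝ) ^ t) ^ (-γ) * 2 ^ ((G + 1) * t) := by
        rw [← Real.rpow_natCast, ← Real.rpow_natCast, ← Real.rpow_mul (by norm_num),
          ← Real.rpow_add (by norm_num)]
        calc (2 : ℝ) = 2 ^ (1 : ℝ) := by rw [Real.rpow_one]
          _ ≤ _ := by
            apply Real.rpow_le_rpow_of_exponent_le (by norm_num)
            push_cast
            nlinarith
      have hXb : (X.card : ℝ) ≤ ((2 : ℝ) ^ t) ^ (-γ) * (Fintype.card (Om c s t) : ℝ) := by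
        have hpp : (0 : ℝ) < 2 ^ ((G + 1) * t) := by positivity
        refine le_of_mul_le_mul_right ?_ hpp
        calc _ ≤ _ := hXR
          _ ≤ (((2 : ℝ) ^ t) ^ (-γ) * 2 ^ ((G + 1) * t)) * (Fintype.card (Om c s t) : ℝ) := by gcongr
          _ = _ := by ring
      linarith
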